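/- Let α, β, γ be partitions of equal size such that the Kronecker coefficient g_{dα,dβ,dγ} = 1 for all positive integers d (i.e., (α,β,γ) is a Kronecker-stable triple with each dilated coefficient equal to 1). Then (α, β; γ) is Aguiar-stable: for every triple of partitions (λ,μ,ν), the sequence d ↦ a_{λ+dα,μ+dβ}^{ν+dγ} is eventually constant. -/

import Mathlib

open scoped BigOperators
open scoped Classical

/-- A partition: a finitely supported antitone sequence of natural numbers
(the parts, indexed from 0). -/
def IsPartitionFun (f : ℕ →₀ ℕ) : Prop := ∀ ⦃i j : ℕ⦄, i ≤ j → f j ≤ f i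

def Partition' : Type := {f : ℕ →₀ ℕ // IsPartitionFun f}

namespace Partition'

/-- The size `|λ|` of a partition. -/
def size (l : Partition') : ℕ := l.1.sum fun _ v => v

/-- The number of (nonzero) parts of a partition. -/
def plength (l : Partition') : ℕ := l.1.support.card

noncomputable instance : Add Partition' :=
  ⟨fun l m => ⟨l.1 + m.1, fun i j h => by
    simp only [Finsupp.add_apply]
    exact add_le_add (l.2 h) (m.2 h)⟩⟩

noncomputable instance : SMul ℕ Partition' :=
  ⟨fun d l => ⟨d • l.1, fun i j h => by
    simp only [Finsupp.smul_apply, smul_eq_mul]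
    exact Nat.mul_le_mul_left d (l.2 h)⟩⟩

/-- The one-row partition `(m)`. For `m = 0` this is the empty partition. -/
noncomputable def row (m : ℕ) : Partition' :=
  ⟨Finsupp.single 0 m, by
    intro i j h
    simp only [Finsupp.single_apply]
    split_ifs <;> omega⟩

/-- The two-row partition `(a, b)` (with `b ≤ a`). -/
noncomputable def twoRow (a b : ℕ) (hba : b ≤ a) : Partition' :=
  ⟨Finsupp.single 0 a + Finsupp.single 1 b, by
    intro i j h
    simp only [Finsupp.add_apply, Finsupp.single_apply]
    split_ifs <;> omega⟩

/-- `youngCount n a g` is the number of fixed points of the permutation `g` acting on the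
set of functions `Fin n → Fin n` whose fibre over `i` has exactly `a i` elements; i.e. the
value at `g` of the permutation character of `S_n` acting on cosets of the Young subgroup
attached to the composition `a`. It is `0` if some `a i` is negative. -/
noncomputable def youngCount (n : ℕ) (a : Fin n → ℤ) (g : Equiv.Perm (Fin n)) : ℤ :=
  if ∀ i, 0 ≤ a i then
    (Nat.card {f : Fin n → Fin n //
      f ∘ g = f ∧ ∀ i : Fin n, Nat.card {x : Fin n // f x = i} = (a i).toNat} : ℤ)
  else 0

/-- The irreducible character of the symmetric group `S_n` attached to a partition `l`
of `n`, given by the Jacobi–Trudi determinantal formula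
`χ_l = det (h_{l_i - i + j})` expanded over permutations, where `h`-products are the
permutation characters of Young subgroups. (When `size l ≠ n` this is not used.) -/
noncomputable def irrChar (n : ℕ) (l : Partition') (g : Equiv.Perm (Fin n)) : ℤ :=
  ∑ σ : Equiv.Perm (Fin n), (Equiv.Perm.sign σ : ℤ) *
    youngCount n (fun i => (l.1 i : ℤ) + ((σ i : ℕ) : ℤ) - (i : ℤ)) g

/-- The Kronecker coefficient `g_{λ,μ,ν}`: the multiplicity of the irreducible `S_n`-module
`M_ν` in `M_λ ⊗ M_μ` (for `|λ| = |μ| = |ν| = n`), computed as the scalar product of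
characters `(1/n!) ∑_{g ∈ S_n} χ_λ(g) χ_μ(g) χ_ν(g)`; it is `0` if the sizes differ. -/
noncomputable def kron (l m nu : Partition') : ℕ :=
  if size l = size nu ∧ size m = size nu then
    ((∑ g : Equiv.Perm (Fin (size nu)),
        irrChar (size nu) l g * irrChar (size nu) m g * irrChar (size nu) nu g) /
      (Nat.factorial (size nu) : ℤ)).toNat
  else 0

/-- The standard embedding `S_a × S_b ↪ S_{a+b}`. -/
def sumEmb {a b : ℕ} (g : Equiv.Perm (Fin a)) (h : Equiv.Perm (Fin b)) :
    Equiv.Perm (Fin (a + b)) :=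
  (Equiv.permCongr finSumFinEquiv) (Equiv.sumCongr g h)

/-- The Littlewood–Richardson coefficient `c_{λ,μ}^ν`: the multiplicity of `M_ν` in the
induction of `M_λ ⊠ M_μ` from `S_{|λ|} × S_{|μ|}` to `S_{|λ|+|μ|}`, computed by
Frobenius reciprocity as a scalar product of characters; it is `0` unless
`|ν| = |λ| + |μ|`. -/
noncomputable def lr (l m nu : Partition') : ℕ :=
  if size nu = size l + size m then
    ((∑ g : Equiv.Perm (Fin (size l)), ∑ h : Equiv.Perm (Fin (size m)),
        irrChar (size l) l g * irrChar (size m) m h *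
          irrChar (size l + size m) nu (sumEmb g h)) /
      ((Nat.factorial (size l) : ℤ) * (Nat.factorial (size m) : ℤ))).toNat
  else 0

/-- The Aguiar coefficient `a_{λ,μ}^ν`, defined by
`a_{λ,μ}^ν = Σ_{α,β,δ,η,ρ,τ} c_{α,β}^λ c_{η,ρ}^μ g_{β,η,δ} c_{α,δ}^τ c_{τ,ρ}^ν`. -/
noncomputable def aguiar (l m nu : Partition') : ℕ :=
  ∑ᶠ (α : Partition') (β : Partition') (δ : Partition') (η : Partition')
    (ρ : Partition') (τ : Partition'),
    lr α β l * lr η ρ m * kron β η δ * lr α δ τ * lr τ ρ nu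

end Partition'


open scoped BigOperators
open scoped Classical

set_option linter.unusedSectionVars false
set_option linter.unusedVariables false

namespace AK

section B1
variable {ι : Type} [Fintype ι] {N : ℕ} {V : Type} [AddCommGroup V] [Module ℂ V]

structure GLRel (e : ι → Fin N → Fin N → Module.End ℂ V) : Prop where
  same : ∀ s i j k l, e s i j * e s k l =
    e s k l * e s i j + (if j = k then e s i l else 0) - (if l = i then e s k j else 0)
  diff : ∀ s t, s ≠ t → ∀ i j k l, e s i j * e t k l = e t k l * e s i j

def wt (e : ι → Fin N → Fin N → Module.End ℂ V) (κ : ι → Fin N → ℤ) : Submodule ℂ V where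
  carrier := {v | ∀ s i, e s i i v = (κ s i : ℂ) • v}
  add_mem' := by
    intro a b ha hb s i
    simp [ha s i, hb s i]
  zero_mem' := by intro s i; simp
  smul_mem' := by
    intro c v hv s i
    simp [hv s i, smul_comm c]

theorem mem_wt {e : ι → Fin N → Fin N → Module.End ℂ V} {κ : ι → Fin N → ℤ} {v : V} :
    v ∈ wt e κ ↔ ∀ s i, e s i i v = (κ s i : ℂ) • v := Iff.rfl

noncomputable def rt (s : ι) (i j : Fin N) : ι → Fin N → ℤ :=
  Pi.single s (Pi.single i 1 - Pi.single j 1)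

theorem rt_apply (s t : ι) (i j k : Fin N) :
    rt s i j t k = if t = s then (if k = i then 1 else 0) - (if k = j then 1 else 0) else 0 := by
  unfold rt
  by_cases h : t = s
  · subst h; simp [Pi.single_apply]
  · simp [h]

theorem e_mem_wt {e : ι → Fin N → Fin N → Module.End ℂ V} (he : GLRel e) {κ : ι → Fin N → ℤ}
    {v : V} (hv : v ∈ wt e κ) (s : ι) (i j : Fin N) : e s i j v ∈ wt e (κ + rt s i j) := by
  intro t k
  by_cases h : t = s
  · subst h
    have := congrArg (fun f => f v) (he.same t k k i j)
    simp only [Module.End.mul_apply, LinearMap.add_apply, LinearMap.sub_apply, hv t k, map_smul] at this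
    rw [this]
    simp only [Pi.add_apply, rt_apply, if_true]
    by_cases h1 : k = i <;> by_cases h2 : k = j
    · subst h1; subst h2; simp
    · subst h1; simp [h2, Ne.symm h2, add_smul]
    · subst h2; simp [h1, add_smul, sub_eq_add_neg]
    · simp [h1, h2, Ne.symm h2]
  · have := congrArg (fun f => f v) (he.diff t s h k k i j)
    simp only [Module.End.mul_apply, hv t k, map_smul] at this
    rw [this]
    simp [rt_apply, h]

noncomputable def cas (e : ι → Fin N → Fin N → Module.End ℂ V) : Module.End ℂ V :=
  ∑ s, ∑ i, ∑ j, e s i j * e s j i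

theorem cas_comm {e : ι → Fin N → Fin N → Module.End ℂ V} (he : GLRel e) (t : ι) (k l : Fin N) :
    e t k l * cas e = cas e * e t k l := by
  unfold cas
  rw [Finset.mul_sum, Finset.sum_mul]
  refine Finset.sum_congr rfl fun s _ => ?_
  by_cases h : t = s
  · subst h
    have key : ∀ i j, e t k l * (e t i j * e t j i) = (e t i j * e t j i) * e t k l +
        ((if l = i then e t k j * e t j i else 0) - (if j = k then e t i l * e t j i else 0)
        + (if l = j then e t i j * e t k i else 0) - (if i = k then e t i j * e t j l else 0)) := by
      intro i j
      rw [← mul_assoc, he.same t k l i j, sub_mul, add_mul, mul_assoc (e t i j), he.same t k l j i,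
        mul_sub, mul_add]
      simp only [ite_mul, mul_ite, zero_mul, mul_zero, mul_assoc]
      abel
    simp only [Finset.mul_sum, Finset.sum_mul, key, Finset.sum_add_distrib, Finset.sum_sub_distrib]
    have h1 : ∑ i, ∑ j, (if l = i then e t k j * e t j i else 0) = ∑ j, e t k j * e t j l := by
      rw [Finset.sum_comm]; simp
    have h2 : ∑ i, ∑ j, (if j = k then e t i l * e t j i else 0) = ∑ i, e t i l * e t k i := by
      simp
    have h3 : ∑ i, ∑ j, (if l = j then e t i j * e t k i else 0) = ∑ i, e t i l * e t k i := by
      simp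
    have h4 : ∑ i, ∑ j, (if i = k then e t i j * e t j l else 0) = ∑ j, e t k j * e t j l := by
      rw [Finset.sum_comm]; simp
    rw [h1, h2, h3, h4]; abel
  · simp only [Finset.mul_sum, Finset.sum_mul]
    refine Finset.sum_congr rfl fun i _ => Finset.sum_congr rfl fun j _ => ?_
    rw [← mul_assoc, he.diff t s h, mul_assoc, he.diff t s h, mul_assoc]

/-- projector lemma -/
theorem proj_exists (e : ι → Fin N → Fin N → Module.End ℂ V) (κ0 : ι → Fin N → ℤ)
    (F : Finset (ι → Fin N → ℤ)) (hF : κ0 ∉ F) :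
    ∃ P : Module.End ℂ V, (∀ W' : Submodule ℂ V, (∀ s i v, v ∈ W' → e s i i v ∈ W') →
        ∀ v ∈ W', P v ∈ W') ∧ ∃ p : (ι → Fin N → ℤ) → ℂ, (∀ κ, ∀ v ∈ wt e κ, P v = p κ • v) ∧
        p κ0 = 1 ∧ ∀ κ ∈ F, p κ = 0 := by
  induction F using Finset.induction_on with
  | empty => exact ⟨1, fun _ _ v hv => hv, fun _ => 1, by simp, rfl, by simp⟩
  | insert κ1 F hκ ih =>
    obtain ⟨P, h1, p, h2, h3, h4⟩ := ih (fun h => hF (Finset.mem_insert_of_mem h))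
    have hne : κ0 ≠ κ1 := fun h => hF (h ▸ Finset.mem_insert_self _ _)
    obtain ⟨s, hs⟩ := Function.ne_iff.1 hne
    obtain ⟨i, hi⟩ := Function.ne_iff.1 hs
    have hi' : ((κ0 s i : ℂ) - κ1 s i) ≠ 0 := by
      rw [sub_ne_zero]; exact_mod_cast hi
    refine ⟨((κ0 s i : ℂ) - κ1 s i)⁻¹ • ((e s i i - (κ1 s i : ℂ) • 1) * P), ?_,
      fun κ => ((κ0 s i : ℂ) - κ1 s i)⁻¹ * (((κ s i : ℂ) - κ1 s i) * p κ), ?_, ?_, ?_⟩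
    · intro W' hW v hv
      have := h1 W' hW v hv
      simp only [LinearMap.smul_apply, Module.End.mul_apply, LinearMap.sub_apply, Module.End.one_apply]
      exact W'.smul_mem _ (W'.sub_mem (hW _ _ _ this) (W'.smul_mem _ this))
    · intro κ v hv
      simp only [LinearMap.smul_apply, Module.End.mul_apply, LinearMap.sub_apply, Module.End.one_apply,
        h2 κ v hv, map_smul, hv s i, mul_smul, sub_smul]
      rw [smul_sub, smul_comm (p κ), smul_comm (p κ)]
    · simp only [h3, mul_one, inv_mul_cancel₀ hi']
    · intro κ hκ'
      rcases Finset.mem_insert.1 hκ' with rfl | h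
      · simp
      · simp [h4 κ h]

theorem comp_mem (e : ι → Fin N → Fin N → Module.End ℂ V) (W' : Submodule ℂ V)
    (hW : ∀ s i v, v ∈ W' → e s i i v ∈ W') (F : Finset (ι → Fin N → ℤ))
    (f : (ι → Fin N → ℤ) → V) (hf : ∀ κ ∈ F, f κ ∈ wt e κ) (hs : ∑ κ ∈ F, f κ ∈ W') :
    ∀ κ ∈ F, f κ ∈ W' := by
  intro κ hκ
  obtain ⟨P, h1, p, h2, h3, h4⟩ := proj_exists e κ (F.erase κ) (by simp)
  have := h1 W' hW _ hs
  rw [map_sum, Finset.sum_eq_single κ, h2 κ _ (hf κ hκ), h3, one_smul] at this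
  · exact this
  · intro b hb hne
    rw [h2 b _ (hf b hb), h4 b (by simp [hb, hne]), zero_smul]
  · intro h; exact absurd hκ h

structure Good (e : ι → Fin N → Fin N → Module.End ℂ V) (W : Submodule ℂ V) : Prop where
  fd : FiniteDimensional ℂ W
  st : ∀ s i j, ∀ v ∈ W, e s i j v ∈ W
  dec : W ≤ ⨆ κ, W ⊓ wt e κ

theorem wt_disj (e : ι → Fin N → Fin N → Module.End ℂ V) : iSupIndep (wt e) := by
  rw [iSupIndep_iff_finsetSum_eq_zero_imp_eq_zero]
  intro F f hf h0 i hi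
  have := comp_mem e ⊥ (by simp) F f hf (by simpa using h0)
  simpa using this i hi

theorem good_fin {e : ι → Fin N → Fin N → Module.End ℂ V} {W : Submodule ℂ V} (hW : Good e W) :
    {κ | W ⊓ wt e κ ≠ ⊥}.Finite := by
  have := hW.fd
  have h1 : iSupIndep (fun κ => (W ⊓ wt e κ).comap W.subtype) := by
    rw [iSupIndep_iff_finsetSum_eq_zero_imp_eq_zero]
    intro F f hf h0 i hi
    have h2 := comp_mem e ⊥ (by simp) F (fun κ => (f κ : V)) (fun κ h => (hf κ h).2)
      (by
        have := congrArg W.subtype h0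
        simpa using this)
    exact Subtype.ext (by simpa using h2 i hi)
  have h3 := WellFoundedGT.finite_ne_bot_of_iSupIndep h1
  refine h3.subset ?_
  intro κ hκ h
  apply hκ
  rw [eq_bot_iff]
  intro v hv
  have : (⟨v, hv.1⟩ : W) ∈ (W ⊓ wt e κ).comap W.subtype := hv
  rw [h] at this
  simpa using this

theorem good_dec {e : ι → Fin N → Fin N → Module.End ℂ V} {W : Submodule ℂ V} (hW : Good e W)
    {v : V} (hv : v ∈ W) : ∃ (F : Finset (ι → Fin N → ℤ)) (f : (ι → Fin N → ℤ) → V),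
      (∀ κ, f κ ∈ W ⊓ wt e κ) ∧ ∑ κ ∈ F, f κ = v := by
  have := hW.dec hv
  rw [Submodule.mem_iSup_iff_exists_finsupp] at this
  obtain ⟨f, h1, h2⟩ := this
  exact ⟨f.support, f, h1, h2⟩

theorem good_sub {e : ι → Fin N → Fin N → Module.End ℂ V} {W W' : Submodule ℂ V} (hW : Good e W)
    (hle : W' ≤ W) (st : ∀ s i j, ∀ v ∈ W', e s i j v ∈ W') : Good e W' := by
  have := hW.fd
  refine ⟨Submodule.finiteDimensional_of_le hle, st, ?_⟩
  intro v hv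
  obtain ⟨F, f, h1, rfl⟩ := good_dec hW (hle hv)
  have h2 := comp_mem e W' (fun s i v hv => st s i i v hv) F f (fun κ _ => (h1 κ).2) hv
  exact Submodule.sum_mem _ fun κ hκ => Submodule.mem_iSup_of_mem κ ⟨h2 κ hκ, (h1 κ).2⟩

/-- generalized Casimir eigencomponent -/
noncomputable def gc (e : ι → Fin N → Fin N → Module.End ℂ V) (W : Submodule ℂ V) (c : ℂ) :
    Submodule ℂ V := W ⊓ (cas e).maxGenEigenspace c

theorem cas_mem {e : ι → Fin N → Fin N → Module.End ℂ V} {W : Submodule ℂ V}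
    (st : ∀ s i j, ∀ v ∈ W, e s i j v ∈ W) {v : V} (hv : v ∈ W) : cas e v ∈ W := by
  unfold cas
  simp only [LinearMap.sum_apply, Module.End.mul_apply]
  exact Submodule.sum_mem _ fun s _ => Submodule.sum_mem _ fun i _ => Submodule.sum_mem _
    fun j _ => st _ _ _ _ (st _ _ _ _ hv)

theorem good_gc {e : ι → Fin N → Fin N → Module.End ℂ V} (he : GLRel e) {W : Submodule ℂ V}
    (hW : Good e W) (c : ℂ) : Good e (gc e W c) := by
  refine good_sub hW inf_le_left ?_
  intro s i j v hv
  refine ⟨hW.st _ _ _ _ hv.1, ?_⟩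
  exact Module.End.mapsTo_maxGenEigenspace_of_comm (Commute.symm (cas_comm he s i j)) c hv.2

end B1
end AK


open scoped BigOperators
open scoped Classical
set_option linter.unusedSectionVars false
set_option linter.unusedVariables false

namespace AK

section B2
variable {ι : Type} [Fintype ι] {N : ℕ} {V : Type} [AddCommGroup V] [Module ℂ V]

def ht (κ : ι → Fin N → ℤ) : ℤ := ∑ s, ∑ i : Fin N, -(i : ℤ) * κ s i

def Dom (κ : ι → Fin N → ℤ) : Prop := ∀ s i j, i < j → κ s j ≤ κ s i

def Cone (ι : Type) (N : ℕ) : AddSubmonoid (ι → Fin N → ℤ) :=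
  AddSubmonoid.closure {β | ∃ s, ∃ i j : Fin N, i < j ∧ β = rt s i j}

theorem rt_mem_cone {s : ι} {i j : Fin N} (h : i < j) : rt s i j ∈ Cone ι N :=
  AddSubmonoid.subset_closure ⟨s, i, j, h, rfl⟩

theorem rt_dot (s : ι) (i j : Fin N) (γ : ι → Fin N → ℤ) :
    ∑ t, ∑ k, γ t k * rt s i j t k = γ s i - γ s j := by
  have : ∀ t k, γ t k * rt s i j t k =
      if t = s then ((if k = i then γ t k else 0) - (if k = j then γ t k else 0)) else 0 := by
    intro t k
    rw [rt_apply]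
    split_ifs <;> simp
  simp only [this]
  rw [Finset.sum_eq_single s]
  · simp
  · intro b _ hb; simp [hb]
  · simp

theorem ht_rt (s : ι) (i j : Fin N) : ht (rt s i j) = (j : ℤ) - i := by
  unfold ht
  rw [rt_dot s i j (fun _ k => -(k : ℤ))]
  ring

theorem ht_add (κ κ' : ι → Fin N → ℤ) : ht (κ + κ') = ht κ + ht κ' := by
  simp [ht, mul_add, Finset.sum_add_distrib]

theorem cone_dot {β : ι → Fin N → ℤ} (hβ : β ∈ Cone ι N) {γ : ι → Fin N → ℤ} (hγ : Dom γ) :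
    0 ≤ ∑ t, ∑ k, γ t k * β t k := by
  induction hβ using AddSubmonoid.closure_induction with
  | mem x hx =>
    obtain ⟨s, i, j, hij, rfl⟩ := hx
    rw [rt_dot]
    have := hγ s i j hij
    omega
  | zero => simp
  | add x y _ _ hx hy =>
    simp only [Pi.add_apply, mul_add, Finset.sum_add_distrib]
    omega

theorem cone_sum {β : ι → Fin N → ℤ} (hβ : β ∈ Cone ι N) (s : ι) : ∑ k, β s k = 0 := by
  induction hβ using AddSubmonoid.closure_induction with
  | mem x hx =>
    obtain ⟨t, i, j, hij, rfl⟩ := hx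
    simp only [rt_apply]
    split_ifs <;> simp
  | zero => simp
  | add x y _ _ hx hy => simp [Finset.sum_add_distrib, hx, hy]

theorem cone_ht {β : ι → Fin N → ℤ} (hβ : β ∈ Cone ι N) : β = 0 ∨ 1 ≤ ht β := by
  induction hβ using AddSubmonoid.closure_induction with
  | mem x hx =>
    obtain ⟨t, i, j, hij, rfl⟩ := hx
    right
    rw [ht_rt]
    have : (i : ℕ) < j := hij
    omega
  | zero => left; rfl
  | add x y _ _ hx hy =>
    rcases hx with rfl | hx
    · simpa using hy
    · rcases hy with rfl | hy
      · right; simpa using hx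
      · right; rw [ht_add]; omega

def cterm (κ : ι → Fin N → ℤ) (s : ι) (i j : Fin N) : ℤ :=
  if i = j then κ s i * κ s i else if i < j then κ s i - κ s j else 0

def cfun (κ : ι → Fin N → ℤ) : ℤ := ∑ s, ∑ i, ∑ j, cterm κ s i j

theorem cfun_eq (κ : ι → Fin N → ℤ) :
    cfun κ = ∑ s, ∑ i : Fin N, (κ s i * κ s i + κ s i * ((N : ℤ) - 1 - 2 * i)) := by
  unfold cfun
  refine Finset.sum_congr rfl fun s _ => ?_
  have h : ∀ i j, cterm κ s i j = (if i = j then κ s i * κ s i else 0) +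
      ((if i < j then κ s i else 0) - (if i < j then κ s j else 0)) := by
    intro i j
    unfold cterm
    split_ifs with h1 h2 <;> simp
    exact absurd h2 (by rw [h1]; exact lt_irrefl _)
  simp only [h, Finset.sum_add_distrib, Finset.sum_sub_distrib]
  have h2 : ∑ i, ∑ j, (if i < j then κ s i else 0) = ∑ i : Fin N, κ s i * ((N : ℤ) - 1 - i) := by
    refine Finset.sum_congr rfl fun i _ => ?_
    rw [← Finset.sum_filter, Finset.sum_const]
    have : (Finset.univ.filter fun j => i < j).card = N - 1 - i := by
      rw [← Fin.card_Ioi]; congr 1; ext j; simp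
    rw [this, nsmul_eq_mul, mul_comm]
    have := i.2
    congr 1
    omega
  have h3 : ∑ i, ∑ j, (if i < j then κ s j else 0) = ∑ i : Fin N, κ s i * (i : ℤ) := by
    rw [Finset.sum_comm]
    refine Finset.sum_congr rfl fun i _ => ?_
    rw [← Finset.sum_filter, Finset.sum_const]
    have : (Finset.univ.filter fun j => j < i).card = i := by
      rw [← Fin.card_Iio]; congr 1; ext j; simp
    rw [this, nsmul_eq_mul, mul_comm]
  rw [h2, h3, ← Finset.sum_sub_distrib]
  simp only [Finset.sum_ite_eq, Finset.mem_univ, if_true]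
  congr 1
  refine Finset.sum_congr rfl fun i _ => ?_
  ring

/-- L4 -/
theorem cfun_lt {κ l : ι → Fin N → ℤ} (hκ : Dom κ) (hl : Dom l) (hc : κ - l ∈ Cone ι N)
    (hne : κ ≠ l) : cfun l < cfun κ := by
  have h1 := cone_dot hc (γ := κ + l) (by
    intro s i j h
    have := hκ s i j h
    have := hl s i j h
    simp only [Pi.add_apply]; omega)
  have h2 := cone_ht hc
  have h3 := cone_sum hc
  have h2' : 1 ≤ ht (κ - l) := by
    rcases h2 with h | h
    · exact absurd (sub_eq_zero.1 h) hne
    · exact h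
  have : cfun κ - cfun l = ∑ t, ∑ k, (κ + l) t k * (κ - l) t k + 2 * ht (κ - l) := by
    have h4 : ∑ s, ∑ k, (κ - l) s k * ((N : ℤ) - 1) = 0 := by
      exact Finset.sum_eq_zero fun s _ => by rw [← Finset.sum_mul, h3, zero_mul]
    rw [cfun_eq, cfun_eq, ← add_zero (2 * ht (κ - l)), ← h4, ht, Finset.mul_sum,
      ← Finset.sum_sub_distrib, ← Finset.sum_add_distrib, ← Finset.sum_add_distrib]
    refine Finset.sum_congr rfl fun s _ => ?_
    rw [Finset.mul_sum, 
      ← Finset.sum_sub_distrib, ← Finset.sum_add_distrib, ← Finset.sum_add_distrib]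
    refine Finset.sum_congr rfl fun s _ => ?_
    simp only [Pi.add_apply, Pi.sub_apply]
    ring
  omega

variable {e : ι → Fin N → Fin N → Module.End ℂ V}

theorem ee_swap (he : GLRel e) {κ : ι → Fin N → ℤ} {v : V} (hv : v ∈ wt e κ) (s : ι) {i j : Fin N} :
    e s i j (e s j i v) = e s j i (e s i j v) + ((κ s i : ℂ) - κ s j) • v := by
  have := congrArg (fun f => f v) (he.same s i j j i)
  simp only [Module.End.mul_apply, LinearMap.add_apply, LinearMap.sub_apply, if_true, hv s _] at this
  rw [this, sub_smul]; abel

/-- L2 -/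
theorem cas_hw (he : GLRel e) {W' : Submodule ℂ V} (st : ∀ s i j, ∀ v ∈ W', e s i j v ∈ W')
    {κ : ι → Fin N → ℤ} {v : V} (hv : v ∈ wt e κ) (h : ∀ s i j, i < j → e s i j v ∈ W') :
    cas e v - (cfun κ : ℂ) • v ∈ W' := by
  have : cas e v - (cfun κ : ℂ) • v =
      ∑ s, ∑ i, ∑ j, (e s i j (e s j i v) - (cterm κ s i j : ℂ) • v) := by
    simp only [cas, cfun, LinearMap.sum_apply, Module.End.mul_apply, Finset.sum_sub_distrib,
      Int.cast_sum, Finset.sum_smul]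
  rw [this]
  refine Submodule.sum_mem _ fun s _ => Submodule.sum_mem _ fun i _ => Submodule.sum_mem _ fun j _ => ?_
  unfold cterm
  split_ifs with h1 h2
  · subst h1
    rw [hv, map_smul, hv, smul_smul]
    simp
  · rw [ee_swap he hv]
    simp only [Int.cast_sub, add_sub_cancel_right]
    exact st _ _ _ _ (h _ _ _ h2)
  · have : j < i := lt_of_le_of_ne (not_lt.1 h2) (Ne.symm h1)
    simpa using st _ _ _ _ (h _ _ _ this)

/-- L3 -/
theorem dom_of_hw (he : GLRel e) {W W' : Submodule ℂ V} (hW : Good e W)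
    (st : ∀ s i j, ∀ v ∈ W', e s i j v ∈ W')
    {κ : ι → Fin N → ℤ} {v : V} (hvW : v ∈ W) (hv : v ∈ wt e κ) (hn : v ∉ W') (s : ι) (i j : Fin N)
    (hij : i < j) (h : e s i j v ∈ W') : κ s j ≤ κ s i := by
  by_contra hlt
  push Not at hlt
  have hwt : ∀ k : ℕ, ((e s j i) ^ k) v ∈ W ⊓ wt e (κ + k • rt s j i) := by
    intro k
    induction k with
    | zero => simpa using ⟨hvW, hv⟩
    | succ k ih =>
      rw [pow_succ', Module.End.mul_apply]
      refine ⟨hW.st _ _ _ _ ih.1, ?_⟩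
      have := e_mem_wt he ih.2 s j i
      rwa [add_assoc, ← succ_nsmul] at this
  have hne : ∀ k : ℕ, κ s i - κ s j ≤ 0 - 1 := by intro k; omega
  have hform : ∀ k : ℕ, e s i j (((e s j i) ^ (k+1)) v) -
      (((k + 1 : ℕ) : ℂ) * ((κ s i : ℂ) - κ s j - k)) • ((e s j i) ^ k) v ∈ W' := by
    intro k
    induction k with
    | zero =>
      have := ee_swap he hv s (i := i) (j := j)
      simp [this]
      exact st _ _ _ _ h
    | succ k ih =>
      have h1 := ee_swap he (hwt (k+1)).2 s (i := i) (j := j)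
      rw [pow_succ', Module.End.mul_apply, h1]
      have h2 := st s j i _ ih
      rw [map_sub, map_smul] at h2
      have h3 : e s j i ((e s j i ^ k) v) = (e s j i ^ (k+1)) v := by
        rw [pow_succ', Module.End.mul_apply]
      rw [h3] at h2
      convert h2 using 1
      rw [add_sub_assoc, sub_eq_add_neg (e s j i ((e s i j) ((e s j i ^ (k + 1)) v)))]
      congr 1
      rw [← sub_smul, ← neg_smul]
      congr 1
      simp only [Pi.add_apply, Pi.smul_apply, rt_apply, if_true, hij.ne, hij.ne', if_false]
      push_cast
      simp
      ring
  have hnot : ∀ k : ℕ, ((e s j i) ^ k) v ∉ W' := by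
    intro k
    induction k with
    | zero => simpa using hn
    | succ k ih =>
      intro hmem
      apply ih
      have h1 := W'.sub_mem (st s i j _ hmem) (hform k)
      rw [sub_sub_cancel] at h1
      refine (W'.smul_mem_iff ?_).1 h1
      apply mul_ne_zero
      · exact_mod_cast Nat.succ_ne_zero k
      · have : κ s i - κ s j - k ≠ 0 := by omega
        exact_mod_cast this
  have hinf : Set.Infinite {κ | W ⊓ wt e κ ≠ ⊥} := by
    have hinj : Function.Injective (fun k : ℕ => κ + k • rt s j i) := by
      intro a b hab
      have := congrFun (congrFun hab s) j
      simp [rt_apply, hij.ne'] at this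
      exact this
    refine Set.Infinite.mono ?_ (Set.infinite_range_of_injective hinj)
    rintro _ ⟨k, rfl⟩ hbot
    have := hwt k
    simp only at hbot
    rw [hbot] at this
    apply hnot k
    rw [(Submodule.mem_bot ℂ).1 this]
    exact W'.zero_mem
  exact hinf (good_fin hW)

theorem cas_eq_of (he : GLRel e) {W' : Submodule ℂ V} (st : ∀ s i j, ∀ v ∈ W', e s i j v ∈ W') {c d : ℂ} {v : V}
    (hn : v ∉ W') (h1 : v ∈ (cas e).maxGenEigenspace c) (h2 : cas e v - d • v ∈ W') : d = c := by
  rw [Module.End.mem_maxGenEigenspace] at h1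
  obtain ⟨k, hk⟩ := h1
  have h3 : ∀ k : ℕ, ((cas e - c • 1) ^ k) v - (d - c) ^ k • v ∈ W' := by
    intro k
    induction k with
    | zero => simp
    | succ k ih =>
      rw [pow_succ', Module.End.mul_apply]
      have h4 : (cas e - c • 1) (((cas e - c • 1) ^ k) v - (d - c) ^ k • v) ∈ W' := by
        simp only [LinearMap.sub_apply, LinearMap.smul_apply, Module.End.one_apply]
        exact W'.sub_mem (cas_mem st ih) (W'.smul_mem _ ih)
      have h5 := W'.add_mem h4 (W'.smul_mem ((d - c) ^ k) h2)
      convert h5 using 1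
      simp only [map_sub, LinearMap.sub_apply, LinearMap.smul_apply, Module.End.one_apply, map_smul,
        smul_sub, pow_succ, mul_smul, sub_smul]
      abel
  have h4 := h3 k
  rw [hk, zero_sub, Submodule.neg_mem_iff] at h4
  by_contra hne
  exact hn ((W'.smul_mem_iff (pow_ne_zero k (sub_ne_zero.2 hne))).1 h4)

theorem top_exists (he : GLRel e) {W W' : Submodule ℂ V} (hW : Good e W)
    (st : ∀ s i j, ∀ v ∈ W', e s i j v ∈ W') {c : ℂ} (hc : W ≤ (cas e).maxGenEigenspace c)
    {κ : ι → Fin N → ℤ} (hκ : ¬ W ⊓ wt e κ ≤ W') :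
    ∃ κ', κ' - κ ∈ Cone ι N ∧ Dom κ' ∧ (cfun κ' : ℂ) = c ∧ ∃ v ∈ W ⊓ wt e κ', v ∉ W' ∧
      ∀ s i j, i < j → e s i j v ∈ W' := by
  have hfin : {κ' | ¬ W ⊓ wt e κ' ≤ W' ∧ κ' - κ ∈ Cone ι N}.Finite := by
    refine (good_fin hW).subset ?_
    intro κ' h1 h2
    apply h1.1; rw [h2]; exact bot_le
  obtain ⟨κ', ⟨h1, h2⟩, h3⟩ := hfin.exists_maximalFor ht _ ⟨κ, hκ, by simp [AddSubmonoid.zero_mem]⟩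
  obtain ⟨v, hv, hvn⟩ := Set.not_subset.1 h1
  have hup : ∀ s i j, i < j → e s i j v ∈ W' := by
    intro s i j hij
    by_contra hcon
    have h4 := @h3 (κ' + rt s i j) ⟨fun hle => hcon (hle ⟨hW.st _ _ _ _ hv.1, e_mem_wt he hv.2 s i j⟩), by
      rw [add_sub_right_comm]
      exact (Cone ι N).add_mem h2 (rt_mem_cone hij)⟩
    rw [ht_add, ht_rt] at h4
    have : (i : ℕ) < j := hij
    have := h4 (by omega)
    omega
  refine ⟨κ', h2, fun s i j hij => dom_of_hw he hW st hv.1 hv.2 hvn s i j hij (hup s i j hij), ?_, v, hv,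
    hvn, hup⟩
  exact cas_eq_of he st hvn (hc hv.1) (cas_hw he st hv.2 hup)

theorem bot_st : ∀ s i j, ∀ v ∈ (⊥ : Submodule ℂ V), e s i j v ∈ (⊥ : Submodule ℂ V) := by
  intro s i j v hv
  rw [(Submodule.mem_bot ℂ).1 hv, map_zero]; exact Submodule.zero_mem _

/-- L6 -/
theorem above_bot (he : GLRel e) {W : Submodule ℂ V} (hW : Good e W) {l κ : ι → Fin N → ℤ} (hl : Dom l)
    (hc : W ≤ (cas e).maxGenEigenspace (cfun l : ℂ)) (hκ : κ - l ∈ Cone ι N) (hne : κ ≠ l) :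
    W ⊓ wt e κ = ⊥ := by
  by_contra hcon
  obtain ⟨κ', h1, h2, h3, -⟩ := top_exists he hW bot_st hc (κ := κ) (by rwa [le_bot_iff])
  have h4 : cfun κ' = cfun l := by exact_mod_cast h3
  have h5 : κ' - l ∈ Cone ι N := by
    have := (Cone ι N).add_mem h1 hκ
    simpa using this
  by_cases h6 : κ' = l
  · subst h6
    have a := cone_ht hκ
    have b := cone_ht h1
    have hz : ht (κ - κ') + ht (κ' - κ) = 0 := by
      rw [← ht_add]; simp [ht]
    rcases a with a | a
    · exact hne (sub_eq_zero.1 a)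
    · rcases b with b | b
      · exact hne (sub_eq_zero.1 b).symm
      · omega
  · have := cfun_lt h2 hl h5 h6
    omega

noncomputable def hwv (e : ι → Fin N → Fin N → Module.End ℂ V) (W : Submodule ℂ V)
    (κ : ι → Fin N → ℤ) : Submodule ℂ V :=
  W ⊓ wt e κ ⊓ ⨅ s, ⨅ i, ⨅ j, ⨅ (_ : i < j), LinearMap.ker (e s i j)

theorem mem_hwv {W : Submodule ℂ V} {κ : ι → Fin N → ℤ} {v : V} : v ∈ hwv e W κ ↔
    v ∈ W ∧ v ∈ wt e κ ∧ ∀ s i j, i < j → e s i j v = 0 := by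
  simp [hwv, Submodule.mem_iInf, and_assoc]

theorem gc_hw (he : GLRel e) {W : Submodule ℂ V} (hW : Good e W) {l : ι → Fin N → ℤ} (hl : Dom l) :
    hwv e W l = gc e W (cfun l) ⊓ wt e l := by
  ext v
  rw [mem_hwv]
  constructor
  · rintro ⟨h1, h2, h3⟩
    refine ⟨⟨h1, ?_⟩, h2⟩
    refine Module.End.mem_maxGenEigenspace _ _ _ |>.2 ⟨1, ?_⟩
    have := cas_hw he (W' := ⊥) bot_st h2 (fun s i j h => by rw [h3 s i j h]; exact Submodule.zero_mem _)
    simpa using this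
  · rintro ⟨h1, h2⟩
    refine ⟨h1.1, h2, fun s i j h => ?_⟩
    have hg := good_gc he hW (cfun l : ℂ)
    have h3 := above_bot he hg hl inf_le_right (κ := l + rt s i j) (by simpa using rt_mem_cone h) (by
      intro heq
      have h0 : rt s i j = 0 := by simpa using heq
      have := congrFun (congrFun h0 s) i
      simp [rt_apply, h.ne] at this)
    have : e s i j v ∈ gc e W (cfun l : ℂ) ⊓ wt e (l + rt s i j) := ⟨hg.st _ _ _ _ h1, e_mem_wt he h2 s i j⟩
    rw [h3] at this
    simpa using this

end B2
end AK


open scoped BigOperators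
open scoped Classical
set_option linter.unusedSectionVars false
set_option linter.unusedVariables false

namespace AK

section B3
variable {ι : Type} [Fintype ι] {N : ℕ} {V : Type} [AddCommGroup V] [Module ℂ V]

theorem gsup (f : Module.End ℂ V) {E : Submodule ℂ V} [FiniteDimensional ℂ E]
    (h : ∀ v ∈ E, f v ∈ E) : E ≤ ⨆ c, E ⊓ f.maxGenEigenspace c := by
  have h1 := Module.End.iSup_maxGenEigenspace_eq_top (f.restrict h)
  have h2 : E = (⊤ : Submodule ℂ E).map E.subtype := by simp
  conv_lhs => rw [h2, ← h1, Submodule.map_iSup]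
  refine iSup_mono fun c => ?_
  rw [Module.End.maxGenEigenspace, Module.End.genEigenspace_restrict, Submodule.map_comap_subtype]

theorem gdim (f : Module.End ℂ V) {E : Submodule ℂ V} [FiniteDimensional ℂ E]
    (h : ∀ v ∈ E, f v ∈ E) (F : Finset ℂ) (hF : ∀ c ∉ F, E ⊓ f.maxGenEigenspace c = ⊥) :
    Module.finrank ℂ E = ∑ c ∈ F, Module.finrank ℂ (E ⊓ f.maxGenEigenspace c : Submodule ℂ V) := by
  have h1 := Module.End.iSup_maxGenEigenspace_eq_top (f.restrict h)
  have h2 := Module.End.independent_maxGenEigenspace (f.restrict h)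
  have hA : ∀ c, Module.End.maxGenEigenspace (f.restrict h) c = (f.maxGenEigenspace c).comap E.subtype :=
    fun c => by rw [Module.End.maxGenEigenspace, Module.End.genEigenspace_restrict]
  have hfr : ∀ c, Module.finrank ℂ (Module.End.maxGenEigenspace (f.restrict h) c) =
      Module.finrank ℂ (E ⊓ f.maxGenEigenspace c : Submodule ℂ V) := by
    intro c
    rw [← Submodule.finrank_map_subtype_eq, hA, Submodule.map_comap_subtype]
  have h3 : (⨆ c : F, Module.End.maxGenEigenspace (f.restrict h) c) = ⊤ := by
    rw [eq_top_iff, ← h1]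
    refine iSup_le fun c => ?_
    by_cases hc : c ∈ F
    · exact le_iSup (fun c : F => Module.End.maxGenEigenspace (f.restrict h) c) ⟨c, hc⟩
    · have : Module.finrank ℂ (Module.End.maxGenEigenspace (f.restrict h) c) = 0 := by
        rw [hfr, hF c hc]; simp
      rw [Submodule.finrank_eq_zero] at this
      rw [this]; exact bot_le
  have h4 := DirectSum.isInternal_submodule_of_iSupIndep_of_iSup_eq_top
    (h2.comp (f := fun c : F => (c : ℂ)) Subtype.val_injective) h3
  have h5 := LinearEquiv.ofBijective (DirectSum.coeLinearMap _) h4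
  rw [← h5.finrank_eq, Module.finrank_directSum]
  rw [← Finset.sum_coe_sort F (fun c => Module.finrank ℂ (E ⊓ f.maxGenEigenspace c : Submodule ℂ V))]
  exact Finset.sum_congr rfl fun c _ => hfr c

variable {e : ι → Fin N → Fin N → Module.End ℂ V}

/-- E1 -/
theorem hwv_gen (he : GLRel e) {W W' : Submodule ℂ V} (hW : Good e W)
    (st : ∀ s i j, ∀ v ∈ W', e s i j v ∈ W') (hh : ∀ κ, Dom κ → hwv e W κ ≤ W') : W ≤ W' := by
  have := hW.fd
  refine (gsup (cas e) (fun v hv => cas_mem hW.st hv)).trans (iSup_le fun c => ?_)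
  have hg := good_gc he hW c
  refine hg.dec.trans (iSup_le fun κ => ?_)
  by_contra hcon
  obtain ⟨κ', h1, h2, h3, v, hv, hvn, -⟩ := top_exists he hg st inf_le_right hcon
  apply hvn
  apply hh κ' h2
  rw [gc_hw he hW h2, h3]
  exact hv

theorem glrel_rev (he : GLRel e) : GLRel (fun s (i j : Fin N) => e s i.rev j.rev) := by
  constructor
  · intro s i j k l
    have := he.same s i.rev j.rev k.rev l.rev
    simpa using this
  · intro s t h i j k l
    exact he.diff s t h _ _ _ _

theorem cas_rev : cas (fun s (i j : Fin N) => e s i.rev j.rev) = cas e := by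
  unfold cas
  refine Finset.sum_congr rfl fun s _ => ?_
  rw [← Equiv.sum_comp Fin.revPerm]
  refine Finset.sum_congr rfl fun i _ => ?_
  rw [← Equiv.sum_comp Fin.revPerm]
  simp

theorem wt_rev (κ : ι → Fin N → ℤ) :
    wt (fun s (i j : Fin N) => e s i.rev j.rev) (fun s i => κ s i.rev) = wt e κ := by
  ext v
  simp only [mem_wt]
  constructor
  · intro h s i
    simpa using h s i.rev
  · intro h s i
    exact h s i.rev

theorem cfun_zero {κ : ι → Fin N → ℤ} (h : Dom κ) (h0 : cfun κ = 0) : κ = 0 := by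
  have h1 : ∀ s i j, 0 ≤ cterm κ s i j := by
    intro s i j
    unfold cterm
    split_ifs with h1 h2
    · exact mul_self_nonneg _
    · have := h s i j h2; omega
    · rfl
  unfold cfun at h0
  rw [Finset.sum_eq_zero_iff_of_nonneg (fun s _ => Finset.sum_nonneg fun i _ => Finset.sum_nonneg fun j _ => h1 s i j)] at h0
  funext s i
  have h2 := h0 s (Finset.mem_univ _)
  rw [Finset.sum_eq_zero_iff_of_nonneg (fun i _ => Finset.sum_nonneg fun j _ => h1 s i j)] at h2
  have h3 := h2 i (Finset.mem_univ _)
  rw [Finset.sum_eq_zero_iff_of_nonneg (fun j _ => h1 s i j)] at h3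
  have h4 := h3 i (Finset.mem_univ _)
  simpa [cterm] using h4

theorem zero_below (he : GLRel e) {W : Submodule ℂ V} (hW : Good e W)
    (hc : W ≤ (cas e).maxGenEigenspace 0) {κ : ι → Fin N → ℤ} (hκ : W ⊓ wt e κ ≠ ⊥) :
    -κ ∈ Cone ι N := by
  obtain ⟨κ', h1, h2, h3, -⟩ := top_exists he hW bot_st hc (κ := κ) (by rwa [le_bot_iff])
  have := cfun_zero h2 (by exact_mod_cast h3)
  subst this
  simpa using h1

theorem zero_act (he : GLRel e) {W : Submodule ℂ V} (hW : Good e W)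
    (hc : W ≤ (cas e).maxGenEigenspace 0) : ∀ v ∈ W, ∀ s i j, e s i j v = 0 := by
  have hrev : Good (fun s (i j : Fin N) => e s i.rev j.rev) W := by
    refine ⟨hW.fd, fun s i j v hv => hW.st _ _ _ _ hv, hW.dec.trans (iSup_le fun κ => ?_)⟩
    rw [← wt_rev κ]
    exact le_iSup (fun κ => W ⊓ wt (fun s (i j : Fin N) => e s i.rev j.rev) κ) (fun s i => κ s i.rev)
  have hz : ∀ κ, W ⊓ wt e κ ≠ ⊥ → κ = 0 := by
    intro κ hκ
    have h1 := zero_below he hW hc hκ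
    have h2 := zero_below (glrel_rev he) hrev (by rwa [cas_rev]) (κ := fun s i => κ s i.rev)
      (by rwa [wt_rev])
    have h3 : ht (-(fun s i => κ s (Fin.rev i))) = - ht (-κ) := by
      have : ht (-(fun s i => κ s (Fin.rev i))) + ht (-κ) = 0 := by
        have hs := cone_sum h1
        simp only [Pi.neg_apply] at hs
        unfold ht
        rw [← Finset.sum_add_distrib]
        refine Finset.sum_eq_zero fun s _ => ?_
        rw [← Equiv.sum_comp Fin.revPerm, ← Finset.sum_add_distrib]
        have : ∑ i : Fin N, (-((N : ℤ) - 1)) * (- κ s i) = 0 := by rw [← Finset.mul_sum, hs, mul_zero]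
        rw [← this]
        refine Finset.sum_congr rfl fun i _ => ?_
        simp only [Fin.revPerm_apply, Pi.neg_apply, Fin.rev_rev]
        have h5 : ((Fin.rev i : ℕ) : ℤ) = N - 1 - i := by
          rw [Fin.val_rev]; omega
        rw [h5]; ring
      omega
    rcases cone_ht h1 with h4 | h4
    · simpa using h4
    · rcases cone_ht h2 with h5 | h5
      · have : ht (-(fun s i => κ s (Fin.rev i))) = 0 := by rw [h5]; simp [ht]
        omega
      · omega
  have hle : W ≤ wt e 0 := by
    refine hW.dec.trans (iSup_le fun κ => ?_)
    by_cases h : W ⊓ wt e κ = ⊥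
    · rw [h]; exact bot_le
    · rw [hz κ h]; exact inf_le_right
  intro v hv s i j
  by_cases hij : i = j
  · subst hij
    simpa using hle hv s i
  · by_contra hne
    have h1 := hz (0 + rt s i j) (by
      intro hb
      have : e s i j v ∈ W ⊓ wt e (0 + rt s i j) := ⟨hW.st _ _ _ _ hv, e_mem_wt he (hle hv) s i j⟩
      rw [hb] at this
      exact hne (by simpa using this))
    have := congrFun (congrFun h1 s) i
    simp [rt_apply, hij] at this

/-- E2 -/
theorem reynolds (he : GLRel e) {W : Submodule ℂ V} (hW : Good e W) :
    ∃ r : Polynomial ℂ, r.eval 0 = 1 ∧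
      ∀ v ∈ W, ∀ s i j, e s i j (Polynomial.aeval (cas e) r v) = 0 := by
  have := hW.fd
  have hst : ∀ v ∈ W, cas e v ∈ W := fun v hv => cas_mem hW.st hv
  obtain ⟨p, hp0, hp⟩ : ∃ p : Polynomial ℂ, p ≠ 0 ∧ ∀ v ∈ W, Polynomial.aeval (cas e) p v = 0 := by
    refine ⟨((cas e).restrict hst).charpoly, (LinearMap.charpoly_monic _).ne_zero, fun v hv => ?_⟩
    have h1 := LinearMap.aeval_self_charpoly ((cas e).restrict hst)
    have h2 : ∀ q : Polynomial ℂ, ∀ w : W, ((Polynomial.aeval ((cas e).restrict hst) q w : W) : V) =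
        Polynomial.aeval (cas e) q (w : V) := by
      intro q
      induction q using Polynomial.induction_on' with
      | add a b ha hb => intro w; simp [ha, hb]
      | monomial n a =>
        intro w
        simp only [Polynomial.aeval_monomial, Module.End.mul_apply, Module.algebraMap_end_apply,
          Submodule.coe_smul]
        congr 1
        induction n generalizing w with
        | zero => simp
        | succ n ih =>
          simp only [pow_succ, Module.End.mul_apply, ih]
          rfl
    rw [← h2 _ ⟨v, hv⟩, h1]; rfl
  obtain ⟨q, hq, hnd⟩ := Polynomial.exists_eq_pow_rootMultiplicity_mul_and_not_dvd p hp0 0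
  simp only [map_zero, sub_zero] at hq hnd
  have hq0 : q.eval 0 ≠ 0 := by
    rwa [Polynomial.X_dvd_iff, Polynomial.coeff_zero_eq_eval_zero] at hnd
  have hin : ∀ r : Polynomial ℂ, ∀ v ∈ W, Polynomial.aeval (cas e) r v ∈ W := by
    intro r v hv
    induction r using Polynomial.induction_on' with
    | add a b ha hb => simpa using W.add_mem ha hb
    | monomial n a =>
        simp only [Polynomial.aeval_monomial, Module.End.mul_apply, Module.algebraMap_end_apply]
        refine W.smul_mem _ ?_
        induction n with
        | zero => simpa
        | succ n ih => rw [pow_succ', Module.End.mul_apply]; exact hst _ ih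
  refine ⟨Polynomial.C (q.eval 0)⁻¹ * q, by simp [hq0], fun v hv => ?_⟩
  refine zero_act he (good_gc he hW 0) inf_le_right _ ⟨hin _ _ hv, ?_⟩
  refine Module.End.mem_maxGenEigenspace _ _ _ |>.2 ⟨p.rootMultiplicity 0, ?_⟩
  have h1 := hp v hv
  rw [hq] at h1
  simp only [map_mul, Module.End.mul_apply, Polynomial.aeval_C, Module.algebraMap_end_apply,
    zero_smul, sub_zero, map_smul] at h1 ⊢
  rw [map_pow, Polynomial.aeval_X] at h1
  rw [h1, smul_zero]

theorem aeval_inv {f : Module.End ℂ V} {v : V} (h : f v = 0) (r : Polynomial ℂ) :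
    Polynomial.aeval f r v = r.eval 0 • v := by
  induction r using Polynomial.induction_on' with
  | add a b ha hb => simp [ha, hb, add_smul]
  | monomial n a =>
    simp only [Polynomial.aeval_monomial, Module.End.mul_apply, Module.algebraMap_end_apply,
      Polynomial.eval_monomial]
    cases n with
    | zero => simp
    | succ n => simp [pow_succ, Module.End.mul_apply, h]

end B3
end AK


open scoped BigOperators
open scoped Classical
set_option linter.unusedSectionVars false
set_option linter.unusedVariables false

namespace AK

section B4
variable {ι : Type} [Fintype ι] {N : ℕ} {V : Type} [AddCommGroup V] [Module ℂ V]
variable {e : ι → Fin N → Fin N → Module.End ℂ V}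

theorem rt_rev (s : ι) (i j : Fin N) (κ : ι → Fin N → ℤ) : κ + rt s i j + rt s j i = κ := by
  unfold rt
  rw [add_assoc, ← Pi.single_add]
  simp

/-- dimension of weight space -/
noncomputable def mu (e : ι → Fin N → Fin N → Module.End ℂ V) (W : Submodule ℂ V)
    (κ : ι → Fin N → ℤ) : ℕ := Module.finrank ℂ (W ⊓ wt e κ : Submodule ℂ V)

theorem ee_mem (he : GLRel e) {W : Submodule ℂ V} (hW : Good e W) (κ : ι → Fin N → ℤ)
    (s : ι) (i j : Fin N) : ∀ v ∈ W ⊓ wt e κ, (e s j i * e s i j) v ∈ W ⊓ wt e κ := by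
  intro v hv
  refine ⟨hW.st _ _ _ _ (hW.st _ _ _ _ hv.1), ?_⟩
  have := e_mem_wt he (e_mem_wt he hv.2 s i j) s j i
  rwa [rt_rev] at this

noncomputable def uu (he : GLRel e) {W : Submodule ℂ V} (hW : Good e W) (s : ι) (i j : Fin N)
    (κ : ι → Fin N → ℤ) : ℂ :=
  LinearMap.trace ℂ _ ((e s j i * e s i j).restrict (ee_mem he hW κ s i j))

theorem good_fdw {W : Submodule ℂ V} (hW : Good e W) (κ : ι → Fin N → ℤ) :
    FiniteDimensional ℂ (W ⊓ wt e κ : Submodule ℂ V) := by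
  have := hW.fd
  exact Submodule.finiteDimensional_of_le inf_le_left

theorem uu_swap (he : GLRel e) {W : Submodule ℂ V} (hW : Good e W) (s : ι) (i j : Fin N)
    (κ : ι → Fin N → ℤ) : uu he hW s j i κ = uu he hW s i j κ + ((κ s i : ℂ) - κ s j) * mu e W κ := by
  have := good_fdw hW κ
  unfold uu mu
  rw [← LinearMap.trace_one (R := ℂ) (M := (W ⊓ wt e κ : Submodule ℂ V)), ← smul_eq_mul (_ - _), ← map_smul, ← map_add]
  congr 1
  ext v
  simpa using ee_swap he v.2.2 s (i := i) (j := j)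

theorem uu_step (he : GLRel e) {W : Submodule ℂ V} (hW : Good e W) (s : ι) (i j : Fin N)
    (κ : ι → Fin N → ℤ) : uu he hW s i j κ = uu he hW s j i (κ + rt s i j) := by
  have h1 := good_fdw hW κ
  have h2 := good_fdw hW (κ + rt s i j)
  have hA : ∀ v ∈ W ⊓ wt e κ, e s i j v ∈ W ⊓ wt e (κ + rt s i j) := fun v hv =>
    ⟨hW.st _ _ _ _ hv.1, e_mem_wt he hv.2 s i j⟩
  have hB : ∀ v ∈ W ⊓ wt e (κ + rt s i j), e s j i v ∈ W ⊓ wt e κ := by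
    intro v hv
    refine ⟨hW.st _ _ _ _ hv.1, ?_⟩
    have := e_mem_wt he hv.2 s j i
    rwa [rt_rev] at this
  have := LinearMap.trace_comp_comm' (R := ℂ) ((e s i j).restrict hA) ((e s j i).restrict hB)
  exact this

theorem uu_zero (he : GLRel e) {W : Submodule ℂ V} (hW : Good e W) (s : ι) (i j : Fin N)
    (κ : ι → Fin N → ℤ) (h : W ⊓ wt e κ = ⊥) : uu he hW s i j κ = 0 := by
  have : Subsingleton (W ⊓ wt e κ : Submodule ℂ V) := by rw [h]; infer_instance
  unfold uu
  rw [Subsingleton.elim (LinearMap.restrict (e s j i * e s i j) (ee_mem he hW κ s i j)) 0, map_zero]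

theorem cas_trace (he : GLRel e) {W : Submodule ℂ V} (hW : Good e W) {c : ℂ}
    (hc : W ≤ (cas e).maxGenEigenspace c) (κ : ι → Fin N → ℤ) :
    c * mu e W κ = cfun κ * mu e W κ +
      ∑ s, ∑ i, ∑ j, (if i < j then 2 * uu he hW s i j κ else 0) := by
  have h1 := good_fdw hW κ
  have hcm : ∀ v ∈ W ⊓ wt e κ, cas e v ∈ W ⊓ wt e κ := by
    intro v hv
    simp only [cas, LinearMap.sum_apply]
    exact Submodule.sum_mem _ fun s _ => Submodule.sum_mem _ fun i _ => Submodule.sum_mem _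
      fun j _ => ee_mem he hW κ s j i v hv
  have h2 : LinearMap.trace ℂ _ ((cas e).restrict hcm) = c * mu e W κ := by
    have h3 : IsNilpotent ((cas e).restrict hcm - c • 1 : Module.End ℂ (W ⊓ wt e κ : Submodule ℂ V)) := by
      rw [Module.End.isNilpotent_iff_of_finite]
      intro v
      obtain ⟨k, hk⟩ := Module.End.mem_maxGenEigenspace _ _ _ |>.1 (hc v.2.1)
      refine ⟨k, Subtype.ext ?_⟩
      have : ∀ k : ℕ, ∀ v : (W ⊓ wt e κ : Submodule ℂ V),
          ((((cas e).restrict hcm - c • 1 : Module.End ℂ (W ⊓ wt e κ : Submodule ℂ V)) ^ k) v : V) =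
          ((cas e - c • 1) ^ k) (v : V) := by
        intro k
        induction k with
        | zero => simp
        | succ k ih => intro v; rw [pow_succ, pow_succ, Module.End.mul_apply, Module.End.mul_apply, ih]; rfl
      rw [this, hk]; rfl
    have h4 := LinearMap.isNilpotent_trace_of_isNilpotent h3
    rw [isNilpotent_iff_eq_zero, map_sub, map_smul, LinearMap.trace_one, sub_eq_zero] at h4
    exact h4
  rw [← h2]
  have h5 : (cas e).restrict hcm = ∑ s, ∑ i, ∑ j, (e s i j * e s j i).restrict (ee_mem he hW κ s j i) := by
    ext v
    simp [cas]
  rw [h5]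
  simp only [map_sum]
  have h6 : ∀ s i j, LinearMap.trace ℂ _ ((e s i j * e s j i).restrict (ee_mem he hW κ s j i)) =
      cterm κ s i j * mu e W κ + ((if i < j then uu he hW s i j κ else 0) +
        (if j < i then uu he hW s j i κ else 0)) := by
    intro s i j
    change uu he hW s j i κ = _
    unfold cterm
    rcases lt_trichotomy i j with h | h | h
    · simp only [h, h.ne, h.not_gt, if_true, if_false, uu_swap he hW s i j]; push_cast; ring
    · subst h
      simp only [if_true, lt_irrefl, if_false, add_zero]
      unfold uu mu
      rw [← LinearMap.trace_one (R := ℂ) (M := (W ⊓ wt e κ : Submodule ℂ V)), ← smul_eq_mul (Int.cast _), ← map_smul]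
      congr 1
      ext v
      have := v.2.2 s i
      simp [this, smul_smul]
    · simp [h, h.ne', h.not_gt]
  simp only [h6, Finset.sum_add_distrib]
  congr 1
  · simp [cfun, Finset.sum_mul]
  · rw [← Finset.sum_add_distrib]
    refine Finset.sum_congr rfl fun s _ => ?_
    rw [Finset.sum_comm (f := fun i j => if j < i then uu he hW s j i κ else 0), ← Finset.sum_add_distrib]
    refine Finset.sum_congr rfl fun i _ => ?_
    rw [← Finset.sum_add_distrib]
    refine Finset.sum_congr rfl fun j _ => ?_
    split_ifs <;> ring

end B4
end AK


open scoped BigOperators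
open scoped Classical
set_option linter.unusedSectionVars false
set_option linter.unusedVariables false

namespace AK

section B5
open MvPolynomial
variable {ι : Type} [Fintype ι] {N : ℕ}

def toZ (ζ : (ι × Fin N) →₀ ℕ) : ι → Fin N → ℤ := fun s i => (ζ (s, i) : ℤ)

theorem toZ_inj : Function.Injective (toZ : ((ι × Fin N) →₀ ℕ) → _) := by
  intro a b h
  ext ⟨s, i⟩
  have := congrFun (congrFun h s) i
  simpa [toZ] using this

theorem toZ_surj {κ : ι → Fin N → ℤ} (h : ∀ s i, 0 ≤ κ s i) : ∃ ζ, toZ ζ = κ := by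
  refine ⟨Finsupp.equivFunOnFinite.symm (fun p => (κ p.1 p.2).toNat), ?_⟩
  funext s i
  simp [toZ, h s i]

theorem gf_exists (f : (ι → Fin N → ℤ) → ℂ) (hf : {κ | f κ ≠ 0}.Finite) :
    ∃ p : MvPolynomial (ι × Fin N) ℂ, ∀ ζ, coeff ζ p = f (toZ ζ) := by
  have h : {ζ | f (toZ ζ) ≠ 0}.Finite := hf.preimage (toZ_inj.injOn)
  refine ⟨∑ ζ ∈ h.toFinset, monomial ζ (f (toZ ζ)), fun ζ => ?_⟩
  rw [coeff_sum]
  simp only [coeff_monomial, Finset.sum_ite_eq']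
  split_ifs with h1
  · rfl
  · by_contra h2
    exact h1 (by simpa using Ne.symm h2)

noncomputable def Dop (k : ι × Fin N) : Derivation ℂ (MvPolynomial (ι × Fin N) ℂ) (MvPolynomial (ι × Fin N) ℂ) :=
  (X k : MvPolynomial (ι × Fin N) ℂ) • pderiv k

theorem Dop_X (k l : ι × Fin N) : Dop k (X l) = if k = l then X l else 0 := by
  simp only [Dop, Derivation.smul_apply, smul_eq_mul, pderiv_X, Pi.single_apply]
  split_ifs with h1 h2 <;> simp_all

theorem coeff_Dop (k : ι × Fin N) (p : MvPolynomial (ι × Fin N) ℂ) (ζ) :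
    coeff ζ (Dop k p) = ζ k * coeff ζ p := by
  induction p using MvPolynomial.induction_on' with
  | monomial u a =>
    simp only [Dop, Derivation.smul_apply, smul_eq_mul, pderiv_monomial]
    have : X k * monomial (u - Finsupp.single k 1) (a * (u k : ℂ)) = monomial u (a * (u k : ℂ)) := by
      by_cases h : u k = 0
      · simp [h]
      · rw [X, monomial_mul, one_mul, add_comm, tsub_add_cancel_of_le]
        simpa using Nat.one_le_iff_ne_zero.2 h
    rw [this, coeff_monomial, coeff_monomial]
    split_ifs with h
    · subst h; ring
    · simp
  | add p q hp hq => simp [hp, hq, mul_add]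

noncomputable def Eop (p : MvPolynomial (ι × Fin N) ℂ) : MvPolynomial (ι × Fin N) ℂ :=
  ∑ k, Dop k (Dop k p) - C ((N : ℂ) - 1) * ∑ k, Dop k p

def Eco (κ : ι → Fin N → ℤ) : ℤ := ∑ s, ∑ i, (κ s i * κ s i - (N - 1) * κ s i)

theorem coeff_Eop (p : MvPolynomial (ι × Fin N) ℂ) (ζ) : coeff ζ (Eop p) = Eco (toZ ζ) * coeff ζ p := by
  simp only [Eop, coeff_sub, coeff_C_mul, coeff_sum, coeff_Dop, Eco, toZ]
  push_cast
  rw [Finset.mul_sum, ← Finset.sum_sub_distrib, Fintype.sum_prod_type, Finset.sum_mul]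
  refine Finset.sum_congr rfl fun s _ => ?_
  rw [Finset.sum_mul]
  refine Finset.sum_congr rfl fun i _ => ?_
  ring

noncomputable def PP (ι : Type) [Fintype ι] (N : ℕ) : Finset (ι × Fin N × Fin N) :=
  Finset.univ.filter fun p => p.2.1 < p.2.2

noncomputable def lin (α : ι × Fin N × Fin N) : MvPolynomial (ι × Fin N) ℂ :=
  X (α.1, α.2.1) - X (α.1, α.2.2)

noncomputable def aV (ι : Type) [Fintype ι] (N : ℕ) : MvPolynomial (ι × Fin N) ℂ :=
  ∏ α ∈ PP ι N, lin α

noncomputable def aE (α : ι × Fin N × Fin N) : MvPolynomial (ι × Fin N) ℂ :=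
  ∏ β ∈ (PP ι N).erase α, lin β

theorem aE_mul {α : ι × Fin N × Fin N} (h : α ∈ PP ι N) : aE α * lin α = aV ι N := by
  rw [aE, aV, Finset.prod_erase_mul _ _ h]

theorem leib_prod {A : Type} [CommRing A] [Algebra ℂ A] (D : Derivation ℂ A A) {τ : Type} (S : Finset τ)
    (f : τ → A) : D (∏ α ∈ S, f α) = ∑ α ∈ S, (∏ β ∈ S.erase α, f β) * D (f α) := by
  induction S using Finset.induction_on with
  | empty => simp
  | insert a S ha ih =>
    rw [Finset.prod_insert ha, D.leibniz, ih, Finset.sum_insert ha, Finset.erase_insert ha, smul_eq_mul,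
      smul_eq_mul, add_comm, Finset.mul_sum]
    congr 1
    refine Finset.sum_congr rfl fun b hb => ?_
    have : a ≠ b := fun h => ha (h ▸ hb)
    rw [Finset.erase_insert_of_ne this, Finset.prod_insert (by simp [ha]), mul_assoc]

theorem pair_sum {A : Type} [CommRing A] (f : ι × Fin N → A) :
    ∑ α ∈ PP ι N, (f (α.1, α.2.1) + f (α.1, α.2.2)) = ((N : A) - 1) * ∑ k, f k := by
  rw [PP, Finset.sum_filter, Fintype.sum_prod_type, Fintype.sum_prod_type, Finset.mul_sum]
  refine Finset.sum_congr rfl fun s _ => ?_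
  rw [Fintype.sum_prod_type]
  simp only
  have h : ∀ i j : Fin N, (if i < j then f (s, i) + f (s, j) else 0) =
      (if i < j then f (s, i) else 0) + (if i < j then f (s, j) else 0) := by
    intro i j; split_ifs <;> simp
  simp only [h, Finset.sum_add_distrib]
  rw [Finset.sum_comm (f := fun i j => if i < j then f (s, j) else 0), ← Finset.sum_add_distrib, Finset.mul_sum]
  refine Finset.sum_congr rfl fun i _ => ?_
  rw [← Finset.sum_add_distrib]
  have h2 : ∀ j : Fin N, ((if i < j then f (s, i) else 0) + (if j < i then f (s, i) else 0)) =
      f (s, i) - (if j = i then f (s, i) else 0) := by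
    intro j
    rcases lt_trichotomy i j with h | h | h
    · simp [h, h.not_gt, h.ne']
    · simp [h]
    · simp [h, h.not_gt, h.ne]
  simp only [h2, Finset.sum_sub_distrib]
  simp
  ring

theorem main_alg (ch : MvPolynomial (ι × Fin N) ℂ) (U : ι × Fin N × Fin N → MvPolynomial (ι × Fin N) ℂ)
    (c : ℂ)
    (hU : ∀ α ∈ PP ι N, lin α * U α = X (α.1, α.2.2) * (Dop (α.1, α.2.1) ch - Dop (α.1, α.2.2) ch))
    (hc : C c * ch = ∑ k, Dop k (Dop k ch) +
      ∑ α ∈ PP ι N, (Dop (α.1, α.2.1) ch - Dop (α.1, α.2.2) ch + 2 * U α)) :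
    Eop (aV ι N * ch) = C c * (aV ι N * ch) + ch * Eop (aV ι N) := by
  have h1 : ∀ k, Dop k (Dop k (aV ι N * ch)) = aV ι N * Dop k (Dop k ch) + 2 * (Dop k (aV ι N) * Dop k ch)
      + ch * Dop k (Dop k (aV ι N)) := by
    intro k
    simp only [Derivation.leibniz, map_add, smul_eq_mul]; ring
  have h2 : ∑ k, Dop k (aV ι N) * Dop k ch = ∑ α ∈ PP ι N, aE α *
      (X (α.1, α.2.1) * Dop (α.1, α.2.1) ch - X (α.1, α.2.2) * Dop (α.1, α.2.2) ch) := by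
    have : ∀ k, Dop k (aV ι N) * Dop k ch = ∑ α ∈ PP ι N, aE α *
      ((if k = (α.1, α.2.1) then X (α.1, α.2.1) * Dop k ch else 0)
        - (if k = (α.1, α.2.2) then X (α.1, α.2.2) * Dop k ch else 0)) := by
      intro k
      rw [aV, leib_prod, Finset.sum_mul]
      refine Finset.sum_congr rfl fun α _ => ?_
      have h0 : Dop k (lin α) * Dop k ch =
        ((if k = (α.1, α.2.1) then X (α.1, α.2.1) * Dop k ch else 0)
        - (if k = (α.1, α.2.2) then X (α.1, α.2.2) * Dop k ch else 0)) := by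
        rw [lin.eq_def, map_sub, Dop_X, Dop_X, sub_mul, ite_mul, ite_mul, zero_mul]
      rw [← h0, aE, mul_assoc]
      congr!
    simp only [this]
    rw [Finset.sum_comm]
    refine Finset.sum_congr rfl fun α _ => ?_
    rw [← Finset.mul_sum, Finset.sum_sub_distrib]
    simp
  have h3 : aV ι N * ∑ k, Dop k (Dop k ch) = C c * (aV ι N * ch) - ∑ α ∈ PP ι N, aE α *
      ((X (α.1, α.2.1) + X (α.1, α.2.2)) * (Dop (α.1, α.2.1) ch - Dop (α.1, α.2.2) ch)) := by
    have : ∑ k, Dop k (Dop k ch) = C c * ch - ∑ α ∈ PP ι N, (Dop (α.1, α.2.1) ch - Dop (α.1, α.2.2) ch + 2 * U α) := by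
      rw [hc]; ring
    rw [this, mul_sub, Finset.mul_sum]
    congr 1
    · ring
    · refine Finset.sum_congr rfl fun α hα => ?_
      have := hU α hα
      rw [← aE_mul hα]
      have h4 : aE α * lin α * (Dop (α.1, α.2.1) ch - Dop (α.1, α.2.2) ch + 2 * U α) =
        aE α * (lin α * (Dop (α.1, α.2.1) ch - Dop (α.1, α.2.2) ch) + 2 * (lin α * U α)) := by ring
      rw [h4, this, lin]; ring
  have h5 : ∑ α ∈ PP ι N, aE α * (lin α * (Dop (α.1, α.2.1) ch + Dop (α.1, α.2.2) ch)) =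
      aV ι N * (C ((N : ℂ) - 1) * ∑ k, Dop k ch) := by
    have := pair_sum (fun k => Dop k ch)
    simp only [map_sub, map_natCast, map_one]
    rw [← this, Finset.mul_sum]
    refine Finset.sum_congr rfl fun α hα => ?_
    rw [← aE_mul hα]; ring
  have h6 : 2 * ∑ k, Dop k (aV ι N) * Dop k ch + aV ι N * ∑ k, Dop k (Dop k ch) =
      C c * (aV ι N * ch) + aV ι N * (C ((N : ℂ) - 1) * ∑ k, Dop k ch) := by
    rw [← h5, h3, h2, Finset.mul_sum, add_sub_left_comm, ← Finset.sum_sub_distrib]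
    congr 1
    refine Finset.sum_congr rfl fun α hα => ?_
    rw [lin]; ring
  unfold Eop
  simp only [h1, Finset.sum_add_distrib]
  simp only [Derivation.leibniz, smul_eq_mul, Finset.sum_add_distrib]
  simp only [← Finset.mul_sum]
  linear_combination h6

noncomputable def wdel (w : ι → Equiv.Perm (Fin N)) : (ι × Fin N) →₀ ℕ :=
  Finsupp.equivFunOnFinite.symm fun p => N - 1 - (w p.1 p.2 : ℕ)

theorem aV_eq : aV ι N = ∑ w : ι → Equiv.Perm (Fin N),
    monomial (wdel w) (∏ s, ((Equiv.Perm.sign (w s) : ℤ) : ℂ)) := by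
  have h1 : aV ι N = ∏ s : ι, ∏ i : Fin N, ∏ j ∈ Finset.Ioi i,
      ((X (s, i) : MvPolynomial (ι × Fin N) ℂ) - X (s, j)) := by
    rw [aV, PP, Finset.prod_filter, Fintype.prod_prod_type]
    refine Finset.prod_congr rfl fun s _ => ?_
    rw [Fintype.prod_prod_type]
    refine Finset.prod_congr rfl fun i _ => ?_
    simp only
    rw [← Finset.prod_filter]
    refine Finset.prod_congr ?_ fun j _ => rfl
    ext j; simp
  have h2 : ∀ s : ι, ∏ i : Fin N, ∏ j ∈ Finset.Ioi i,
      ((X (s, i) : MvPolynomial (ι × Fin N) ℂ) - X (s, j)) =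
      ∑ σ : Equiv.Perm (Fin N), ((Equiv.Perm.sign σ : ℤ) : MvPolynomial (ι × Fin N) ℂ) *
        ∏ i, X (s, i) ^ (N - 1 - (σ i : ℕ)) := by
    intro s
    have h3 := Matrix.det_projVandermonde (fun _ => (1 : MvPolynomial (ι × Fin N) ℂ)) (fun i : Fin N => X (s, i))
    simp only [one_mul] at h3
    rw [← h3, ← Matrix.det_transpose, Matrix.det_apply']
    refine Finset.sum_congr rfl fun σ _ => ?_
    congr 1
    refine Finset.prod_congr rfl fun i _ => ?_
    rw [Matrix.transpose_apply, Matrix.projVandermonde_apply, one_pow, one_mul, Fin.val_rev]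
    congr 1
    omega
  rw [h1]
  simp only [h2]
  rw [Finset.prod_univ_sum, Fintype.piFinset_univ]
  refine Finset.sum_congr rfl fun w _ => ?_
  rw [Finset.prod_mul_distrib, monomial_eq, map_prod]
  refine congrArg₂ (· * ·) (Finset.prod_congr rfl fun s _ => by simp) ?_
  rw [Finsupp.prod_fintype _ _ (by simp), Fintype.prod_prod_type]
  rfl

end B5
end AK


open scoped BigOperators
open scoped Classical
set_option linter.unusedSectionVars false
set_option linter.unusedVariables false

namespace AK

section B6
open MvPolynomial
variable {ι : Type} [Fintype ι] {N : ℕ} {V : Type} [AddCommGroup V] [Module ℂ V]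
variable {e : ι → Fin N → Fin N → Module.End ℂ V}

noncomputable def eps (s : ι) (i : Fin N) : ι → Fin N → ℤ := Pi.single s (Pi.single i 1)

theorem eps_apply (s t : ι) (i k : Fin N) : eps s i t k = if t = s ∧ k = i then 1 else 0 := by
  unfold eps
  by_cases h : t = s
  · subst h; simp [Pi.single_apply]
  · simp [h]

theorem rt_eq (s : ι) (i j : Fin N) : rt s i j = eps s i - eps s j := by
  simp [rt, eps, Pi.single_sub]

theorem coeff_X_gf {f : (ι → Fin N → ℤ) → ℂ} (hn : ∀ κ, f κ ≠ 0 → ∀ s i, 0 ≤ κ s i)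
    {p : MvPolynomial (ι × Fin N) ℂ} (hp : ∀ ζ, coeff ζ p = f (toZ ζ)) (s : ι) (i : Fin N) (ζ) :
    coeff ζ (X (s, i) * p) = f (toZ ζ - eps s i) := by
  rw [coeff_X_mul']
  split_ifs with h
  · rw [hp]
    congr 1
    have h1 : 1 ≤ ζ (s, i) := Nat.one_le_iff_ne_zero.2 (by simpa using h)
    funext t k
    simp only [toZ, Pi.sub_apply, eps_apply, Finsupp.tsub_apply, Finsupp.single_apply, Prod.mk.injEq]
    by_cases h2 : s = t ∧ i = k
    · obtain ⟨rfl, rfl⟩ := h2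
      simp; omega
    · have h3 : ¬ (t = s ∧ k = i) := fun h => h2 ⟨h.1.symm, h.2.symm⟩
      simp [h2, h3]
  · by_contra h2
    have := hn _ (Ne.symm h2) s i
    simp [toZ, eps_apply] at this h
    omega

def shiftw (l : ι → Fin N → ℤ) (w : ι → Equiv.Perm (Fin N)) : ι → Fin N → ℤ :=
  fun s i => l s i + ((w s i : ℕ) : ℤ) - (i : ℤ)

def sgnw (w : ι → Equiv.Perm (Fin N)) : ℤ := ∏ s, (Equiv.Perm.sign (w s) : ℤ)

theorem Eco_wdel (w : ι → Equiv.Perm (Fin N)) : Eco (toZ (wdel w)) = Eco (toZ (wdel (1 : ι → Equiv.Perm (Fin N)))) := by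
  unfold Eco
  refine Finset.sum_congr rfl fun s _ => ?_
  rw [← Equiv.sum_comp (w s) (fun i => toZ (wdel 1) s i * toZ (wdel 1) s i - (N - 1) * toZ (wdel 1) s i)]
  rfl

theorem Eop_aV : Eop (aV ι N) = C (Eco (toZ (wdel (1 : ι → Equiv.Perm (Fin N)))) : ℂ) * aV ι N := by
  ext ζ
  rw [coeff_Eop, coeff_C_mul]
  by_cases h : coeff ζ (aV ι N) = 0
  · simp [h]
  · congr 2
    rw [aV_eq, coeff_sum] at h
    obtain ⟨w, -, hw⟩ := Finset.exists_ne_zero_of_sum_ne_zero h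
    rw [coeff_monomial] at hw
    split_ifs at hw with h2
    · rw [← h2, Eco_wdel]
    · exact absurd rfl hw

theorem wsum_zero (he : GLRel e) {W : Submodule ℂ V} (hW : Good e W) {c : ℂ}
    (hc : W ≤ (cas e).maxGenEigenspace c) (hn : ∀ κ, W ⊓ wt e κ ≠ ⊥ → ∀ s i, 0 ≤ κ s i)
    {l : ι → Fin N → ℤ} (hl : ∀ s i, 0 ≤ l s i) (hne : (cfun l : ℂ) ≠ c) :
    ∑ w : ι → Equiv.Perm (Fin N), (sgnw w : ℂ) * (mu e W (shiftw l w) : ℂ) = 0 := by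
  have hmu : ∀ κ, W ⊓ wt e κ = ⊥ → mu e W κ = 0 := by
    intro κ h; unfold mu; rw [h]; simp
  have hmn : ∀ κ, (mu e W κ : ℂ) ≠ 0 → ∀ s i, 0 ≤ κ s i := by
    intro κ h
    exact hn κ fun hb => h (by rw [hmu κ hb]; simp)
  have hun : ∀ s i j κ, uu he hW s i j κ ≠ 0 → ∀ s i, 0 ≤ κ s i := by
    intro s i j κ h
    exact hn κ fun hb => h (uu_zero he hW s i j κ hb)
  obtain ⟨ch, hch⟩ := gf_exists (fun κ => (mu e W κ : ℂ)) ((good_fin hW).subset fun κ h hb =>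
    h (by simp [hmu κ hb]))
  have hUex : ∀ α : ι × Fin N × Fin N, ∃ p : MvPolynomial (ι × Fin N) ℂ, ∀ ζ, coeff ζ p =
      uu he hW α.1 α.2.1 α.2.2 (toZ ζ) := fun α =>
    gf_exists (fun κ => uu he hW α.1 α.2.1 α.2.2 κ) ((good_fin hW).subset fun κ h hb =>
    h (uu_zero he hW _ _ _ κ hb))
  choose U hU using hUex
  have hD : ∀ s i ζ, coeff ζ (Dop (s, i) ch) = (toZ ζ s i : ℂ) * mu e W (toZ ζ) := by
    intro s i ζ
    rw [coeff_Dop, hch]; simp [toZ]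
  have key := main_alg ch U c ?_ ?_
  · obtain ⟨ζ, hζ⟩ := toZ_surj hl
    have h1 := congrArg (coeff (ζ + wdel 1)) key
    rw [coeff_Eop, coeff_add, Eop_aV, mul_left_comm ch, mul_comm ch, coeff_C_mul, coeff_C_mul] at h1
    have h2 : coeff (ζ + wdel 1) (aV ι N * ch) =
        ∑ w : ι → Equiv.Perm (Fin N), (sgnw w : ℂ) * (mu e W (shiftw l w) : ℂ) := by
      rw [aV_eq, Finset.sum_mul, coeff_sum]
      refine Finset.sum_congr rfl fun w _ => ?_
      rw [coeff_monomial_mul']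
      have hsg : (∏ s, ((Equiv.Perm.sign (w s) : ℤ) : ℂ)) = (sgnw w : ℂ) := by
        simp [sgnw]
      split_ifs with h3
      · rw [hsg, hch]
        congr 3
        funext s i
        have h4 := h3 (s, i)
        rw [← hζ]
        simp only [toZ, Finsupp.tsub_apply, Finsupp.add_apply, shiftw] at h4 ⊢
        have h5 : wdel w (s, i) = N - 1 - (w s i : ℕ) := rfl
        have h6 : wdel (1 : ι → Equiv.Perm (Fin N)) (s, i) = N - 1 - (i : ℕ) := rfl
        have := (w s i).2
        have := i.2
        omega
      · symm
        by_contra h4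
        apply h3
        have h5 := hmn _ (right_ne_zero_of_mul h4)
        rintro ⟨s, i⟩
        have h6 := h5 s i
        rw [← hζ] at h6
        simp only [toZ, Finsupp.add_apply, shiftw] at h6 ⊢
        have h5 : wdel w (s, i) = N - 1 - (w s i : ℕ) := rfl
        have h6 : wdel (1 : ι → Equiv.Perm (Fin N)) (s, i) = N - 1 - (i : ℕ) := rfl
        have := (w s i).2
        have := i.2
        omega
    rw [← h2]
    have h3 : (Eco (toZ (ζ + wdel 1)) - Eco (toZ (wdel (1 : ι → Equiv.Perm (Fin N)))) : ℤ) = cfun l := by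
      rw [cfun_eq, Eco, Eco, ← Finset.sum_sub_distrib]
      refine Finset.sum_congr rfl fun s _ => ?_
      rw [← Finset.sum_sub_distrib]
      refine Finset.sum_congr rfl fun i _ => ?_
      rw [← hζ]
      simp only [toZ, Finsupp.add_apply]
      have h6 : (wdel (1 : ι → Equiv.Perm (Fin N)) (s, i) : ℤ) = N - 1 - (i : ℤ) := by
        have : wdel (1 : ι → Equiv.Perm (Fin N)) (s, i) = N - 1 - (i : ℕ) := rfl
        have := i.2
        omega
      push_cast
      rw [h6]; ring
    have h3' : (Eco (toZ (ζ + wdel 1)) : ℂ) - Eco (toZ (wdel (1 : ι → Equiv.Perm (Fin N)))) = cfun l := by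
      exact_mod_cast h3
    have h4 : ((cfun l : ℂ) - c) * coeff (ζ + wdel 1) (aV ι N * ch) = 0 := by
      rw [← h3']
      linear_combination h1
    exact (mul_eq_zero.1 h4).resolve_left (sub_ne_zero.2 hne)
  · rintro ⟨s, i, j⟩ hα
    ext ζ
    have hq : ∀ ζ, coeff ζ (Dop (s, i) ch - Dop (s, j) ch) =
        (fun κ => ((κ s i : ℂ) - κ s j) * mu e W κ) (toZ ζ) := by
      intro ζ
      rw [coeff_sub, hD, hD]; ring
    rw [lin, sub_mul, coeff_sub, coeff_X_gf (hun s i j) (hU (s, i, j)), coeff_X_gf (hun s i j) (hU (s, i, j)),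
      coeff_X_gf (f := fun κ => ((κ s i : ℂ) - κ s j) * mu e W κ) (fun κ h => hmn κ (right_ne_zero_of_mul h)) hq, uu_step he hW]
    have h1 : toZ ζ - eps s i + rt s i j = toZ ζ - eps s j := by rw [rt_eq]; abel
    simp only
    rw [h1, uu_swap he hW s i j]
    ring
  · ext ζ
    rw [coeff_C_mul, hch, cas_trace he hW hc, coeff_add, coeff_sum, coeff_sum]
    have h1 : ∀ k : ι × Fin N, coeff ζ (Dop k (Dop k ch)) = (toZ ζ k.1 k.2 : ℂ) * (toZ ζ k.1 k.2 : ℂ) * mu e W (toZ ζ) := by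
      intro k
      rw [coeff_Dop, hD]; simp [toZ, mul_assoc]
    have h2 : ∀ α : ι × Fin N × Fin N, coeff ζ (Dop (α.1, α.2.1) ch - Dop (α.1, α.2.2) ch + 2 * U α) =
        ((toZ ζ α.1 α.2.1 : ℂ) - toZ ζ α.1 α.2.2) * mu e W (toZ ζ) + 2 * uu he hW α.1 α.2.1 α.2.2 (toZ ζ) := by
      intro α
      rw [coeff_add, coeff_sub, hD, hD, ← hU, two_mul, coeff_add]; ring
    simp only [h1, h2]
    rw [PP, Finset.sum_filter, Fintype.sum_prod_type, Fintype.sum_prod_type, cfun, ← Finset.sum_add_distrib]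
    push_cast
    rw [Finset.sum_mul, ← Finset.sum_add_distrib]
    refine Finset.sum_congr rfl fun s _ => ?_
    rw [Fintype.sum_prod_type, Finset.sum_mul, ← Finset.sum_add_distrib, ← Finset.sum_add_distrib]
    refine Finset.sum_congr rfl fun i _ => ?_
    simp only
    have h3 : (toZ ζ s i : ℂ) * (toZ ζ s i : ℂ) * mu e W (toZ ζ) =
      ∑ j, if i = j then (toZ ζ s i : ℂ) * (toZ ζ s i : ℂ) * mu e W (toZ ζ) else 0 := by simp
    rw [h3, Finset.sum_mul, ← Finset.sum_add_distrib, ← Finset.sum_add_distrib]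
    refine Finset.sum_congr rfl fun j _ => ?_
    unfold cterm
    by_cases h4 : i = j
    · subst h4; simp
    · by_cases h5 : i < j
      · simp only [h4, h5, if_true, if_false]; push_cast; ring
      · simp [h4, h5]

theorem shiftw_bot (he : GLRel e) {W : Submodule ℂ V} (hW : Good e W) {l : ι → Fin N → ℤ} (hl : Dom l)
    (hc : W ≤ (cas e).maxGenEigenspace (cfun l : ℂ)) (w : ι → Equiv.Perm (Fin N)) (hw : w ≠ 1) :
    W ⊓ wt e (shiftw l w) = ⊥ := by
  by_contra hcon
  obtain ⟨κ, h1, h2, h3, -⟩ := top_exists he hW bot_st hc (κ := shiftw l w) (by rwa [le_bot_iff])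
  have h4 : cfun κ = cfun l := by exact_mod_cast h3
  set β := κ - shiftw l w with hβ
  have hκ : ∀ s i, κ s i = l s i + (β s i + ((w s i : ℤ) - i)) := by
    intro s i; simp [hβ, shiftw]; ring
  have d1 : 0 ≤ ∑ s, ∑ i, (κ + l) s i * β s i := cone_dot h1 (by
    intro s i j h
    have := h2 s i j h
    have := hl s i j h
    simp only [Pi.add_apply]; omega)
  have d2 : 0 ≤ ∑ s, ∑ i, (κ + l) s i * ((w s i : ℤ) - i) := by
    refine Finset.sum_nonneg fun s _ => ?_
    simp only [mul_sub, Finset.sum_sub_distrib]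
    have hanti : Antivary (fun i : Fin N => (κ + l) s i) (fun i : Fin N => (i : ℤ)) := by
      intro i j h
      have h' : i < j := by
        have : (i : ℤ) < j := h
        exact_mod_cast this
      have := h2 s i j h'
      have := hl s i j h'
      simp only [Pi.add_apply]; omega
    have := hanti.sum_mul_le_sum_mul_comp_perm (σ := w s)
    linarith
  have d3 : ∀ s, ∑ i, β s i = 0 := cone_sum h1
  have d4 : ∀ s, ∑ i, ((w s i : ℤ) - i) = 0 := by
    intro s
    rw [Finset.sum_sub_distrib, Equiv.sum_comp (w s) (fun i : Fin N => (i : ℤ)), sub_self]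
  have d5 : 0 ≤ ht β := by
    rcases cone_ht h1 with h | h
    · rw [h]; simp [ht]
    · omega
  have d6 : 0 < ∑ s, ∑ i : Fin N, ((w s i : ℤ) - i) * ((w s i : ℤ) - i) := by
    obtain ⟨s, hs⟩ := Function.ne_iff.1 hw
    obtain ⟨i, hi⟩ := DFunLike.ne_iff.1 hs
    refine Finset.sum_pos' (fun s _ => Finset.sum_nonneg fun i _ => mul_self_nonneg _) ⟨s, Finset.mem_univ _, ?_⟩
    refine Finset.sum_pos' (fun i _ => mul_self_nonneg _) ⟨i, Finset.mem_univ _, ?_⟩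
    have : (w s i : ℤ) - i ≠ 0 := by
      intro h0
      apply hi
      apply Fin.ext
      simp
      omega
    exact mul_self_pos.2 this
  have d7 : ∀ s, ∑ i : Fin N, ((w s i : ℤ) * (w s i : ℤ)) = ∑ i : Fin N, (i : ℤ) * i := fun s =>
    Equiv.sum_comp (w s) (fun i : Fin N => (i : ℤ) * i)
  have d8 : ∑ s, ∑ i : Fin N, ((w s i : ℤ) - i) * ((w s i : ℤ) - i) =
      - ∑ s, ∑ i : Fin N, 2 * i * ((w s i : ℤ) - i) := by
    rw [← Finset.sum_neg_distrib]
    refine Finset.sum_congr rfl fun s _ => ?_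
    have : ∑ i : Fin N, ((w s i : ℤ) - i) * ((w s i : ℤ) - i) =
        ∑ i : Fin N, ((w s i : ℤ) * (w s i : ℤ)) - ∑ i : Fin N, (i : ℤ) * i
          - ∑ i : Fin N, 2 * i * ((w s i : ℤ) - i) := by
      rw [← Finset.sum_sub_distrib, ← Finset.sum_sub_distrib]
      exact Finset.sum_congr rfl fun i _ => by ring
    rw [this, d7]; ring
  have : cfun κ - cfun l = ∑ s, ∑ i, (κ + l) s i * β s i + ∑ s, ∑ i, (κ + l) s i * ((w s i : ℤ) - i)
      + 2 * ht β - ∑ s, ∑ i : Fin N, 2 * i * ((w s i : ℤ) - i) := by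
    have z1 : ∑ s, ∑ k, (β s k * ((N : ℤ) - 1) + ((w s k : ℤ) - k) * ((N : ℤ) - 1)) = 0 := by
      refine Finset.sum_eq_zero fun s _ => ?_
      rw [Finset.sum_add_distrib, ← Finset.sum_mul, ← Finset.sum_mul, d3, d4]; ring
    rw [← add_zero (_ - ∑ s, ∑ i : Fin N, 2 * (i : ℤ) * ((w s i : ℤ) - i)), ← z1, cfun_eq, cfun_eq, ht, Finset.mul_sum]
    simp only [Finset.mul_sum, ← Finset.sum_add_distrib, ← Finset.sum_sub_distrib]
    refine Finset.sum_congr rfl fun s _ => Finset.sum_congr rfl fun i _ => ?_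
    simp only [Pi.add_apply, hκ]
    ring
  omega

theorem char_formula (he : GLRel e) {W : Submodule ℂ V} (hW : Good e W)
    (hn : ∀ κ, W ⊓ wt e κ ≠ ⊥ → ∀ s i, 0 ≤ κ s i)
    {l : ι → Fin N → ℤ} (hl : ∀ s i, 0 ≤ l s i) (hd : Dom l) :
    (Module.finrank ℂ (hwv e W l) : ℤ) = ∑ w : ι → Equiv.Perm (Fin N), sgnw w * (mu e W (shiftw l w) : ℤ) := by
  have := hW.fd
  have hfin : {c | W ⊓ (cas e).maxGenEigenspace c ≠ ⊥}.Finite := by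
    have hst : ∀ v ∈ W, cas e v ∈ W := fun v hv => cas_mem hW.st hv
    have h1 := WellFoundedGT.finite_ne_bot_of_iSupIndep (Module.End.independent_maxGenEigenspace ((cas e).restrict hst))
    refine h1.subset fun c hcne hb => hcne ?_
    have hb' : Module.End.maxGenEigenspace ((cas e).restrict hst) c = ⊥ := hb
    rw [Module.End.maxGenEigenspace, Module.End.genEigenspace_restrict] at hb'
    rw [Module.End.maxGenEigenspace, ← Submodule.map_comap_subtype, hb', Submodule.map_bot]
  set F := insert (cfun l : ℂ) hfin.toFinset with hF
  have hmu : ∀ κ, mu e W κ = ∑ c ∈ F, mu e (gc e W c) κ := by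
    intro κ
    have := good_fdw hW κ
    unfold mu
    rw [gdim (cas e) (E := W ⊓ wt e κ) ?_ F ?_]
    · refine Finset.sum_congr rfl fun c _ => ?_
      rw [gc, inf_right_comm]
    · intro v hv
      refine ⟨cas_mem hW.st hv.1, ?_⟩
      intro s i
      have h := congrArg (fun f => f v) (cas_comm he s i i)
      simp only [Module.End.mul_apply, hv.2 s i, map_smul] at h
      exact h
    · intro c hcF
      rw [hF, Finset.mem_insert, not_or] at hcF
      have h0 : W ⊓ (cas e).maxGenEigenspace c = ⊥ := by simpa using hcF.2
      rw [inf_right_comm, h0, bot_inf_eq]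
  have hcast : ((Module.finrank ℂ (hwv e W l) : ℤ) : ℂ) =
      ((∑ w : ι → Equiv.Perm (Fin N), sgnw w * (mu e W (shiftw l w) : ℤ) : ℤ) : ℂ) := by
    simp only [hmu]
    push_cast
    simp only [Finset.mul_sum]
    rw [Finset.sum_comm, Finset.sum_eq_single (cfun l : ℂ)]
    · rw [Finset.sum_eq_single 1]
      · have : shiftw l 1 = l := by funext s i; simp [shiftw]
        rw [this, gc_hw he hW hd, mu]
        simp [sgnw]
      · intro w _ hw
        rw [mu, shiftw_bot he (good_gc he hW _) hd inf_le_right w hw]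
        simp
      · simp
    · intro c _ hcne
      exact wsum_zero he (good_gc he hW c) inf_le_right (fun κ h => hn κ fun hb => h (by
        rw [eq_bot_iff, ← hb]; exact inf_le_inf_right _ inf_le_left)) hl (Ne.symm hcne)
    · intro h
      exact absurd (Finset.mem_insert_self _ _) h
  exact_mod_cast hcast

end B6
end AK


open scoped BigOperators
open scoped Classical
set_option linter.unusedSectionVars false
set_option linter.unusedVariables false

namespace AK

section C1
open MvPolynomial

/-- variables carrying indices in `Fin N`, one (or none) for each `s : ι` -/
structure Idx (ι : Type) (N : ℕ) (Y : Type) where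
  idx : ι → Y → Option (Fin N)
  rep : ι → Fin N → Y → Y
  a1 : ∀ s x i j, idx s x = some j → idx s (rep s i x) = some i
  a2 : ∀ s t x i, s ≠ t → idx t (rep s i x) = idx t x
  a3 : ∀ s x i j, rep s i (rep s j x) = rep s i x
  a4 : ∀ s t x i j, s ≠ t → rep s i (rep t j x) = rep t j (rep s i x)
  a5 : ∀ s x i, idx s x = some i → rep s i x = x

variable {ι : Type} [Fintype ι] {N : ℕ} {Y : Type} [Fintype Y]

/-- polarisation derivations -/
noncomputable def dact (I : Idx ι N Y) (s : ι) (i j : Fin N) :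
    Derivation ℂ (MvPolynomial Y ℂ) (MvPolynomial Y ℂ) :=
  mkDerivation ℂ fun x => if I.idx s x = some j then X (I.rep s i x) else 0

noncomputable def act (I : Idx ι N Y) (s : ι) (i j : Fin N) : Module.End ℂ (MvPolynomial Y ℂ) :=
  (dact I s i j).toLinearMap

theorem act_apply (I : Idx ι N Y) (s : ι) (i j : Fin N) (p : MvPolynomial Y ℂ) :
    act I s i j p = dact I s i j p := rfl

theorem act_X (I : Idx ι N Y) (s : ι) (i j : Fin N) (x : Y) :
    act I s i j (X x) = if I.idx s x = some j then X (I.rep s i x) else 0 := by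
  simp [act, dact, mkDerivation_X]

theorem act_mul (I : Idx ι N Y) (s : ι) (i j : Fin N) (p q : MvPolynomial Y ℂ) :
    act I s i j (p * q) = act I s i j p * q + p * act I s i j q := by
  have := (dact I s i j).leibniz p q
  simp only [smul_eq_mul] at this
  simp only [act_apply]
  rw [this]; ring

theorem act_C (I : Idx ι N Y) (s : ι) (i j : Fin N) (c : ℂ) :
    act I s i j (C c) = 0 := derivation_C _ _

theorem act_one (I : Idx ι N Y) (s : ι) (i j : Fin N)  :
    act I s i j 1 = 0 := act_C I s i j 1

theorem act_rel (I : Idx ι N Y) : GLRel (act I) := by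
  constructor
  · intro s i j k l
    have h : ⁅dact I s i j, dact I s k l⁆ = (if j = k then dact I s i l else 0) -
        (if l = i then dact I s k j else 0) := by
      apply derivation_ext
      intro x
      rw [Derivation.commutator_apply]
      have h0 : ∀ s i j x, dact I s i j (X x) = if I.idx s x = some j then X (I.rep s i x) else 0 := act_X I
      rw [h0, h0]
      have h1 : dact I s i j (if I.idx s x = some l then X (I.rep s k x) else 0) =
        if I.idx s x = some l ∧ j = k then X (I.rep s i x) else 0 := by
        by_cases hl : I.idx s x = some l
        · rw [if_pos hl, h0, I.a1 _ _ _ _ hl, I.a3]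
          by_cases hjk : j = k
          · simp [hl, hjk]
          · simp [hl, hjk, Ne.symm hjk]
        · simp [hl]
      have h2 : dact I s k l (if I.idx s x = some j then X (I.rep s i x) else 0) =
        if I.idx s x = some j ∧ l = i then X (I.rep s k x) else 0 := by
        by_cases hl : I.idx s x = some j
        · rw [if_pos hl, h0, I.a1 _ _ _ _ hl, I.a3]
          by_cases hjk : l = i
          · simp [hl, hjk]
          · simp [hl, hjk, Ne.symm hjk]
        · simp [hl]
      rw [h1, h2, Derivation.sub_apply]
      by_cases hjk : j = k <;> by_cases hli : l = i <;> simp [hjk, hli, h0]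
    refine LinearMap.ext fun p => ?_
    have := congrArg (fun D => D p) h
    simp only [Derivation.commutator_apply, Derivation.sub_apply] at this
    simp only [Module.End.mul_apply, act_apply, LinearMap.sub_apply, LinearMap.add_apply]
    rw [sub_eq_iff_eq_add] at this
    rw [this]
    by_cases hjk : j = k <;> by_cases hli : l = i <;> simp [hjk, hli, act_apply] <;> ring
  · intro s t hst i j k l
    have h : ⁅dact I s i j, dact I t k l⁆ = 0 := by
      apply derivation_ext
      intro x
      rw [Derivation.commutator_apply]
      have h0 : ∀ s i j x, dact I s i j (X x) = if I.idx s x = some j then X (I.rep s i x) else 0 := act_X I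
      rw [h0, h0]
      by_cases h1 : I.idx t x = some l <;> by_cases h2 : I.idx s x = some j <;>
        simp [h1, h2, h0, I.a2 s t _ _ hst, I.a2 t s _ _ (Ne.symm hst), I.a4 s t _ _ _ hst]
    refine LinearMap.ext fun p => ?_
    have := congrArg (fun D => D p) h
    simp only [Derivation.commutator_apply, Derivation.zero_apply] at this
    exact sub_eq_zero.1 this

/-- weight of an exponent -/
noncomputable def wv (I : Idx ι N Y) (m : Y →₀ ℕ) : ι → Fin N → ℤ :=
  fun s i => ∑ x, if I.idx s x = some i then (m x : ℤ) else 0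

theorem act_monomial (I : Idx ι N Y) (s : ι) (i j : Fin N) (m : Y →₀ ℕ) (r : ℂ) :
    act I s i j (monomial m r) = ∑ x, if I.idx s x = some j then
      monomial (m - Finsupp.single x 1 + Finsupp.single (I.rep s i x) 1) (r * m x) else 0 := by
  have : act I s i j (monomial m r) = dact I s i j (monomial m r) := rfl
  rw [this, dact, mkDerivation_monomial, Finsupp.sum_fintype _ _ (by simp), Finset.smul_sum]
  refine Finset.sum_congr rfl fun x _ => ?_
  split_ifs with h
  · rw [smul_eq_mul, X, monomial_mul, smul_monomial]; simp
  · simp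

theorem act_diag (I : Idx ι N Y) (s : ι) (i : Fin N) (m : Y →₀ ℕ) (r : ℂ) :
    act I s i i (monomial m r) = (wv I m s i : ℂ) • monomial m r := by
  rw [act_monomial, wv]
  push_cast
  rw [Finset.sum_smul]
  refine Finset.sum_congr rfl fun x _ => ?_
  split_ifs with h
  · rw [I.a5 _ _ _ h, smul_monomial]
    by_cases h0 : m x = 0
    · simp [h0]
    · rw [tsub_add_cancel_of_le]
      · simp [mul_comm]
      · rw [Finsupp.single_le_iff]; omega
  · simp

theorem coeff_act_diag (I : Idx ι N Y) (s : ι) (i : Fin N) (m : Y →₀ ℕ) (p : MvPolynomial Y ℂ) :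
    coeff m (act I s i i p) = (wv I m s i : ℂ) * coeff m p := by
  induction p using MvPolynomial.induction_on' with
  | monomial u a =>
    rw [act_diag, coeff_smul, coeff_monomial]
    split_ifs with h
    · subst h; simp
    · simp
  | add p q hp hq => simp [hp, hq, mul_add]

theorem mem_wt_act {I : Idx ι N Y} {κ : ι → Fin N → ℤ} {p : MvPolynomial Y ℂ} :
    p ∈ wt (act I) κ ↔ ∀ m, coeff m p ≠ 0 → wv I m = κ := by
  rw [mem_wt]
  constructor
  · intro h m hm
    funext s i
    have := congrArg (coeff m) (h s i)
    rw [coeff_act_diag, coeff_smul, smul_eq_mul] at this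
    exact_mod_cast mul_right_cancel₀ hm this
  · intro h s i
    ext m
    rw [coeff_act_diag, coeff_smul, smul_eq_mul]
    by_cases hm : coeff m p = 0
    · simp [hm]
    · rw [h m hm]

theorem wt_act_eq (I : Idx ι N Y) (κ : ι → Fin N → ℤ) :
    wt (act I) κ = restrictSupport ℂ {m | wv I m = κ} := by
  ext p
  rw [mem_wt_act, mem_restrictSupport_iff]
  constructor
  · intro h m hm
    exact h m (by simpa using hm)
  · intro h m hm
    exact h (by simpa using hm)

noncomputable def Wd (Y : Type) (D : ℕ) : Submodule ℂ (MvPolynomial Y ℂ) :=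
  restrictSupport ℂ {m : Y →₀ ℕ | m.degree ≤ D}

theorem deg_fin (D : ℕ) : {m : Y →₀ ℕ | m.degree ≤ D}.Finite := by
  have : Set.Finite (Set.Iic (Finsupp.equivFunOnFinite.symm (fun _ : Y => D))) := Set.finite_Iic _
  refine this.subset ?_
  intro m hm x
  have h1 : m x ≤ m.degree := by
    rw [Finsupp.degree_eq_sum]
    exact Finset.single_le_sum (f := fun x => m x) (fun _ _ => Nat.zero_le _) (Finset.mem_univ x)
  exact h1.trans hm

theorem Wd_fd (D : ℕ) : FiniteDimensional ℂ (Wd Y D) := by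
  have := (deg_fin (Y := Y) D).to_subtype
  exact Module.Finite.of_basis (basisRestrictSupport ℂ {m : Y →₀ ℕ | m.degree ≤ D})

theorem Wd_st (I : Idx ι N Y) (D : ℕ) (s : ι) (i j : Fin N) :
    ∀ p ∈ Wd Y D, act I s i j p ∈ Wd Y D := by
  intro p hp
  rw [Wd, restrictSupport_eq_span] at hp
  induction hp using Submodule.span_induction with
  | mem x hx =>
    obtain ⟨m, hm, rfl⟩ := hx
    simp only
    rw [act_monomial]
    refine Submodule.sum_mem _ fun x _ => ?_
    split_ifs with h
    · rw [Wd, monomial_mem_restrictSupport]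
      by_cases h0 : m x = 0
      · right; simp [h0]
      · left
        simp only [Set.mem_ofPred_eq] at hm ⊢
        have h2 : m = m - Finsupp.single x 1 + Finsupp.single x 1 := by
          rw [tsub_add_cancel_of_le]
          rw [Finsupp.single_le_iff]; omega
        rw [h2, map_add, Finsupp.degree_single] at hm
        rw [map_add, Finsupp.degree_single]
        exact hm
    · exact Submodule.zero_mem _
  | zero => simp
  | add x y _ _ hx hy => rw [map_add]; exact Submodule.add_mem _ hx hy
  | smul a x _ hx => rw [map_smul]; exact Submodule.smul_mem _ _ hx

theorem Wd_good (I : Idx ι N Y) (D : ℕ) : Good (act I) (Wd Y D) := by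
  refine ⟨Wd_fd D, Wd_st I D, ?_⟩
  nth_rw 1 [Wd]
  rw [restrictSupport_eq_span, Submodule.span_le]
  rintro _ ⟨m, hm, rfl⟩
  refine Submodule.mem_iSup_of_mem (wv I m) ⟨?_, ?_⟩
  · simp only [Wd]
    exact (monomial_mem_restrictSupport ℂ).2 (Or.inl hm)
  · rw [wt_act_eq]
    exact (monomial_mem_restrictSupport ℂ).2 (Or.inl rfl)

theorem mu_Wd (I : Idx ι N Y) (D : ℕ) (κ : ι → Fin N → ℤ) :
    mu (act I) (Wd Y D) κ = Set.ncard {m : Y →₀ ℕ | m.degree ≤ D ∧ wv I m = κ} := by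
  have h : Wd Y D ⊓ wt (act I) κ = restrictSupport ℂ {m : Y →₀ ℕ | m.degree ≤ D ∧ wv I m = κ} := by
    rw [wt_act_eq, Wd]
    ext p
    simp only [Submodule.mem_inf, mem_restrictSupport_iff, Set.ofPred_and, Set.subset_inter_iff]
  rw [mu, h, Module.finrank_eq_nat_card_basis (basisRestrictSupport ℂ _), Nat.card_coe_set_eq]

theorem wv_nonneg (I : Idx ι N Y) (m : Y →₀ ℕ) (s : ι) (i : Fin N) : 0 ≤ wv I m s i :=
  Finset.sum_nonneg fun x _ => by split_ifs <;> simp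

theorem wt_nonneg (I : Idx ι N Y) {κ : ι → Fin N → ℤ} {p : MvPolynomial Y ℂ} (hp : p ∈ wt (act I) κ)
    (h0 : p ≠ 0) (s : ι) (i : Fin N) : 0 ≤ κ s i := by
  obtain ⟨m, hm⟩ := exists_coeff_ne_zero h0
  rw [← mem_wt_act.1 hp m hm]
  exact wv_nonneg I m s i

theorem char_Wd (I : Idx ι N Y) (D : ℕ) {l : ι → Fin N → ℤ} (hl : ∀ s i, 0 ≤ l s i) (hd : Dom l) :
    (Module.finrank ℂ (hwv (act I) (Wd Y D) l) : ℤ) = ∑ w : ι → Equiv.Perm (Fin N),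
      sgnw w * (Set.ncard {m : Y →₀ ℕ | m.degree ≤ D ∧ wv I m = shiftw l w} : ℤ) := by
  rw [char_formula (act_rel I) (Wd_good I D) ?_ hl hd]
  · simp only [mu_Wd]
  · intro κ hκ s i
    obtain ⟨p, hp, h0⟩ := (Submodule.ne_bot_iff _).1 hκ
    exact wt_nonneg I hp.2 h0 s i

theorem hwv_mul {I : Idx ι N Y} {κ κ' : ι → Fin N → ℤ} {p q : MvPolynomial Y ℂ}
    (hp : p ∈ hwv (act I) ⊤ κ) (hq : q ∈ hwv (act I) ⊤ κ') : p * q ∈ hwv (act I) ⊤ (κ + κ') := by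
  rw [mem_hwv] at hp hq ⊢
  refine ⟨trivial, ?_, ?_⟩
  · intro s i
    rw [act_mul, hp.2.1 s i, hq.2.1 s i]
    simp only [Pi.add_apply, Int.cast_add, add_smul, smul_mul_assoc, mul_smul_comm]
  · intro s i j h
    rw [act_mul, hp.2.2 s i j h, hq.2.2 s i j h]; simp

theorem hwv_one {I : Idx ι N Y} : (1 : MvPolynomial Y ℂ) ∈ hwv (act I) ⊤ 0 := by
  rw [mem_hwv]
  refine ⟨trivial, ?_, ?_⟩
  · intro s i; simp [act_one]
  · intro s i j _; exact act_one ..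

theorem hwv_pow {I : Idx ι N Y} {κ : ι → Fin N → ℤ} {p : MvPolynomial Y ℂ}
    (hp : p ∈ hwv (act I) ⊤ κ) (n : ℕ) : p ^ n ∈ hwv (act I) ⊤ (n • κ) := by
  induction n with
  | zero => simpa using hwv_one
  | succ n ih => rw [pow_succ, succ_nsmul]; exact hwv_mul ih hp

theorem hwv_prod {I : Idx ι N Y} {α : Type} (F : Finset α) (κ : α → ι → Fin N → ℤ)
    (p : α → MvPolynomial Y ℂ) (hp : ∀ a ∈ F, p a ∈ hwv (act I) ⊤ (κ a)) :
    ∏ a ∈ F, p a ∈ hwv (act I) ⊤ (∑ a ∈ F, κ a) := by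
  induction F using Finset.induction_on with
  | empty => simpa using hwv_one
  | insert a F ha ih =>
    rw [Finset.prod_insert ha, Finset.sum_insert ha]
    exact hwv_mul (hp _ (Finset.mem_insert_self _ _)) (ih fun b hb => hp b (Finset.mem_insert_of_mem hb))

theorem wv_add (I : Idx ι N Y) (m m' : Y →₀ ℕ) : wv I (m + m') = wv I m + wv I m' := by
  funext s i
  simp only [wv, Pi.add_apply, ← Finset.sum_add_distrib]
  refine Finset.sum_congr rfl fun x _ => ?_
  split_ifs <;> simp

theorem wt_deg (I : Idx ι N Y) (hI : ∀ x, ∃ s i, I.idx s x = some i) (m : Y →₀ ℕ) :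
    (m.degree : ℤ) ≤ ∑ s, ∑ i, wv I m s i := by
  unfold wv
  simp only [Finset.sum_comm (t := (Finset.univ : Finset Y))]
  rw [Finsupp.degree_eq_sum]
  push_cast
  refine Finset.sum_le_sum fun x _ => ?_
  obtain ⟨s, i, h⟩ := hI x
  calc (m x : ℤ) = if I.idx s x = some i then (m x : ℤ) else 0 := by simp [h]
    _ ≤ ∑ i, if I.idx s x = some i then (m x : ℤ) else 0 :=
        Finset.single_le_sum (f := fun i => if I.idx s x = some i then (m x : ℤ) else 0)
          (fun i _ => by beta_reduce; split_ifs <;> simp) (Finset.mem_univ i)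
    _ ≤ _ := Finset.single_le_sum (f := fun s => ∑ i, if I.idx s x = some i then (m x : ℤ) else 0)
          (fun s _ => Finset.sum_nonneg fun i _ => by split_ifs <;> simp) (Finset.mem_univ s)

theorem wt_le_Wd (I : Idx ι N Y) (hI : ∀ x, ∃ s i, I.idx s x = some i) {κ : ι → Fin N → ℤ} {D : ℕ}
    (hD : ∑ s, ∑ i, κ s i ≤ D) : wt (act I) κ ≤ Wd Y D := by
  rw [wt_act_eq, Wd]
  apply restrictSupport_mono
  intro m hm
  have h1 := wt_deg I hI m
  have : wv I m = κ := hm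
  rw [this] at h1
  have h2 : (m.degree : ℤ) ≤ D := h1.trans hD
  exact_mod_cast h2

theorem hwv_top_eq (I : Idx ι N Y) (hI : ∀ x, ∃ s i, I.idx s x = some i) {κ : ι → Fin N → ℤ} {D : ℕ}
    (hD : ∑ s, ∑ i, κ s i ≤ D) : hwv (act I) ⊤ κ = hwv (act I) (Wd Y D) κ := by
  ext p
  rw [mem_hwv, mem_hwv]
  exact ⟨fun h => ⟨wt_le_Wd I hI hD h.2.1, h.2⟩, fun h => ⟨trivial, h.2⟩⟩

theorem char_top (I : Idx ι N Y) (hI : ∀ x, ∃ s i, I.idx s x = some i) {l : ι → Fin N → ℤ}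
    (hl : ∀ s i, 0 ≤ l s i) (hd : Dom l) :
    (Module.finrank ℂ (hwv (act I) ⊤ l) : ℤ) = ∑ w : ι → Equiv.Perm (Fin N),
      sgnw w * (Set.ncard {m : Y →₀ ℕ | wv I m = shiftw l w} : ℤ) := by
  have hsum : ∀ w : ι → Equiv.Perm (Fin N), ∑ s, ∑ i, shiftw l w s i = ∑ s, ∑ i, l s i := by
    intro w
    refine Finset.sum_congr rfl fun s _ => ?_
    simp only [shiftw, add_sub_assoc, Finset.sum_add_distrib, Finset.sum_sub_distrib]
    rw [Equiv.sum_comp (w s) (fun i : Fin N => ((i : ℕ) : ℤ))]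
    ring
  have h0 : 0 ≤ ∑ s, ∑ i, l s i := Finset.sum_nonneg fun s _ => Finset.sum_nonneg fun i _ => hl s i
  rw [hwv_top_eq I hI (D := (∑ s, ∑ i, l s i).toNat) (Int.self_le_toNat _), char_Wd I _ hl hd]
  refine Finset.sum_congr rfl fun w _ => ?_
  congr 3
  ext m
  simp only [Set.mem_ofPred_eq, and_iff_right_iff_imp]
  intro h
  have := wt_deg I hI m
  rw [h, hsum w] at this
  omega

theorem hwv_fd (I : Idx ι N Y) (hI : ∀ x, ∃ s i, I.idx s x = some i) (κ : ι → Fin N → ℤ) :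
    FiniteDimensional ℂ (hwv (act I) ⊤ κ) := by
  rw [hwv_top_eq I hI (D := (∑ s, ∑ i, κ s i).toNat) (Int.self_le_toNat _)]
  have := Wd_fd (Y := Y) (∑ s, ∑ i, κ s i).toNat
  exact Submodule.finiteDimensional_of_le (fun v hv => (mem_hwv.1 hv).1)

end C1
end AK


open scoped BigOperators
open scoped Classical
set_option linter.unusedSectionVars false
set_option linter.unusedVariables false

namespace AK

section C2
open MvPolynomial

/-- variables `x i k`, `y j k`, `z i j k` -/
abbrev TV (N : ℕ) : Type := (Fin N × Fin N) ⊕ ((Fin N × Fin N) ⊕ (Fin N × Fin N × Fin N))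

/-- three square matrices of variables -/
abbrev UV (N : ℕ) : Type := Fin 3 × Fin N × Fin N

def tidx {N : ℕ} : Fin 3 → TV N → Option (Fin N)
  | 0, Sum.inl (i, _) => some i
  | 1, Sum.inl _ => none
  | 2, Sum.inl (_, k) => some k
  | 0, Sum.inr (Sum.inl _) => none
  | 1, Sum.inr (Sum.inl (j, _)) => some j
  | 2, Sum.inr (Sum.inl (_, k)) => some k
  | 0, Sum.inr (Sum.inr (i, _, _)) => some i
  | 1, Sum.inr (Sum.inr (_, j, _)) => some j
  | 2, Sum.inr (Sum.inr (_, _, k)) => some k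

def trep {N : ℕ} : Fin 3 → Fin N → TV N → TV N
  | 0, a, Sum.inl (_, k) => Sum.inl (a, k)
  | 1, _, Sum.inl p => Sum.inl p
  | 2, a, Sum.inl (i, _) => Sum.inl (i, a)
  | 0, _, Sum.inr (Sum.inl p) => Sum.inr (Sum.inl p)
  | 1, a, Sum.inr (Sum.inl (_, k)) => Sum.inr (Sum.inl (a, k))
  | 2, a, Sum.inr (Sum.inl (j, _)) => Sum.inr (Sum.inl (j, a))
  | 0, a, Sum.inr (Sum.inr (_, j, k)) => Sum.inr (Sum.inr (a, j, k))
  | 1, a, Sum.inr (Sum.inr (i, _, k)) => Sum.inr (Sum.inr (i, a, k))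
  | 2, a, Sum.inr (Sum.inr (i, j, _)) => Sum.inr (Sum.inr (i, j, a))

def tI (N : ℕ) : Idx (Fin 3) N (TV N) where
  idx := tidx
  rep := trep
  a1 := by
    intro s x i j h
    rcases x with ⟨a, b⟩ | ⟨a, b⟩ | ⟨a, b, c⟩ <;> fin_cases s <;> simp_all [tidx, trep]
  a2 := by
    intro s t x i h
    rcases x with ⟨a, b⟩ | ⟨a, b⟩ | ⟨a, b, c⟩ <;> fin_cases s <;> fin_cases t <;> simp_all [tidx, trep]
  a3 := by
    intro s x i j
    rcases x with ⟨a, b⟩ | ⟨a, b⟩ | ⟨a, b, c⟩ <;> fin_cases s <;> simp_all [tidx, trep]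
  a4 := by
    intro s t x i j h
    rcases x with ⟨a, b⟩ | ⟨a, b⟩ | ⟨a, b, c⟩ <;> fin_cases s <;> fin_cases t <;> simp_all [tidx, trep]
  a5 := by
    intro s x i h
    rcases x with ⟨a, b⟩ | ⟨a, b⟩ | ⟨a, b, c⟩ <;> fin_cases s <;> simp_all [tidx, trep]

theorem tI_all (N : ℕ) (x : TV N) : ∃ s i, (tI N).idx s x = some i := by
  rcases x with ⟨a, b⟩ | ⟨a, b⟩ | ⟨a, b, c⟩
  · exact ⟨2, b, rfl⟩
  · exact ⟨2, b, rfl⟩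
  · exact ⟨2, c, rfl⟩

def uidx {N : ℕ} : Fin 3 ⊕ Fin 3 → UV N → Option (Fin N)
  | Sum.inl s, (t, a, _) => if t = s then some a else none
  | Sum.inr s, (t, _, b) => if t = s then some b else none

def urep {N : ℕ} : Fin 3 ⊕ Fin 3 → Fin N → UV N → UV N
  | Sum.inl s, i, (t, a, b) => if t = s then (t, i, b) else (t, a, b)
  | Sum.inr s, i, (t, a, b) => if t = s then (t, a, i) else (t, a, b)

def uI (N : ℕ) : Idx (Fin 3 ⊕ Fin 3) N (UV N) where
  idx := uidx
  rep := urep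
  a1 := by
    rintro (s | s) ⟨t, a, b⟩ i j h <;> simp only [uidx, urep] at h ⊢ <;> split_ifs at h ⊢ <;> simp_all
  a2 := by
    rintro (s | s) (s' | s') ⟨t, a, b⟩ i h <;> simp only [uidx, urep] <;> split_ifs <;> simp_all
  a3 := by
    rintro (s | s) ⟨t, a, b⟩ i j <;> simp only [urep] <;> split_ifs <;> simp_all
  a4 := by
    rintro (s | s) (s' | s') ⟨t, a, b⟩ i j h <;> simp only [urep] <;> split_ifs <;> simp_all
  a5 := by
    rintro (s | s) ⟨t, a, b⟩ i h <;> simp only [uidx, urep] at h ⊢ <;> split_ifs at h ⊢ <;> simp_all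

theorem uI_all (N : ℕ) (x : UV N) : ∃ s i, (uI N).idx s x = some i := by
  obtain ⟨t, a, b⟩ := x
  exact ⟨Sum.inl t, a, by simp [uI, uidx]⟩

def sumIdx {ι κ : Type} {N : ℕ} {A B : Type} (I : Idx ι N A) (K : Idx κ N B) :
    Idx (ι ⊕ κ) N (A ⊕ B) where
  idx s x := match s, x with
    | Sum.inl s, Sum.inl x => I.idx s x
    | Sum.inr s, Sum.inr x => K.idx s x
    | Sum.inl _, Sum.inr _ => none
    | Sum.inr _, Sum.inl _ => none
  rep s i x := match s, x with
    | Sum.inl s, Sum.inl x => Sum.inl (I.rep s i x)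
    | Sum.inr s, Sum.inr x => Sum.inr (K.rep s i x)
    | Sum.inl _, Sum.inr x => Sum.inr x
    | Sum.inr _, Sum.inl x => Sum.inl x
  a1 := by
    rintro (s | s) (x | x) i j h <;> simp at h ⊢
    · exact I.a1 _ _ _ _ h
    · exact K.a1 _ _ _ _ h
  a2 := by
    rintro (s | s) (t | t) (x | x) i h <;> simp at h ⊢
    · exact I.a2 _ _ _ _ h
    · exact K.a2 _ _ _ _ h
  a3 := by
    rintro (s | s) (x | x) i j <;> simp
    · exact I.a3 _ _ _ _
    · exact K.a3 _ _ _ _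
  a4 := by
    rintro (s | s) (t | t) (x | x) i j h <;> simp at h ⊢
    · exact I.a4 _ _ _ _ _ h
    · exact K.a4 _ _ _ _ _ h
  a5 := by
    rintro (s | s) (x | x) i h <;> simp at h ⊢
    · exact I.a5 _ _ _ h
    · exact K.a5 _ _ _ h

def oI (N : ℕ) : Idx (Fin 3 ⊕ (Fin 3 ⊕ Fin 3)) N (TV N ⊕ UV N) := sumIdx (tI N) (uI N)

abbrev SR (N : ℕ) := MvPolynomial (TV N) ℂ
abbrev AR (N : ℕ) := MvPolynomial (UV N) ℂ
abbrev OR (N : ℕ) := MvPolynomial (TV N ⊕ UV N) ℂ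

theorem inter {A B : Type} (φ : MvPolynomial A ℂ →ₐ[ℂ] MvPolynomial B ℂ)
    (D₁ : Derivation ℂ (MvPolynomial A ℂ) (MvPolynomial A ℂ))
    (D₂ : Derivation ℂ (MvPolynomial B ℂ) (MvPolynomial B ℂ))
    (h : ∀ x, φ (D₁ (X x)) = D₂ (φ (X x))) (p) : φ (D₁ p) = D₂ (φ p) := by
  induction p using MvPolynomial.induction_on with
  | C a =>
    have : φ (C a) = C a := φ.commutes a
    rw [this, derivation_C, derivation_C, map_zero]
  | add p q hp hq => simp only [map_add, hp, hq]
  | mul_X p i hp =>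
    rw [map_mul φ, Derivation.leibniz, Derivation.leibniz]
    simp only [smul_eq_mul, map_add, map_mul, hp, h]

variable {N : ℕ}

noncomputable def tot (N : ℕ) (s : Fin 3) (i j : Fin N) : Module.End ℂ (OR N) :=
  act (oI N) (Sum.inl s) i j - act (oI N) (Sum.inr (Sum.inr s)) j i

theorem tot_mul (s : Fin 3) (i j : Fin N) (p q : OR N) :
    tot N s i j (p * q) = tot N s i j p * q + p * tot N s i j q := by
  simp only [tot, LinearMap.sub_apply, act_mul]; ring

theorem tot_rel : GLRel (tot N) := by
  have h := act_rel (oI N)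
  constructor
  · intro s i j k l
    have h1 := h.same (Sum.inl s) i j k l
    have h2 := h.same (Sum.inr (Sum.inr s)) j i l k
    have h3 := h.diff (Sum.inl s) (Sum.inr (Sum.inr s)) (by simp) i j l k
    have h4 := h.diff (Sum.inl s) (Sum.inr (Sum.inr s)) (by simp) k l j i
    simp only [tot, sub_mul, mul_sub, h1, h2, h3, h4]
    by_cases hjk : j = k
    · subst hjk
      by_cases hli : l = i
      · subst hli; simp; abel
      · simp [hli, Ne.symm hli]; abel
    · by_cases hli : l = i
      · subst hli; simp [hjk, Ne.symm hjk]; abel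
      · simp [hli, Ne.symm hli, hjk, Ne.symm hjk]; abel
  · intro s t hst i j k l
    have h1 := h.diff (Sum.inl s) (Sum.inl t) (by simpa using hst) i j k l
    have h2 := h.diff (Sum.inr (Sum.inr s)) (Sum.inr (Sum.inr t)) (by simpa using hst) j i l k
    have h3 := h.diff (Sum.inl s) (Sum.inr (Sum.inr t)) (by simp) i j l k
    have h4 := h.diff (Sum.inl t) (Sum.inr (Sum.inr s)) (by simp) k l j i
    simp only [tot, sub_mul, mul_sub, h1, h2, h3, h4]
    abel

theorem tot_good (D : ℕ) : Good (tot N) (Wd (TV N ⊕ UV N) D) := by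
  have h := Wd_good (oI N) D
  refine ⟨h.fd, fun s i j v hv => Submodule.sub_mem _ (h.st _ _ _ _ hv) (h.st _ _ _ _ hv), ?_⟩
  refine h.dec.trans (iSup_le fun κ => ?_)
  refine le_trans ?_ (le_iSup _ (fun s i => κ (Sum.inl s) i - κ (Sum.inr (Sum.inr s)) i))
  rintro v ⟨hv, hw⟩
  refine ⟨hv, fun s i => ?_⟩
  rw [tot, LinearMap.sub_apply, hw, hw]
  push_cast
  rw [sub_smul]

noncomputable def uu' (N : ℕ) (s : Fin 3) (a b : Fin N) : OR N := X (Sum.inr (s, a, b))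
noncomputable def xx (N : ℕ) (x : TV N) : OR N := X (Sum.inl x)

noncomputable def phiX (N : ℕ) : TV N → OR N
  | Sum.inl (a, k) => ∑ i', ∑ k', uu' N 0 a i' * uu' N 2 k k' * xx N (Sum.inl (i', k'))
  | Sum.inr (Sum.inl (b, k)) => ∑ j', ∑ k', uu' N 1 b j' * uu' N 2 k k' * xx N (Sum.inr (Sum.inl (j', k')))
  | Sum.inr (Sum.inr (a, b, k)) => ∑ i', ∑ j', ∑ k',
      uu' N 0 a i' * uu' N 1 b j' * uu' N 2 k k' * xx N (Sum.inr (Sum.inr (i', j', k')))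

noncomputable def phi (N : ℕ) : SR N →ₐ[ℂ] OR N := aeval (phiX N)

noncomputable def ev (N : ℕ) : OR N →ₐ[ℂ] SR N :=
  aeval (Sum.elim X (fun u : UV N => if u.2.1 = u.2.2 then 1 else 0))

theorem dact_mul {ι : Type} {Y : Type} (I : Idx ι N Y) (s : ι) (i j : Fin N) (p q : MvPolynomial Y ℂ) :
    dact I s i j (p * q) = dact I s i j p * q + p * dact I s i j q := by
  rw [Derivation.leibniz]; simp only [smul_eq_mul]; ring

theorem L_uu (s t : Fin 3) (i j a b : Fin N) : dact (oI N) (Sum.inr (Sum.inl s)) i j (uu' N t a b) =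
    if t = s ∧ a = j then uu' N t i b else 0 := by
  rw [← act_apply, uu', act_X]
  simp only [oI, sumIdx, uI, uidx, urep, uu']
  by_cases h : t = s <;> by_cases h2 : a = j <;> simp [h, h2]

theorem R_uu (s t : Fin 3) (i j a b : Fin N) : dact (oI N) (Sum.inr (Sum.inr s)) i j (uu' N t a b) =
    if t = s ∧ b = j then uu' N t a i else 0 := by
  rw [← act_apply, uu', act_X]
  simp only [oI, sumIdx, uI, uidx, urep, uu']
  by_cases h : t = s <;> by_cases h2 : b = j <;> simp [h, h2]

theorem E_uu (s t : Fin 3) (i j a b : Fin N) : dact (oI N) (Sum.inl s) i j (uu' N t a b) = 0 := by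
  rw [← act_apply, uu', act_X]
  simp [oI, sumIdx]

theorem LR_xx (s : Fin 3 ⊕ Fin 3) (i j : Fin N) (x : TV N) : dact (oI N) (Sum.inr s) i j (xx N x) = 0 := by
  rw [← act_apply, xx, act_X]
  simp [oI, sumIdx]

theorem E_xx (s : Fin 3) (i j : Fin N) (x : TV N) : dact (oI N) (Sum.inl s) i j (xx N x) =
    if tidx s x = some j then xx N (trep s i x) else 0 := by
  rw [← act_apply, xx, act_X]
  simp only [oI, sumIdx, tI, xx]
  congr!

theorem phi_L (s : Fin 3) (i j : Fin N) (p : SR N) :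
    phi N (act (tI N) s i j p) = act (oI N) (Sum.inr (Sum.inl s)) i j (phi N p) := by
  refine inter (phi N) (dact (tI N) s i j) (dact (oI N) (Sum.inr (Sum.inl s)) i j) ?_ p
  intro x
  rw [← act_apply, act_X]
  rcases x with ⟨a, b⟩ | ⟨a, b⟩ | ⟨a, b, c⟩ <;> fin_cases s <;>
    simp only [phi, aeval_X, phiX, map_sum, dact_mul, LR_xx, L_uu, tI, tidx, trep, Option.some.injEq, if_false, reduceCtorEq, map_zero] <;>
    simp [Finset.sum_ite_irrel] <;> split_ifs <;> simp [phiX]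

theorem phi_tot (s : Fin 3) (i j : Fin N) (p : SR N) : tot N s i j (phi N p) = 0 := by
  refine (inter (phi N) 0 (dact (oI N) (Sum.inl s) i j - dact (oI N) (Sum.inr (Sum.inr s)) j i) ?_ p).symm.trans (by simp)
  intro x
  rw [Derivation.zero_apply, map_zero, phi, aeval_X, Derivation.sub_apply]
  rcases x with ⟨a, b⟩ | ⟨a, b⟩ | ⟨a, b, c⟩ <;> fin_cases s <;>
    simp only [phi, aeval_X, phiX, map_sum, dact_mul, LR_xx, R_uu, E_uu, E_xx, tidx, trep] <;>
    simp [Finset.sum_ite_irrel]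

theorem ev_phi (p : SR N) : ev N (phi N p) = p := by
  have : (ev N).comp (phi N) = AlgHom.id ℂ _ := by
    apply MvPolynomial.algHom_ext
    intro x
    rcases x with ⟨a, b⟩ | ⟨a, b⟩ | ⟨a, b, c⟩ <;>
    simp [phi, ev, phiX, uu', xx]
  exact congrArg (fun f => f p) this

theorem ev_tot (s : Fin 3) (i j : Fin N) (p : OR N) : act (tI N) s i j (ev N p) =
    ev N (tot N s i j p + act (oI N) (Sum.inr (Sum.inl s)) i j p) := by
  refine (inter (ev N) (dact (oI N) (Sum.inl s) i j - dact (oI N) (Sum.inr (Sum.inr s)) j i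
    + dact (oI N) (Sum.inr (Sum.inl s)) i j) (dact (tI N) s i j) ?_ p).symm
  intro x
  rw [Derivation.add_apply, Derivation.sub_apply]
  rcases x with x | ⟨t, a, b⟩
  · have h : (X (Sum.inl x) : OR N) = xx N x := rfl
    rw [h, LR_xx, LR_xx, E_xx]
    simp only [ev, xx, aeval_X, Sum.elim_inl]
    rw [← act_apply, act_X]
    simp only [tI]
    by_cases h6 : tidx s x = some j <;> simp [h6]
  · have h : (X (Sum.inr (t, a, b)) : OR N) = uu' N t a b := rfl
    rw [h, E_uu, R_uu, L_uu]
    simp only [ev, uu', aeval_X, Sum.elim_inr, zero_sub, map_add, map_neg, apply_ite (aeval _), map_zero]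
    have h0 : ∀ P : Prop, dact (tI N) s i j (if P then 1 else 0) = 0 := by
      intro P; split_ifs
      · exact Derivation.map_one_eq_zero _
      · simp
    have h5 : dact (tI N) s i j (if a = b then 1 else 0) = 0 := by convert h0 (a = b)
    rw [h5]
    by_cases h3 : b = i
    · by_cases h1 : t = s <;> by_cases h2 : a = j <;> simp [h1, h2, h3]
    · by_cases h1 : t = s <;> by_cases h2 : a = j <;> simp [h1, h2, h3, Ne.symm h3]

end C2
end AK


open scoped BigOperators
open scoped Classical
set_option linter.unusedSectionVars false
set_option linter.unusedVariables false

namespace AK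

section A1
open MvPolynomial
variable {N : ℕ}

def sh (l : Fin N → ℤ) (σ : Equiv.Perm (Fin N)) : Fin N → ℤ :=
  fun i => l i + ((σ i : ℕ) : ℤ) - (i : ℤ)

/-- alternating sum of Jacobi-Trudi type -/
def JJ (l : Fin N → ℤ) (f : (Fin N → ℤ) → ℤ) : ℤ :=
  ∑ σ : Equiv.Perm (Fin N), (Equiv.Perm.sign σ : ℤ) * f (sh l σ)

/-- number of matrices with given margins -/
noncomputable def Pm (a b : Fin N → ℤ) : ℕ :=
  Set.ncard {m : Fin N → Fin N → ℕ | (∀ i, ∑ j, (m i j : ℤ) = a i) ∧ ∀ j, ∑ i, (m i j : ℤ) = b j}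

noncomputable def Hser (N : ℕ) : PowerSeries (MvPolynomial (Fin N) ℤ) :=
  ∏ j, PowerSeries.mk (fun n => X j ^ n)

noncomputable def hh (N : ℕ) (n : ℤ) : MvPolynomial (Fin N) ℤ :=
  if 0 ≤ n then PowerSeries.coeff n.toNat (Hser N) else 0

theorem hh_eq (n : ℕ) : hh N n = ∑ m ∈ Finset.finsuppAntidiag (Finset.univ : Finset (Fin N)) n, monomial m 1 := by
  rw [hh, if_pos (by simp), Hser, Int.toNat_natCast, PowerSeries.coeff_prod]
  refine Finset.sum_congr rfl fun m _ => ?_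
  rw [monomial_eq, Finsupp.prod_fintype _ _ (by simp)]
  simp

theorem hh_zero : hh N 0 = 1 := by
  have := hh_eq (N := N) 0
  simpa using this

noncomputable def Gser (N : ℕ) (k : Fin N) : Polynomial (MvPolynomial (Fin N) ℤ) :=
  ∏ j ∈ Finset.univ.erase k, (1 - Polynomial.C (X j) * Polynomial.X)

theorem HG (k : Fin N) : Hser N * (Gser N k : PowerSeries (MvPolynomial (Fin N) ℤ)) = PowerSeries.mk (fun n => X k ^ n) := by
  have h : ∀ j : Fin N, PowerSeries.mk (fun n => (X j : MvPolynomial (Fin N) ℤ) ^ n) *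
      (1 - PowerSeries.C (X j) * PowerSeries.X) = 1 := by
    intro j
    ext n
    rw [mul_sub, mul_one, map_sub, ← mul_assoc]
    cases n with
    | zero => simp
    | succ n =>
      rw [PowerSeries.coeff_succ_mul_X, mul_comm, PowerSeries.coeff_C_mul]
      simp [PowerSeries.coeff_one, pow_succ, mul_comm]
  have hG : (Gser N k : PowerSeries (MvPolynomial (Fin N) ℤ)) =
      ∏ j ∈ Finset.univ.erase k, (1 - PowerSeries.C (X j) * PowerSeries.X) := by
    rw [Gser, ← Polynomial.coeToPowerSeries.ringHom_apply, map_prod]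
    refine Finset.prod_congr rfl fun j _ => ?_
    simp
  rw [hG, Hser, ← Finset.mul_prod_erase _ _ (Finset.mem_univ k), mul_assoc, ← Finset.prod_mul_distrib]
  simp [h]

theorem Gdeg (k : Fin N) (q : ℕ) (hq : N ≤ q) : (Gser N k).coeff q = 0 := by
  apply Polynomial.coeff_eq_zero_of_natDegree_lt
  have h1 : (Gser N k).natDegree ≤ ∑ j ∈ Finset.univ.erase k, 1 := by
    refine (Polynomial.natDegree_prod_le _ _).trans (Finset.sum_le_sum fun j _ => ?_)
    refine (Polynomial.natDegree_sub_le _ _).trans ?_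
    simp
  have h2 : (Finset.univ.erase k).card + 1 = N := by
    rw [Finset.card_erase_of_mem (Finset.mem_univ k)]
    have := k.2
    simp; omega
  simp at h1
  have := k.2
  omega

theorem X_pow_eq (k : Fin N) (n : ℕ) : (X k : MvPolynomial (Fin N) ℤ) ^ n =
    ∑ q ∈ Finset.range N, hh N ((n : ℤ) - q) * (Gser N k).coeff q := by
  have h := congrArg (PowerSeries.coeff n) (HG k)
  rw [PowerSeries.coeff_mk, PowerSeries.coeff_mul] at h
  rw [← h, Finset.Nat.sum_antidiagonal_eq_sum_range_succ (fun p q => PowerSeries.coeff p (Hser N) *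
    PowerSeries.coeff q (Gser N k : PowerSeries (MvPolynomial (Fin N) ℤ)))]
  rw [← Finset.sum_range_reflect]
  have e1 : ∑ q ∈ Finset.range (n + 1), hh N ((n : ℤ) - q) * (Gser N k).coeff q =
      ∑ q ∈ Finset.range (max (n + 1) N), hh N ((n : ℤ) - q) * (Gser N k).coeff q := by
    apply Finset.sum_subset
    · intro q; simp; omega
    · intro q _ hq
      rw [hh, if_neg (by simp at hq; omega), zero_mul]
  have e2 : ∑ q ∈ Finset.range N, hh N ((n : ℤ) - q) * (Gser N k).coeff q =
      ∑ q ∈ Finset.range (max (n + 1) N), hh N ((n : ℤ) - q) * (Gser N k).coeff q := by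
    apply Finset.sum_subset
    · intro q; simp; omega
    · intro q _ hq
      rw [Gdeg k q (by simpa using hq), mul_zero]
  rw [e2, ← e1]
  refine Finset.sum_congr rfl fun q hq => ?_
  have hq' : q ≤ n := by simpa using Nat.lt_succ_iff.1 (Finset.mem_range.1 hq)
  rw [hh, if_pos (by omega)]
  have e3 : ((n : ℤ) - q).toNat = n - q := by omega
  rw [e3]
  congr 1
  rw [Polynomial.coeff_coe]
  congr 1
  omega

noncomputable def Hmat (κ : Fin N → ℕ) : Matrix (Fin N) (Fin N) (MvPolynomial (Fin N) ℤ) :=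
  fun i j => hh N ((κ i : ℤ) + j - i)

noncomputable def Amat (κ : Fin N → ℕ) : Matrix (Fin N) (Fin N) (MvPolynomial (Fin N) ℤ) :=
  fun i k => X k ^ (κ i + (N - 1 - i))

noncomputable def Mmat (N : ℕ) : Matrix (Fin N) (Fin N) (MvPolynomial (Fin N) ℤ) :=
  fun j k => (Gser N k).coeff (N - 1 - j)

theorem AHM (κ : Fin N → ℕ) : Amat κ = Hmat κ * Mmat N := by
  ext1 i k
  rw [Matrix.mul_apply, Amat, X_pow_eq, ← Finset.sum_range_reflect, ← Fin.sum_univ_eq_sum_range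
    (fun q => hh N (((κ i + (N - 1 - i) : ℕ) : ℤ) - ((N - 1 - q : ℕ) : ℤ)) * (Gser N k).coeff (N - 1 - q))]
  refine Finset.sum_congr rfl fun j _ => ?_
  rw [Hmat, Mmat]
  congr 2
  have := i.2
  have := j.2
  omega

theorem detH0 : (Hmat (0 : Fin N → ℕ)).det = 1 := by
  rw [Matrix.det_of_isUpperTriangular]
  · simp [Hmat, hh_zero]
  · intro i j hij
    have : j < i := hij
    rw [Hmat, hh, if_neg]
    simp
    exact this

theorem detA (κ : Fin N → ℕ) : (Amat κ).det = (Hmat κ).det * (Amat (0 : Fin N → ℕ)).det := by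
  rw [AHM κ, AHM 0, Matrix.det_mul, Matrix.det_mul, detH0, one_mul]

theorem coeff_hprod (a : Fin N → ℤ) (b : Fin N →₀ ℕ) :
    coeff b (∏ i, hh N (a i)) = (Pm a (fun i => (b i : ℤ)) : ℤ) := by
  by_cases ha : ∀ i, 0 ≤ a i
  · lift a to Fin N → ℕ using ha
    simp only [hh_eq]
    rw [Finset.prod_univ_sum, coeff_sum]
    have h1 : ∀ p : Fin N → (Fin N →₀ ℕ), coeff b (∏ i, monomial (p i) (1 : ℤ)) = if ∑ i, p i = b then 1 else 0 := by
      intro p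
      have : ∏ i, monomial (p i) (1 : ℤ) = monomial (∑ i, p i) 1 := by
        exact (monomial_sum_one _ _).symm
      rw [this, coeff_monomial]
    simp only [h1]
    rw [Finset.sum_ite, Finset.sum_const_zero, add_zero, Finset.sum_const, nsmul_eq_mul, mul_one, Pm,
      ← Set.ncard_coe_finset]
    congr 1
    refine Set.ncard_congr (fun p _ i j => p i j) ?_ ?_ ?_
    · intro p hp
      simp at hp
      refine ⟨fun i => ?_, fun j => ?_⟩
      · exact_mod_cast (hp.1 i)
      · rw [← hp.2]; simp
    · intro p q _ _ h
      funext i; ext j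
      exact congrFun (congrFun h i) j
    · intro m hm
      refine ⟨fun i => Finsupp.equivFunOnFinite.symm (m i), ?_, rfl⟩
      simp
      refine ⟨fun i => ?_, ?_⟩
      · exact_mod_cast hm.1 i
      · ext j
        have := hm.2 j
        simp
        exact_mod_cast this
  · push Not at ha
    obtain ⟨i, hi⟩ := ha
    rw [Finset.prod_eq_zero (Finset.mem_univ i), coeff_zero, Pm]
    · symm
      rw [Nat.cast_eq_zero]
      convert Set.ncard_empty (Fin N → Fin N → ℕ)
      refine Set.eq_empty_iff_forall_notMem.2 fun m h => ?_
      have h1 := h.1 i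
      have : 0 ≤ ∑ j, (m i j : ℤ) := Finset.sum_nonneg fun j _ => by simp
      omega
    · rw [hh, if_neg (by omega)]

theorem Pm_neg {a b : Fin N → ℤ} (h : Pm a b ≠ 0) : (∀ i, 0 ≤ a i) ∧ ∀ i, 0 ≤ b i := by
  obtain ⟨m, hm⟩ := Set.nonempty_of_ncard_ne_zero h
  refine ⟨fun i => ?_, fun i => ?_⟩
  · rw [← hm.1 i]; exact Finset.sum_nonneg fun j _ => by simp
  · rw [← hm.2 i]; exact Finset.sum_nonneg fun j _ => by simp

theorem coeff_detH (κ : Fin N → ℕ) (b : Fin N →₀ ℕ) : coeff b (Hmat κ).det =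
    JJ (fun i => (κ i : ℤ)) (fun a => (Pm a (fun i => (b i : ℤ)) : ℤ)) := by
  rw [← Matrix.det_transpose, Matrix.det_apply, coeff_sum, JJ]
  refine Finset.sum_congr rfl fun σ _ => ?_
  rw [Units.smul_def, coeff_smul, smul_eq_mul]
  congr 1
  rw [← coeff_hprod]
  rfl

theorem coeff_detA (κ : Fin N → ℕ) : (Amat κ).det = ∑ τ : Equiv.Perm (Fin N),
    monomial (Finsupp.equivFunOnFinite.symm fun i => κ (τ i) + (N - 1 - (τ i : ℕ))) (Equiv.Perm.sign τ : ℤ) := by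
  rw [Matrix.det_apply]
  refine Finset.sum_congr rfl fun τ _ => ?_
  rw [Units.smul_def, monomial_eq, Finsupp.prod_fintype _ _ (by simp), ← C_mul']
  simp [Amat]

theorem perm_sorted {a b : Fin N → ℕ} (ha : StrictAnti a) (hb : StrictAnti b) {τ : Equiv.Perm (Fin N)}
    (h : ∀ i, a (τ i) = b i) : τ = 1 := by
  have h1 : StrictMono τ := by
    intro i j hij
    have := hb hij
    rw [← h, ← h] at this
    exact ha.lt_iff_gt.1 this
  have h2 : h1.orderIsoOfSurjective _ τ.surjective = OrderIso.refl _ := Subsingleton.elim _ _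
  ext i
  have := congrArg (fun f : Fin N ≃o Fin N => ((f i : Fin N) : ℕ)) h2
  simpa using this

theorem ortho (κ l : Fin N → ℕ) (hκ : Antitone κ) (hl : Antitone l) :
    JJ (fun i => (l i : ℤ)) (fun b => JJ (fun i => (κ i : ℤ)) (fun a => (Pm a b : ℤ))) =
      if κ = l then 1 else 0 := by
  set d : Fin N →₀ ℕ := Finsupp.equivFunOnFinite.symm fun i => l i + (N - 1 - (i : ℕ)) with hd
  have h := congrArg (coeff d) (detA κ)
  have sa : ∀ κ : Fin N → ℕ, Antitone κ → StrictAnti (fun i : Fin N => κ i + (N - 1 - (i : ℕ))) := by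
    intro κ hκ i j hij
    have := hκ hij.le
    have h1 : (i : ℕ) < j := hij
    have := j.2
    simp only; omega
  have e1 : coeff d (Amat κ).det = if κ = l then 1 else 0 := by
    rw [coeff_detA, coeff_sum]
    simp only [coeff_monomial]
    rw [Finset.sum_eq_single 1]
    · congr 1
      · rw [hd]
        simp only [Equiv.Perm.coe_one, id, EmbeddingLike.apply_eq_iff_eq, eq_iff_iff]
        constructor
        · intro h; funext i
          have := congrFun h i
          omega
        · rintro rfl; rfl
      · simp
    · intro τ _ hτ
      rw [if_neg]
      intro h
      apply hτ
      refine perm_sorted (sa κ hκ) (sa l hl) fun i => ?_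
      have := congrArg (fun f => f i) h
      simpa [hd] using this
    · simp
  rw [e1] at h
  rw [h, coeff_detA, Finset.mul_sum, coeff_sum, JJ]
  refine Finset.sum_congr rfl fun τ _ => ?_
  rw [coeff_mul_monomial']
  split_ifs with hle
  · rw [coeff_detH, mul_comm]
    congr 3
    funext a
    congr 2
    funext i
    have := hle i
    simp only [hd, Finsupp.equivFunOnFinite_symm_apply_apply, Finsupp.tsub_apply, sh, Pi.zero_apply] at this ⊢
    have := i.2
    have := (τ i).2
    omega
  · rw [JJ, Finset.sum_eq_zero, mul_zero]
    intro σ _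
    have : Pm (sh (fun i => (κ i : ℤ)) σ) (sh (fun i => (l i : ℤ)) τ) = 0 := by
      by_contra h0
      apply hle
      intro i
      have := (Pm_neg h0).2 i
      simp only [hd, Finsupp.equivFunOnFinite_symm_apply_apply, sh, Pi.zero_apply] at this ⊢
      have := i.2
      have := (τ i).2
      omega
    rw [this]; simp

end A1
end AK


open scoped BigOperators
open scoped Classical
set_option linter.unusedSectionVars false
set_option linter.unusedVariables false

namespace AK

section A2
variable {N : ℕ}

theorem JJ_sum {ι : Type*} (S : Finset ι) (l : Fin N → ℤ) (f : ι → (Fin N → ℤ) → ℤ) (c : ι → ℤ) :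
    JJ l (fun a => ∑ x ∈ S, c x * f x a) = ∑ x ∈ S, c x * JJ l (f x) := by
  simp only [JJ, Finset.mul_sum]
  rw [Finset.sum_comm]
  refine Finset.sum_congr rfl fun x _ => Finset.sum_congr rfl fun σ _ => ?_
  ring

theorem JJ_sub (l : Fin N → ℤ) (f g : (Fin N → ℤ) → ℤ) :
    JJ l (fun a => f a - g a) = JJ l f - JJ l g := by
  simp only [JJ, mul_sub, Finset.sum_sub_distrib]

theorem JJ_comm (l m : Fin N → ℤ) (f : (Fin N → ℤ) → (Fin N → ℤ) → ℤ) :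
    JJ l (fun a => JJ m (fun b => f a b)) = JJ m (fun b => JJ l (fun a => f a b)) := by
  simp only [JJ, Finset.mul_sum]
  rw [Finset.sum_comm]
  refine Finset.sum_congr rfl fun x _ => Finset.sum_congr rfl fun σ _ => ?_
  ring

theorem JJ_smul (l : Fin N → ℤ) (f : (Fin N → ℤ) → ℤ) (c : ℤ) :
    JJ l (fun a => c * f a) = c * JJ l f := by
  simp only [JJ, Finset.mul_sum]
  refine Finset.sum_congr rfl fun x _ => ?_
  ring

theorem JJ_smul' (l : Fin N → ℤ) (f : (Fin N → ℤ) → ℤ) (c : ℤ) :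
    JJ l (fun a => f a * c) = JJ l f * c := by
  simp only [JJ, Finset.sum_mul]
  refine Finset.sum_congr rfl fun x _ => ?_
  ring

theorem sh_total (l : Fin N → ℤ) (σ : Equiv.Perm (Fin N)) : ∑ i, sh l σ i = ∑ i, l i := by
  have : ∑ i, (((σ i : Fin N) : ℕ) : ℤ) = ∑ i : Fin N, ((i : ℕ) : ℤ) :=
    Equiv.sum_comp σ (fun i : Fin N => ((i : ℕ) : ℤ))
  simp only [sh, Finset.sum_sub_distrib, Finset.sum_add_distrib, this]
  ring

theorem JJ_congr {l : Fin N → ℤ} {f g : (Fin N → ℤ) → ℤ}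
    (h : ∀ a, ∑ i, a i = ∑ i, l i → f a = g a) : JJ l f = JJ l g := by
  refine Finset.sum_congr rfl fun σ _ => ?_
  rw [h _ (sh_total l σ)]

def Symm (f : (Fin N → ℤ) → ℤ) : Prop := ∀ a (σ : Equiv.Perm (Fin N)), f (a ∘ σ) = f a
def Nng (f : (Fin N → ℤ) → ℤ) : Prop := ∀ a, f a ≠ 0 → ∀ i, 0 ≤ a i

theorem exists_sort (a : Fin N → ℕ) : ∃ σ : Equiv.Perm (Fin N), Antitone (a ∘ σ) := by
  refine ⟨Tuple.sort (fun i => OrderDual.toDual (a i)), ?_⟩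
  intro i j hij
  exact Tuple.monotone_sort (fun i => OrderDual.toDual (a i)) hij

theorem perm_sq (σ : Equiv.Perm (Fin N)) (hσ : σ ≠ 1) :
    ∑ i : Fin N, ((i : ℕ) : ℤ) * (((σ i : ℕ) : ℤ) - (i : ℕ)) < 0 := by
  obtain ⟨i0, hi0⟩ : ∃ i, σ i ≠ i := by
    by_contra h; push Not at h; exact hσ (Equiv.ext h)
  have h1 : 0 < ∑ i : Fin N, (((σ i : ℕ) : ℤ) - (i : ℕ)) ^ 2 := by
    refine Finset.sum_pos' (fun i _ => sq_nonneg _) ⟨i0, Finset.mem_univ _, ?_⟩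
    have : ((σ i0 : ℕ) : ℤ) - (i0 : ℕ) ≠ 0 := by
      intro h; apply hi0; ext; omega
    positivity
  have h2 : ∑ i, (((σ i : Fin N) : ℕ) : ℤ) ^ 2 = ∑ i : Fin N, ((i : ℕ) : ℤ) ^ 2 :=
    Equiv.sum_comp σ (fun i : Fin N => ((i : ℕ) : ℤ) ^ 2)
  have h3 : ∑ i : Fin N, (((σ i : ℕ) : ℤ) - (i : ℕ)) ^ 2 =
      ∑ i, (((σ i : Fin N) : ℕ) : ℤ) ^ 2 - ∑ i : Fin N, ((i : ℕ) : ℤ) ^ 2 -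
        2 * ∑ i : Fin N, ((i : ℕ) : ℤ) * (((σ i : ℕ) : ℤ) - (i : ℕ)) := by
    rw [Finset.mul_sum, ← Finset.sum_sub_distrib, ← Finset.sum_sub_distrib]
    refine Finset.sum_congr rfl fun i _ => ?_
    ring
  linarith

theorem sort_le (a : Fin N → ℕ) (σ : Equiv.Perm (Fin N)) (h : Antitone (a ∘ σ)) :
    ∑ i : Fin N, (i : ℕ) * (a (σ i)) ≤ ∑ i : Fin N, (i : ℕ) * a i := by
  have hv : Antivary (fun i : Fin N => (i : ℕ)) (a ∘ σ) := by
    intro i j hij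
    by_contra hc
    push Not at hc
    have : i < j := hc
    exact absurd (h this.le) (not_le.2 hij)
  have := hv.sum_mul_le_sum_mul_comp_perm (σ := σ⁻¹)
  simpa using this

theorem symm_vanish (f : (Fin N → ℤ) → ℤ) (hs : Symm f) (hn : Nng f)
    (h0 : ∀ κ : Fin N → ℕ, Antitone κ → JJ (fun i => (κ i : ℤ)) f = 0) : ∀ a, f a = 0 := by
  have key : ∀ n : ℕ, ∀ a : Fin N → ℕ, ∑ i : Fin N, (i : ℕ) * a i = n → f (fun i => (a i : ℤ)) = 0 := by
    intro n
    induction n using Nat.strong_induction_on with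
    | _ n ih =>
      intro a ha
      obtain ⟨σ, hσ⟩ := exists_sort a
      have hle := sort_le a σ hσ
      have e : f (fun i => (a i : ℤ)) = f (fun i => ((a ∘ σ) i : ℤ)) := (hs (fun i => (a i : ℤ)) σ).symm
      rw [e]
      have hJ := h0 _ hσ
      rw [JJ, ← Finset.add_sum_erase _ _ (Finset.mem_univ 1), Finset.sum_eq_zero, add_zero] at hJ
      · have e1 : sh (fun i => ((a ∘ σ) i : ℤ)) 1 = (fun i => ((a ∘ σ) i : ℤ)) := by
          funext i; simp [sh]
        rw [e1] at hJ
        simpa using hJ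
      · intro π hπ
        by_contra hne
        have hne := right_ne_zero_of_mul hne
        have hp := hn _ hne
        apply hne
        have hlt := perm_sq π (Finset.ne_of_mem_erase hπ)
        generalize hb : sh (fun i => ((a ∘ σ) i : ℤ)) π = b at hp ⊢
        lift b to Fin N → ℕ using hp
        refine ih _ ?_ b rfl
        zify
        have : ∑ i : Fin N, ((i : ℕ) : ℤ) * (b i : ℤ) = ∑ i : Fin N, ((i : ℕ) : ℤ) * (a (σ i) : ℤ) +
            ∑ i : Fin N, ((i : ℕ) : ℤ) * (((π i : ℕ) : ℤ) - (i : ℕ)) := by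
          rw [← Finset.sum_add_distrib]
          refine Finset.sum_congr rfl fun i _ => ?_
          have := congrFun hb i
          simp only [sh, Function.comp] at this
          rw [← this]; ring
        rw [this, ← ha]
        push_cast
        zify at hle
        linarith
  intro a
  by_contra hne
  have hp := hn _ hne
  lift a to Fin N → ℕ using hp
  exact hne (key _ a rfl)

/-- Kostka-type number -/
noncomputable def KK (l t : Fin N → ℤ) : ℤ := JJ l (fun a => (Pm a t : ℤ))

theorem Pm_total {a b : Fin N → ℤ} (h : Pm a b ≠ 0) : ∑ i, a i = ∑ i, b i := by
  obtain ⟨m, hm⟩ := Set.nonempty_of_ncard_ne_zero h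
  simp only [← hm.1, ← hm.2]
  exact Finset.sum_comm

theorem Pm_comm (a b : Fin N → ℤ) : Pm a b = Pm b a := by
  refine Set.ncard_congr (fun m _ i j => m j i) ?_ ?_ ?_
  · intro m hm; exact ⟨hm.2, hm.1⟩
  · intro m m' _ _ h; funext i j; exact congrFun (congrFun h j) i
  · intro m hm; exact ⟨fun i j => m j i, ⟨hm.2, hm.1⟩, rfl⟩

theorem Pm_symm (a b : Fin N → ℤ) (σ : Equiv.Perm (Fin N)) : Pm (a ∘ σ) b = Pm a b := by
  symm
  refine Set.ncard_congr (fun m _ i j => m (σ i) j) ?_ ?_ ?_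
  · intro m hm
    refine ⟨fun i => hm.1 (σ i), fun j => ?_⟩
    rw [← hm.2 j]; exact Equiv.sum_comp σ (fun i => (m i j : ℤ))
  · intro m m' _ _ h; funext i j
    have := congrFun (congrFun h (σ.symm i)) j
    simpa using this
  · intro m hm
    refine ⟨fun i j => m (σ.symm i) j, ⟨fun i => ?_, fun j => ?_⟩, ?_⟩
    · rw [hm.1]; simp
    · rw [← hm.2 j]; exact Equiv.sum_comp σ.symm (fun i => (m i j : ℤ))
    · simp

theorem Pm_symm' (a b : Fin N → ℤ) (σ : Equiv.Perm (Fin N)) : Pm a (b ∘ σ) = Pm a b := by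
  rw [Pm_comm, Pm_symm, Pm_comm]

theorem KK_ne {l t : Fin N → ℤ} (h : KK l t ≠ 0) : (∀ i, 0 ≤ t i) ∧ ∑ i, t i = ∑ i, l i := by
  obtain ⟨σ, _, hσ⟩ := Finset.exists_ne_zero_of_sum_ne_zero h
  have := right_ne_zero_of_mul hσ
  have h1 : Pm (sh l σ) t ≠ 0 := Nat.cast_ne_zero.1 this
  exact ⟨(Pm_neg h1).2, by rw [← Pm_total h1, sh_total]⟩

theorem KK_symm (l : Fin N → ℤ) : Symm (KK l) := by
  intro a σ
  simp only [KK, Pm_symm']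

/-- truncation of a partition to a vector -/
def vec (N : ℕ) (p : Partition') : Fin N → ℤ := fun i => (p.1 i : ℤ)

theorem part_zero {p : Partition'} {k : ℕ} (h : p.size ≤ k) : p.1 k = 0 := by
  by_contra hk
  have h1 : Finset.range (k + 1) ⊆ p.1.support := by
    intro i hi
    have := p.2 (Nat.lt_succ_iff.1 (Finset.mem_range.1 hi))
    simp; omega
  have h2 : ∑ i ∈ Finset.range (k + 1), 1 ≤ p.size := by
    rw [Partition'.size, Finsupp.sum]
    refine le_trans (Finset.sum_le_sum fun i hi => ?_) (Finset.sum_le_sum_of_subset h1)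
    have := h1 hi
    simp at this
    omega
  simp at h2
  omega

theorem part_zero' {p : Partition'} {k : ℕ} (h : p.plength ≤ k) : p.1 k = 0 := by
  by_contra hk
  have h1 : Finset.range (k + 1) ⊆ p.1.support := by
    intro i hi
    have := p.2 (Nat.lt_succ_iff.1 (Finset.mem_range.1 hi))
    simp; omega
  have h2 := Finset.card_le_card h1
  simp [Partition'.plength] at h2 h
  omega

theorem size_eq {p : Partition'} (h : ∀ k, N ≤ k → p.1 k = 0) : ∑ i, vec N p i = p.size := by
  rw [Partition'.size, Finsupp.sum_of_support_subset (s := Finset.range N)]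
  · simp only [vec]
    rw [Fin.sum_univ_eq_sum_range (fun i => (p.1 i : ℤ))]
    simp
  · intro i hi
    by_contra hc
    simp at hi hc
    exact hi (h i hc)
  · simp

theorem vec_inj {p q : Partition'} (hp : ∀ k, N ≤ k → p.1 k = 0) (hq : ∀ k, N ≤ k → q.1 k = 0)
    (h : vec N p = vec N q) : p = q := by
  apply Subtype.ext
  ext k
  by_cases hk : k < N
  · have := congrFun h ⟨k, hk⟩
    simpa [vec] using this
  · rw [hp k (by omega), hq k (by omega)]

theorem vec_anti (p : Partition') : Antitone (fun i : Fin N => p.1 i) := fun i j hij => p.2 hij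

theorem exists_part (κ : Fin N → ℕ) (hκ : Antitone κ) : ∃ p : Partition', vec N p = (fun i => (κ i : ℤ)) ∧
    ∀ k, N ≤ k → p.1 k = 0 := by
  let f : ℕ →₀ ℕ := Finsupp.onFinset (Finset.range N) (fun i => if h : i < N then κ ⟨i, h⟩ else 0) (by
    intro a ha
    by_contra h
    simp at h
    simp [not_lt.2 h] at ha)
  have hf : ∀ i, f i = if h : i < N then κ ⟨i, h⟩ else 0 := fun i => rfl
  refine ⟨⟨f, ?_⟩, ?_, ?_⟩
  · intro i j hij
    rw [hf, hf]
    split_ifs with h1 h2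
    · exact hκ hij
    · omega
    · omega
    · omega
  · funext i; simp [vec, hf]
  · intro k hk; simp [hf, hk]

theorem fin_parts (M : ℕ) : {p : Partition' | p.size ≤ M}.Finite := by
  refine Set.Finite.of_finite_image (f := fun p => vec M p) ?_ ?_
  · refine (Set.finite_Icc (0 : Fin M → ℤ) (fun _ => (M : ℤ))).subset ?_
    rintro _ ⟨p, hp, rfl⟩
    have hs := size_eq (N := M) (p := p) (fun k hk => part_zero (le_trans hp hk))
    refine ⟨fun i => by simp [vec], fun i => ?_⟩
    have h1 : vec M p i ≤ ∑ i, vec M p i := Finset.single_le_sum (fun i _ => by simp [vec]) (Finset.mem_univ i)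
    have h2 : p.size ≤ M := hp
    rw [hs] at h1
    simp only; omega
  · intro p hp q hq h
    exact vec_inj (fun k hk => part_zero (le_trans hp hk)) (fun k hk => part_zero (le_trans hq hk)) h

noncomputable def PS (M : ℕ) : Finset Partition' := (fin_parts M).toFinset

theorem mem_PS {M : ℕ} {p : Partition'} : p ∈ PS M ↔ p.size ≤ M := by
  simp [PS]

theorem completeness {M : ℕ} (hM : M ≤ N) (f : (Fin N → ℤ) → ℤ) (hs : Symm f) (hn : Nng f)
    (hb : ∀ a, f a ≠ 0 → ∑ i, a i ≤ M) (t : Fin N → ℤ) :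
    ∑ p ∈ PS M, KK (vec N p) t * JJ (vec N p) f = f t := by
  have hz : ∀ p ∈ PS M, ∀ k, N ≤ k → p.1 k = 0 := fun p hp k hk => part_zero ((mem_PS.1 hp).trans (hM.trans hk))
  have := symm_vanish (fun t => f t - ∑ p ∈ PS M, JJ (vec N p) f * KK (vec N p) t) ?_ ?_ ?_ t
  · simp only [mul_comm (KK _ t)]
    linarith
  · intro a σ
    simp only [hs a σ, KK_symm _ a σ]
  · intro a ha
    by_cases h1 : f a = 0
    · by_contra h2
      apply ha
      simp only [h1]
      rw [Finset.sum_eq_zero, sub_zero]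
      intro p _
      by_contra h3
      exact h2 (KK_ne (right_ne_zero_of_mul h3)).1
    · exact hn a h1
  · intro κ hκ
    rw [JJ_sub, JJ_sum, sub_eq_zero]
    obtain ⟨q, hq, hq0⟩ := exists_part κ hκ
    have ho : ∀ p ∈ PS M, JJ (fun i => (κ i : ℤ)) (KK (vec N p)) = if p = q then 1 else 0 := by
      intro p hp
      have := ortho (fun i : Fin N => p.1 i) κ (vec_anti p) hκ
      have e : (fun i : Fin N => p.1 i) = κ ↔ p = q := by
        constructor
        · intro h
          refine vec_inj (hz p hp) hq0 ?_
          rw [hq, ← h]; rfl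
        · rintro rfl
          funext i
          have := congrFun hq i
          simpa [vec] using this
      simp only [e] at this
      exact this
    rw [Finset.sum_congr rfl fun p hp => by rw [ho p hp]]
    by_cases hqM : q ∈ PS M
    · simp [hqM, hq]
    · rw [Finset.sum_eq_zero]
      · refine Finset.sum_eq_zero fun σ _ => ?_
        by_contra hne
        have := hb _ (right_ne_zero_of_mul hne)
        rw [sh_total, ← hq, size_eq hq0] at this
        exact hqM (mem_PS.2 (by exact_mod_cast this))
      · intro p hp
        rw [if_neg, mul_zero]
        rintro rfl; exact hqM hp

end A2
end AK


open scoped BigOperators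
open scoped Classical
set_option linter.unusedSectionVars false
set_option linter.unusedVariables false

namespace AK

section A3
variable {N : ℕ}

/-- extension by zero -/
def extz (N : ℕ) {n : ℕ} (a : Fin n → ℤ) : Fin N → ℤ := fun i => if h : (i : ℕ) < n then a ⟨i, h⟩ else 0

def finEq {n : ℕ} (hn : n ≤ N) : Fin n ≃ {i : Fin N // (i : ℕ) < n} where
  toFun i := ⟨⟨i, by omega⟩, i.2⟩
  invFun i := ⟨i.1, i.2⟩
  left_inv i := rfl
  right_inv i := rfl

noncomputable def permUp {n : ℕ} (hn : n ≤ N) (π : Equiv.Perm (Fin n)) : Equiv.Perm (Fin N) :=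
  Equiv.Perm.ofSubtype ((finEq hn).permCongr π)

theorem permUp_lt {n : ℕ} (hn : n ≤ N) (π : Equiv.Perm (Fin n)) (i : Fin N) (h : (i : ℕ) < n) :
    ((permUp hn π i : Fin N) : ℕ) = π ⟨i, h⟩ := by
  rw [permUp, Equiv.Perm.ofSubtype_apply_of_mem (p := fun i : Fin N => (i : ℕ) < n) _ h]
  rfl

theorem permUp_ge {n : ℕ} (hn : n ≤ N) (π : Equiv.Perm (Fin n)) (i : Fin N) (h : ¬ (i : ℕ) < n) :
    permUp hn π i = i := by
  rw [permUp, Equiv.Perm.ofSubtype_apply_of_not_mem (p := fun i : Fin N => (i : ℕ) < n) _ h]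

theorem JJ_bridge {n : ℕ} (hn : n ≤ N) (l : Fin N → ℤ) (hl : ∀ i : Fin N, n ≤ (i : ℕ) → l i = 0)
    (f : (Fin N → ℤ) → ℤ) (hf : Nng f) :
    JJ l f = JJ (fun i : Fin n => l ⟨i, by omega⟩) (fun a => f (extz N a)) := by
  symm
  rw [JJ, JJ]
  refine Fintype.sum_of_injective (permUp hn) ?_ _ _ ?_ ?_
  · intro π π' h
    ext i
    have := congrArg (fun σ : Equiv.Perm (Fin N) => ((σ ⟨i, by omega⟩ : Fin N) : ℕ)) h
    rw [permUp_lt hn π _ i.2, permUp_lt hn π' _ i.2] at this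
    exact this
  · intro σ hσ
    by_contra hne
    apply hσ
    have h1 := hf _ (right_ne_zero_of_mul hne)
    have h2 : ∀ k : ℕ, ∀ i : Fin N, n ≤ (i : ℕ) → N - (i : ℕ) = k → σ i = i := by
      intro k
      induction k using Nat.strong_induction_on with
      | _ k ih =>
        intro i hi hk
        have h3 := h1 i
        rw [sh, hl i hi] at h3
        by_contra hc
        have h4 : (σ i : ℕ) ≠ i := fun h => hc (Fin.ext h)
        have h5 : (i : ℕ) < σ i := by omega
        have := ih (N - (σ i : ℕ)) (by omega) (σ i) (by omega) rfl
        exact hc (σ.injective this)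
    have h3 : ∀ x : Fin N, ((σ x : ℕ) < n) ↔ (x : ℕ) < n := by
      intro x
      constructor
      · intro h
        by_contra hc
        rw [h2 _ x (by omega) rfl] at h
        exact hc h
      · intro h
        by_contra hc
        have := σ.injective (h2 _ (σ x) (by omega) rfl)
        rw [this] at hc
        exact hc h
    refine ⟨(finEq hn).symm.permCongr (σ.subtypePerm h3), ?_⟩
    rw [permUp]
    have e : (finEq hn).permCongr ((finEq hn).symm.permCongr (σ.subtypePerm h3)) = σ.subtypePerm h3 := by
      ext x; simp
    rw [e]
    refine Equiv.Perm.ofSubtype_subtypePerm h3 fun x hx => ?_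
    by_contra hc
    exact hx (h2 _ x (by omega) rfl)
  · intro π
    congr 1
    · rw [permUp, Equiv.Perm.sign_ofSubtype, Equiv.Perm.sign_permCongr]
    · congr 1
      funext i
      rw [extz, sh]
      split_ifs with h
      · rw [permUp_lt hn π i h, sh]
      · rw [permUp_ge hn π i h, hl i (by omega)]
        ring

theorem extz_Nng {n : ℕ} (f : (Fin N → ℤ) → ℤ) (hf : Nng f) (hn : n ≤ N) : Nng (fun a : Fin n → ℤ => f (extz N a)) := by
  intro a ha i
  have := hf _ ha ⟨i, by omega⟩
  simpa [extz] using this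

/-- fixed functions with prescribed fibre sizes -/
noncomputable def yc (N : ℕ) {n : ℕ} (a : Fin N → ℤ) (g : Equiv.Perm (Fin n)) : ℤ :=
  (Finset.univ.filter fun f : Fin n → Fin N => f ∘ g = f ∧ ∀ i, ((Finset.univ.filter fun x => f x = i).card : ℤ) = a i).card

theorem yc_nng {n : ℕ} (g : Equiv.Perm (Fin n)) : Nng (fun a => yc N a g) := by
  intro a ha i
  have : 0 < (Finset.univ.filter fun f : Fin n → Fin N => f ∘ g = f ∧ ∀ i, ((Finset.univ.filter fun x => f x = i).card : ℤ) = a i).card := by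
    rw [Nat.pos_iff_ne_zero]; simpa [yc] using ha
  obtain ⟨f, hf⟩ := Finset.card_pos.1 this
  rw [← (Finset.mem_filter.1 hf).2.2 i]
  simp

theorem yc_young {n : ℕ} (a : Fin n → ℤ) (g : Equiv.Perm (Fin n)) : Partition'.youngCount n a g = yc n a g := by
  rw [Partition'.youngCount]
  split_ifs with h
  · rw [yc]
    congr 1
    rw [Nat.card_eq_fintype_card, Fintype.card_subtype]
    congr 1
    ext f
    simp only [Finset.mem_filter, Finset.mem_univ, true_and]
    refine and_congr_right fun _ => forall_congr' fun i => ?_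
    rw [Nat.card_eq_fintype_card, Fintype.card_subtype]
    have := h i
    omega
  · by_contra hne
    exact h (yc_nng g a (Ne.symm hne))

theorem yc_ext {n m : ℕ} (hn : m ≤ N) (a : Fin m → ℤ) (g : Equiv.Perm (Fin n)) :
    yc N (extz N a) g = yc m a g := by
  rw [yc, yc]
  congr 1
  symm
  refine Finset.card_bij (fun f _ x => Fin.castLE hn (f x)) ?_ ?_ ?_
  · intro f hf
    simp only [Finset.mem_filter, Finset.mem_univ, true_and] at hf ⊢
    refine ⟨?_, fun i => ?_⟩
    · funext x
      have := congrFun hf.1 x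
      simp only [Function.comp] at this ⊢
      rw [this]
    · rw [extz]
      split_ifs with h
      · rw [← hf.2 ⟨i, h⟩]
        congr 2
        ext x
        simp [Fin.ext_iff]
      · rw [Nat.cast_eq_zero, Finset.card_eq_zero, Finset.filter_eq_empty_iff]
        intro x _ hx
        apply h
        rw [← hx]; simp
  · intro f _ f' _ h
    funext x
    have := congrFun h x
    simpa [Fin.ext_iff] using this
  · intro f hf
    simp only [Finset.mem_filter, Finset.mem_univ, true_and] at hf
    have hlt : ∀ x, (f x : ℕ) < m := by
      intro x
      by_contra hc
      have := hf.2 (f x)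
      rw [extz, dif_neg hc, Nat.cast_eq_zero, Finset.card_eq_zero, Finset.filter_eq_empty_iff] at this
      exact this (Finset.mem_univ x) rfl
    refine ⟨fun x => ⟨f x, hlt x⟩, ?_, ?_⟩
    · simp only [Finset.mem_filter, Finset.mem_univ, true_and]
      refine ⟨?_, fun i => ?_⟩
      · funext x
        have := congrFun hf.1 x
        simp only [Function.comp] at this ⊢
        simp only [this]
      · have := hf.2 ⟨i, by omega⟩
        rw [extz, dif_pos i.2] at this
        rw [← this]
        congr 2
        ext x
        simp [Fin.ext_iff]
    · funext x; rfl

theorem irr_eq {n : ℕ} (hn : n ≤ N) (p : Partition') (hp : p.size ≤ n) (g : Equiv.Perm (Fin n)) :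
    p.irrChar n g = JJ (vec N p) (fun a => yc N a g) := by
  rw [JJ_bridge hn _ (fun i hi => by simp [vec, part_zero (hp.trans hi)]) _ (yc_nng g), Partition'.irrChar, JJ]
  refine Finset.sum_congr rfl fun σ _ => ?_
  rw [yc_young, yc_ext hn]
  rfl

end A3
end AK


open scoped BigOperators
open scoped Classical
set_option linter.unusedSectionVars false
set_option linter.unusedVariables false

namespace AK

section A4
variable {N n : ℕ} {Y : Type} [Fintype Y]

noncomputable def fc (F : Fin n → Y) : Y → ℕ := fun y => (Finset.univ.filter fun x => F x = y).card

theorem fc_total (F : Fin n → Y) : ∑ y, fc F y = n := by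
  have := Finset.card_eq_sum_card_fiberwise (f := F) (s := Finset.univ) (t := Finset.univ) (by simp)
  simpa [fc] using this.symm

theorem fc_comp (F : Fin n → Y) (g : Equiv.Perm (Fin n)) : fc (F ∘ g) = fc F := by
  funext y
  refine Finset.card_bij (fun x _ => g x) ?_ ?_ ?_
  · intro x hx; simpa using hx
  · intro x _ y _ h; exact g.injective h
  · intro x hx; exact ⟨g.symm x, by simpa using hx, by simp⟩

theorem fc_conj (F F' : Fin n → Y) (h : fc F = fc F') : ∃ g : Equiv.Perm (Fin n), F ∘ g = F' := by
  have e : ∀ y, Nonempty ({x // F' x = y} ≃ {x // F x = y}) := by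
    intro y
    refine ⟨Fintype.equivOfCardEq ?_⟩
    rw [Fintype.card_subtype, Fintype.card_subtype]
    exact (congrFun h y).symm
  refine ⟨(Equiv.sigmaFiberEquiv F').symm.trans ((Equiv.sigmaCongrRight fun y => (e y).some).trans (Equiv.sigmaFiberEquiv F)), ?_⟩
  funext x
  simp only [Function.comp, Equiv.trans_apply]
  exact ((e (F' x)).some ⟨x, rfl⟩).2

theorem fc_exists (c : Y → ℕ) (hc : ∑ y, c y = n) : ∃ F : Fin n → Y, fc F = c := by
  have : Fintype.card (Fin n) = Fintype.card (Σ y, Fin (c y)) := by simp [hc]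
  let e := Fintype.equivOfCardEq this
  refine ⟨fun x => (e x).1, ?_⟩
  funext y
  have : Fintype.card (Fin (c y)) = c y := by simp
  rw [← this, fc, ← Fintype.card_subtype]
  refine Fintype.card_congr ?_
  refine (e.subtypeEquiv (q := fun z => z.1 = y) fun a => Iff.rfl).trans ?_
  exact Equiv.sigmaSubtype y

theorem burnside_one (c : Y → ℕ) (hc : ∑ y, c y = n) :
    ∑ g : Equiv.Perm (Fin n), (Finset.univ.filter fun F : Fin n → Y => F ∘ g = F ∧ fc F = c).card = n.factorial := by
  obtain ⟨F0, h0⟩ := fc_exists c hc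
  have h1 : ∑ g : Equiv.Perm (Fin n), (Finset.univ.filter fun F : Fin n → Y => F ∘ g = F ∧ fc F = c).card =
      ∑ F ∈ Finset.univ.filter (fun F : Fin n → Y => fc F = c), (Finset.univ.filter fun g : Equiv.Perm (Fin n) => F ∘ g = F).card := by
    simp only [Finset.card_filter]
    rw [Finset.sum_comm, Finset.sum_filter]
    refine Finset.sum_congr rfl fun F _ => ?_
    split_ifs with h <;> simp [h]
  have h2 : ∀ F ∈ Finset.univ.filter (fun F : Fin n → Y => fc F = c), (Finset.univ.filter fun g : Equiv.Perm (Fin n) => F ∘ g = F).card =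
      (Finset.univ.filter fun g : Equiv.Perm (Fin n) => F0 ∘ g = F).card := by
    intro F hF
    obtain ⟨k, hk⟩ := fc_conj F0 F (by rw [h0]; exact (Finset.mem_filter.1 hF).2.symm)
    refine Finset.card_bij (fun g _ => k * g) ?_ ?_ ?_
    · intro g hg
      simp only [Finset.mem_filter, Finset.mem_univ, true_and] at hg ⊢
      rw [Equiv.Perm.coe_mul, ← Function.comp_assoc, hk, hg]
    · intro g _ g' _ h; exact mul_left_cancel h
    · intro g hg
      refine ⟨k⁻¹ * g, ?_, by simp⟩
      simp only [Finset.mem_filter, Finset.mem_univ, true_and] at hg ⊢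
      nth_rw 1 [← hk]
      rw [Function.comp_assoc, ← Equiv.Perm.coe_mul, mul_inv_cancel_left, hg]
  rw [h1, Finset.sum_congr rfl h2, ← Finset.card_eq_sum_card_fiberwise (s := Finset.univ) (f := fun g : Equiv.Perm (Fin n) => F0 ∘ g)]
  · rw [Finset.card_univ, Fintype.card_perm, Fintype.card_fin]
  · intro g _
    simp [fc_comp, h0]

theorem fin_comp (p : (Y → ℕ) → Prop) : {c : Y → ℕ | ∑ y, c y = n ∧ p c}.Finite := by
  refine (Set.finite_Icc (0 : Y → ℕ) (fun _ => n)).subset ?_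
  rintro c ⟨hc, _⟩
  refine ⟨fun i => by simp, fun i => ?_⟩
  rw [← hc]
  exact Finset.single_le_sum (f := c) (fun i _ => by simp) (Finset.mem_univ i)

/-- number of fixed functions with a condition on the fibre sizes -/
noncomputable def cf (g : Equiv.Perm (Fin n)) (p : (Y → ℕ) → Prop) : ℕ :=
  (Finset.univ.filter fun F : Fin n → Y => F ∘ g = F ∧ p (fc F)).card

theorem burnside (p : (Y → ℕ) → Prop) :
    ∑ g : Equiv.Perm (Fin n), cf g p =
      n.factorial * Set.ncard {c : Y → ℕ | ∑ y, c y = n ∧ p c} := by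
  have hf := fin_comp (n := n) p
  have h1 : ∀ g : Equiv.Perm (Fin n), cf g p =
      ∑ c ∈ hf.toFinset, (Finset.univ.filter fun F : Fin n → Y => F ∘ g = F ∧ fc F = c).card := by
    intro g
    rw [cf, Finset.card_eq_sum_card_fiberwise (f := fc) (t := hf.toFinset)]
    · refine Finset.sum_congr rfl fun c hc => ?_
      rw [Finset.filter_filter]
      congr 1
      ext F
      simp only [Finset.mem_filter, Finset.mem_univ, true_and]
      constructor
      · rintro ⟨h1, h2⟩; exact ⟨h1.1, h2⟩
      · rintro ⟨h1, h2⟩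
        have := (hf.mem_toFinset.1 hc).2
        exact ⟨⟨h1, by rw [h2]; exact this⟩, h2⟩
    · intro F hF
      rw [Finset.mem_coe, hf.mem_toFinset]
      exact ⟨fc_total F, (Finset.mem_filter.1 hF).2.2⟩
  simp only [h1]
  rw [Finset.sum_comm, Finset.sum_congr rfl fun c hc => burnside_one c (hf.mem_toFinset.1 hc).1,
    Finset.sum_const, smul_eq_mul, mul_comm, Set.ncard_eq_toFinset_card _ hf]

/-- number of three-dimensional arrays with given margins -/
noncomputable def Qm (a b c : Fin N → ℤ) : ℕ :=
  Set.ncard {m : Fin N → Fin N → Fin N → ℕ | (∀ i, ∑ j, ∑ k, (m i j k : ℤ) = a i) ∧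
    (∀ j, ∑ i, ∑ k, (m i j k : ℤ) = b j) ∧ ∀ k, ∑ i, ∑ j, (m i j k : ℤ) = c k}

theorem yc_eq (a : Fin N → ℤ) (g : Equiv.Perm (Fin n)) : yc N a g =
    cf g (fun c : Fin N → ℕ => ∀ i, (c i : ℤ) = a i) := by
  rw [yc, cf]
  congr 2
  ext F
  refine Finset.mem_filter.trans (Iff.trans ?_ (Iff.symm (@Finset.mem_filter _ _ (_) _ _)))
  simp only [Finset.mem_univ, true_and, fc]
  refine and_congr_right fun _ => forall_congr' fun i => ?_
  congr!

theorem fc_fst {A B : Type} [Fintype A] [Fintype B] (F : Fin n → A × B) (i : A) :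
    fc (fun x => (F x).1) i = ∑ j, fc F (i, j) := by
  rw [fc, Finset.card_eq_sum_card_fiberwise (f := fun x => (F x).2) (t := Finset.univ) (by simp)]
  refine Finset.sum_congr rfl fun j _ => ?_
  rw [Finset.filter_filter, fc]
  congr 1; ext x; simp [Prod.ext_iff]

theorem fc_snd {A B : Type} [Fintype A] [Fintype B] (F : Fin n → A × B) (j : B) :
    fc (fun x => (F x).2) j = ∑ i, fc F (i, j) := by
  rw [fc, Finset.card_eq_sum_card_fiberwise (f := fun x => (F x).1) (t := Finset.univ) (by simp)]
  refine Finset.sum_congr rfl fun j _ => ?_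
  rw [Finset.filter_filter, fc]
  congr 1; ext x; simp [Prod.ext_iff, and_comm]

theorem card_pair {A B : Type} [Fintype A] [Fintype B] (g : Equiv.Perm (Fin n)) (p : (A → ℕ) → Prop) (q : (B → ℕ) → Prop) :
    cf g p * cf g q = cf g (fun F => p (fun i => ∑ j, F (i, j)) ∧ q (fun j => ∑ i, F (i, j))) := by
  rw [cf, cf, cf]
  rw [← Finset.card_product]
  refine Finset.card_bij (fun f _ x => (f.1 x, f.2 x)) ?_ ?_ ?_
  · rintro ⟨f1, f2⟩ hf
    simp only [Finset.mem_product, Finset.mem_filter, Finset.mem_univ, true_and] at hf ⊢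
    simp only [← fc_fst, ← fc_snd]
    refine ⟨?_, hf.1.2, hf.2.2⟩
    funext x
    exact Prod.ext (congrFun hf.1.1 x) (congrFun hf.2.1 x)
  · rintro ⟨f1, f2⟩ _ ⟨f1', f2'⟩ _ h
    refine Prod.ext (funext fun x => ?_) (funext fun x => ?_)
    · exact congrArg Prod.fst (congrFun h x)
    · exact congrArg Prod.snd (congrFun h x)
  · intro F hF
    simp only [Finset.mem_filter, Finset.mem_univ, true_and] at hF
    simp only [← fc_fst, ← fc_snd] at hF
    refine ⟨(fun x => (F x).1, fun x => (F x).2), ?_, rfl⟩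
    simp only [Finset.mem_product, Finset.mem_filter, Finset.mem_univ, true_and]
    refine ⟨⟨?_, hF.2.1⟩, ?_, hF.2.2⟩
    · funext x; exact congrArg Prod.fst (congrFun hF.1 x)
    · funext x; exact congrArg Prod.snd (congrFun hF.1 x)

theorem sum_yc2 (a b : Fin N → ℤ) (ha : ∑ i, a i = n) :
    ∑ g : Equiv.Perm (Fin n), yc N a g * yc N b g = n.factorial * (Pm a b : ℤ) := by
  have h1 := burnside (n := n) (Y := Fin N × Fin N) (fun c => (∀ i, ((∑ j, c (i, j) : ℕ) : ℤ) = a i) ∧ ∀ j, ((∑ i, c (i, j) : ℕ) : ℤ) = b j)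
  have h2 : ∑ g : Equiv.Perm (Fin n), yc N a g * yc N b g = ((∑ g : Equiv.Perm (Fin n), cf g (fun c : Fin N × Fin N → ℕ => (∀ i, ((∑ j, c (i, j) : ℕ) : ℤ) = a i) ∧ ∀ j, ((∑ i, c (i, j) : ℕ) : ℤ) = b j) : ℕ) : ℤ) := by
    rw [Nat.cast_sum]
    refine Finset.sum_congr rfl fun g _ => ?_
    rw [yc_eq, yc_eq, ← Nat.cast_mul, card_pair g (fun c => ∀ i, (c i : ℤ) = a i) (fun c => ∀ i, (c i : ℤ) = b i)]
  rw [h2, h1, Nat.cast_mul]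
  congr 2
  refine Set.ncard_congr (fun m _ i j => m (i, j)) ?_ ?_ ?_
  · intro m hm
    refine ⟨fun i => ?_, fun j => ?_⟩
    · rw [← hm.2.1 i]; push_cast; rfl
    · rw [← hm.2.2 j]; push_cast; rfl
  · intro m m' _ _ h; funext x; exact congrFun (congrFun h x.1) x.2
  · intro m hm
    refine ⟨fun x => m x.1 x.2, ⟨?_, fun i => ?_, fun j => ?_⟩, rfl⟩
    · rw [Fintype.sum_prod_type]
      zify
      simp only [hm.1]; exact ha
    · rw [← hm.1 i]; push_cast; rfl
    · rw [← hm.2 j]; push_cast; rfl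

theorem sum_yc3 (a b c : Fin N → ℤ) (ha : ∑ i, a i = n) :
    ∑ g : Equiv.Perm (Fin n), yc N a g * yc N b g * yc N c g = n.factorial * (Qm a b c : ℤ) := by
  have h1 := burnside (n := n) (Y := (Fin N × Fin N) × Fin N) (fun m => ((∀ i, ((∑ j, ∑ k, m ((i, j), k) : ℕ) : ℤ) = a i) ∧ ∀ j, ((∑ i, ∑ k, m ((i, j), k) : ℕ) : ℤ) = b j) ∧ ∀ k, ((∑ x, m (x, k) : ℕ) : ℤ) = c k)
  have h2 : ∑ g : Equiv.Perm (Fin n), yc N a g * yc N b g * yc N c g = ((∑ g : Equiv.Perm (Fin n), cf g (fun m : (Fin N × Fin N) × Fin N → ℕ => ((∀ i, ((∑ j, ∑ k, m ((i, j), k) : ℕ) : ℤ) = a i) ∧ ∀ j, ((∑ i, ∑ k, m ((i, j), k) : ℕ) : ℤ) = b j) ∧ ∀ k, ((∑ x, m (x, k) : ℕ) : ℤ) = c k) : ℕ) : ℤ) := by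
    rw [Nat.cast_sum]
    refine Finset.sum_congr rfl fun g _ => ?_
    rw [yc_eq, yc_eq, yc_eq, ← Nat.cast_mul, card_pair g (fun c => ∀ i, (c i : ℤ) = a i) (fun c => ∀ i, (c i : ℤ) = b i),
      ← Nat.cast_mul, card_pair g (fun m : Fin N × Fin N → ℕ => (∀ i, ((∑ j, m (i, j) : ℕ) : ℤ) = a i) ∧ ∀ j, ((∑ i, m (i, j) : ℕ) : ℤ) = b j) (fun m => ∀ i, (m i : ℤ) = c i)]
  rw [h2, h1, Nat.cast_mul]
  congr 2
  refine Set.ncard_congr (fun m _ i j k => m ((i, j), k)) ?_ ?_ ?_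
  · intro m hm
    refine ⟨fun i => ?_, fun j => ?_, fun k => ?_⟩
    · rw [← hm.2.1.1 i]; push_cast; rfl
    · rw [← hm.2.1.2 j]; push_cast; rfl
    · rw [← hm.2.2 k, Fintype.sum_prod_type]; push_cast; rfl
  · intro m m' _ _ h; funext x; exact congrFun (congrFun (congrFun h x.1.1) x.1.2) x.2
  · intro m hm
    refine ⟨fun x => m x.1.1 x.1.2 x.2, ⟨?_, ⟨fun i => ?_, fun j => ?_⟩, fun k => ?_⟩, rfl⟩
    · rw [Fintype.sum_prod_type, Fintype.sum_prod_type]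
      zify
      simp only [hm.1]; exact ha
    · rw [← hm.1 i]; push_cast; rfl
    · rw [← hm.2.1 j]; push_cast; rfl
    · rw [← hm.2.2 k, Fintype.sum_prod_type]; push_cast; rfl

/-- convolution -/
noncomputable def conv (f g : (Fin N → ℤ) → ℤ) (c : Fin N → ℤ) : ℤ :=
  ∑ x ∈ Finset.Icc 0 c, f x * g (c - x)

theorem yc_sum {n1 n2 : ℕ} (c : Fin N → ℤ) (g : Equiv.Perm (Fin n1)) (h : Equiv.Perm (Fin n2)) :
    yc N c (Partition'.sumEmb g h) = conv (fun a => yc N a g) (fun a => yc N a h) c := by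
  rw [yc_eq, conv, cf]
  have key : ∀ F : Fin (n1 + n2) → Fin N, ∀ i, fc F i = fc (fun x => F (Fin.castAdd n2 x)) i + fc (fun x => F (Fin.natAdd n1 x)) i := by
    intro F i
    simp only [fc, Finset.card_filter]
    rw [Fin.sum_univ_add]
    congr!
  rw [Finset.card_eq_sum_card_fiberwise (f := fun F i => (fc (fun x => F (Fin.castAdd n2 x)) i : ℤ)) (t := Finset.Icc 0 c), Nat.cast_sum]
  · refine Finset.sum_congr rfl fun x hx => ?_
    rw [yc_eq, yc_eq, ← Nat.cast_mul, cf, cf, ← Finset.card_product]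
    congr 1
    refine Finset.card_bij (fun F _ => (fun x => F (Fin.castAdd n2 x), fun x => F (Fin.natAdd n1 x))) ?_ ?_ ?_
    · intro F hF
      simp only [Finset.mem_product, Finset.mem_filter, Finset.mem_univ, true_and] at hF ⊢
      refine ⟨⟨?_, fun i => congrFun hF.2 i⟩, ?_, fun i => ?_⟩
      · funext y
        have := congrFun hF.1.1 (Fin.castAdd n2 y)
        simpa [Partition'.sumEmb] using this
      · funext y
        have := congrFun hF.1.1 (Fin.natAdd n1 y)
        simpa [Partition'.sumEmb] using this
      · have h1 := hF.1.2 i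
        have h2 := congrFun hF.2 i
        rw [key] at h1
        simp only [Pi.sub_apply] at h2 ⊢
        push_cast at h1
        linarith
    · intro F _ F' _ h
      have h1 := congrArg Prod.fst h
      have h2 := congrArg Prod.snd h
      funext y
      refine Fin.addCases (fun z => ?_) (fun z => ?_) y
      · exact congrFun h1 z
      · exact congrFun h2 z
    · rintro ⟨f1, f2⟩ hf
      simp only [Finset.mem_product, Finset.mem_filter, Finset.mem_univ, true_and] at hf
      refine ⟨Fin.append f1 f2, ?_, ?_⟩
      · simp only [Finset.mem_product, Finset.mem_filter, Finset.mem_univ, true_and]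
        refine ⟨⟨?_, fun i => ?_⟩, ?_⟩
        · funext y
          refine Fin.addCases (fun z => ?_) (fun z => ?_) y
          · have := congrFun hf.1.1 z
            simpa [Partition'.sumEmb] using this
          · have := congrFun hf.2.1 z
            simpa [Partition'.sumEmb] using this
        · rw [key]
          simp only [Fin.append_left, Fin.append_right]
          have h1 := hf.1.2 i
          have h2 := hf.2.2 i
          simp only [Pi.sub_apply] at h2
          push_cast
          linarith
        · funext i
          simp only [Fin.append_left]
          exact hf.1.2 i
      · simp
  · intro F hF
    simp only [Finset.coe_filter, Finset.mem_univ, true_and] at hF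
    rw [Finset.mem_coe, Finset.mem_Icc]
    refine ⟨fun i => by simp, fun i => ?_⟩
    have := hF.2 i
    rw [key] at this
    push_cast at this
    simp only
    linarith [Nat.cast_nonneg (α := ℤ) (fc (fun x => F (Fin.natAdd n1 x)) i)]

end A4
end AK


open scoped BigOperators
open scoped Classical
set_option linter.unusedSectionVars false
set_option linter.unusedVariables false

namespace AK

section A5
variable {N n : ℕ}

abbrev M2 (N : ℕ) : Type := Fin N → Fin N → ℕ
abbrev M3 (N : ℕ) : Type := Fin N → Fin N → Fin N → ℕ

def TS (a b c : Fin N → ℤ) : Set (M2 N × M2 N × M3 N) :=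
  {m | (∀ i, (∑ k, (m.1 i k : ℤ)) + ∑ j, ∑ k, (m.2.2 i j k : ℤ) = a i) ∧
    (∀ j, (∑ k, (m.2.1 j k : ℤ)) + ∑ i, ∑ k, (m.2.2 i j k : ℤ) = b j) ∧
    ∀ k, (∑ i, (m.1 i k : ℤ)) + (∑ j, (m.2.1 j k : ℤ)) + ∑ i, ∑ j, (m.2.2 i j k : ℤ) = c k}

noncomputable def Tc (a b c : Fin N → ℤ) : ℕ := Set.ncard (TS a b c)

def JJJ (l m p : Fin N → ℤ) (f : (Fin N → ℤ) → (Fin N → ℤ) → (Fin N → ℤ) → ℤ) : ℤ :=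
  JJ l fun a => JJ m fun b => JJ p fun c => f a b c

def e3 (A : Type*) : (Fin 3 → A) ≃ A × A × A where
  toFun w := (w 0, w 1, w 2)
  invFun w := ![w.1, w.2.1, w.2.2]
  left_inv w := by funext i; fin_cases i <;> rfl
  right_inv w := rfl

theorem dl1 {A B : Type} [DecidableEq A] [Fintype A] [Fintype B] (i : A) (f : A → B → ℤ) :
    (∑ x, ∑ y, if x = i then f x y else 0) = ∑ y, f i y := by
  rw [Finset.sum_comm]; simp

theorem dl2 {A B C : Type} [DecidableEq A] [Fintype A] [Fintype B] [Fintype C] (i : A) (f : A → B → C → ℤ) :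
    (∑ x, ∑ y, ∑ z, if x = i then f x y z else 0) = ∑ y, ∑ z, f i y z := by
  rw [Finset.sum_comm]
  exact Finset.sum_congr rfl fun y _ => dl1 i fun x z => f x y z

theorem sum_e3 {A : Type*} [Fintype A] {_ : Fintype (Fin 3 → A)} (F : (Fin 3 → A) → ℤ) :
    ∑ w, F w = ∑ x, ∑ y, ∑ z, F ![x, y, z] := by
  rw [← Equiv.sum_comp (e3 A).symm, Fintype.sum_prod_type]
  refine Finset.sum_congr rfl fun x _ => ?_
  rw [Fintype.sum_prod_type]
  rfl

theorem Tc_eq (a b c : Fin N → ℤ) : Set.ncard {m : TV N →₀ ℕ | wv (tI N) m = ![a, b, c]} = Tc a b c := by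
  have key : ∀ m : TV N →₀ ℕ, wv (tI N) m = ![a, b, c] ↔
      ((fun i k => m (Sum.inl (i, k)), fun j k => m (Sum.inr (Sum.inl (j, k))), fun i j k => m (Sum.inr (Sum.inr (i, j, k)))) : M2 N × M2 N × M3 N) ∈ TS a b c := by
    intro m
    have h0 : ∀ i, wv (tI N) m 0 i = (∑ k, (m (Sum.inl (i, k)) : ℤ)) + ∑ j, ∑ k, (m (Sum.inr (Sum.inr (i, j, k))) : ℤ) := by
      intro i
      simp [wv, tI, tidx, Fintype.sum_prod_type]
      rw [dl1 i (fun x y => (m (Sum.inl (x, y)) : ℤ)), dl2 i (fun x y z => (m (Sum.inr (Sum.inr (x, y, z))) : ℤ))]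
    have h1 : ∀ j, wv (tI N) m 1 j = (∑ k, (m (Sum.inr (Sum.inl (j, k))) : ℤ)) + ∑ i, ∑ k, (m (Sum.inr (Sum.inr (i, j, k))) : ℤ) := by
      intro i
      simp [wv, tI, tidx, Fintype.sum_prod_type]
      rw [dl1 i (fun x y => (m (Sum.inr (Sum.inl (x, y))) : ℤ))]
      congr 1
      exact Finset.sum_congr rfl fun x _ => dl1 i (fun j k => (m (Sum.inr (Sum.inr (x, j, k))) : ℤ))
    have h2 : ∀ k, wv (tI N) m 2 k = (∑ i, (m (Sum.inl (i, k)) : ℤ)) + (∑ j, (m (Sum.inr (Sum.inl (j, k))) : ℤ)) + ∑ i, ∑ j, (m (Sum.inr (Sum.inr (i, j, k))) : ℤ) := by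
      intro i
      simp [wv, tI, tidx, Fintype.sum_prod_type, add_assoc]
    constructor
    · intro h
      refine ⟨fun i => ?_, fun i => ?_, fun i => ?_⟩
      · exact (h0 i).symm.trans (congrFun (congrFun h 0) i)
      · exact (h1 i).symm.trans (congrFun (congrFun h 1) i)
      · exact (h2 i).symm.trans (congrFun (congrFun h 2) i)
    · rintro ⟨k0, k1, k2⟩
      funext s i
      fin_cases s
      · exact (h0 i).trans (k0 i)
      · exact (h1 i).trans (k1 i)
      · exact (h2 i).trans (k2 i)
  refine Set.ncard_congr (fun m _ => (fun i k => m (Sum.inl (i, k)), fun j k => m (Sum.inr (Sum.inl (j, k))), fun i j k => m (Sum.inr (Sum.inr (i, j, k))))) ?_ ?_ ?_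
  · intro m hm; exact (key m).1 hm
  · intro m m' _ _ h
    ext x
    rcases x with ⟨i, k⟩ | ⟨i, k⟩ | ⟨i, j, k⟩
    · exact congrFun (congrFun (congrArg Prod.fst h) i) k
    · exact congrFun (congrFun (congrArg (fun z => z.2.1) h) i) k
    · exact congrFun (congrFun (congrFun (congrArg (fun z => z.2.2) h) i) j) k
  · rintro ⟨m1, m2, m3⟩ hm
    refine ⟨Finsupp.equivFunOnFinite.symm (fun x => match x with
      | Sum.inl (i, k) => m1 i k
      | Sum.inr (Sum.inl (i, k)) => m2 i k
      | Sum.inr (Sum.inr (i, j, k)) => m3 i j k), ?_, rfl⟩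
    exact (key _).2 hm

theorem dim_eq (l : Fin 3 → Fin N → ℤ) (hl : ∀ s i, 0 ≤ l s i) (hd : Dom l) :
    (Module.finrank ℂ (hwv (act (tI N)) ⊤ l) : ℤ) = JJJ (l 0) (l 1) (l 2) (fun a b c => (Tc a b c : ℤ)) := by
  rw [char_top (tI N) (tI_all N) hl hd, sum_e3, JJJ, JJ]
  refine Finset.sum_congr rfl fun x _ => ?_
  rw [JJ, Finset.mul_sum]
  refine Finset.sum_congr rfl fun y _ => ?_
  rw [JJ, Finset.mul_sum, Finset.mul_sum]
  refine Finset.sum_congr rfl fun z _ => ?_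
  rw [← Tc_eq]
  have : shiftw l ![x, y, z] = ![sh (l 0) x, sh (l 1) y, sh (l 2) z] := by
    funext s i; fin_cases s <;> rfl
  rw [this, sgnw, Fin.prod_univ_three]
  simp [mul_assoc]

theorem TS_finite (a b c : Fin N → ℤ) : (TS a b c).Finite := by
  refine (Set.finite_Icc (0 : M2 N × M2 N × M3 N) ((fun i k => (c k).toNat), (fun i k => (c k).toNat), fun i j k => (c k).toNat)).subset ?_
  rintro ⟨m1, m2, m3⟩ ⟨-, -, h⟩
  simp only at h
  have n1 : ∀ k, 0 ≤ ∑ i, (m1 i k : ℤ) := fun k => Finset.sum_nonneg fun i _ => by simp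
  have n2 : ∀ k, 0 ≤ ∑ i, (m2 i k : ℤ) := fun k => Finset.sum_nonneg fun i _ => by simp
  have n3 : ∀ k i, 0 ≤ ∑ j, (m3 i j k : ℤ) := fun k i => Finset.sum_nonneg fun i _ => by simp
  have n4 : ∀ k, 0 ≤ ∑ i, ∑ j, (m3 i j k : ℤ) := fun k => Finset.sum_nonneg fun i _ => n3 k i
  refine ⟨⟨fun i k => by simp, fun i k => by simp, fun i j k => by simp⟩, fun i k => ?_, fun i k => ?_, fun i j k => ?_⟩
  · have := Finset.single_le_sum (f := fun i => (m1 i k : ℤ)) (fun i _ => by simp) (Finset.mem_univ i)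
    have := h k; have := n2 k; have := n4 k
    simp only at *; omega
  · have := Finset.single_le_sum (f := fun i => (m2 i k : ℤ)) (fun i _ => by simp) (Finset.mem_univ i)
    have := h k; have := n1 k; have := n4 k
    simp only at *; omega
  · have := Finset.single_le_sum (f := fun j => (m3 i j k : ℤ)) (fun i _ => by simp) (Finset.mem_univ j)
    have := Finset.single_le_sum (f := fun i => ∑ j, (m3 i j k : ℤ)) (fun i _ => n3 k i) (Finset.mem_univ i)
    have := h k; have := n1 k; have := n2 k
    simp only at *; omega

theorem Tc_formula (a b c : Fin N → ℤ) : (Tc a b c : ℤ) =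
    ∑ x ∈ Finset.Icc 0 a, ∑ y ∈ Finset.Icc 0 b, ∑ z ∈ Finset.Icc 0 c, ∑ u ∈ Finset.Icc 0 z,
      (Pm x u : ℤ) * Pm (b - y) (c - z) * Qm (a - x) y (z - u) := by
  have hf := TS_finite a b c
  let φ : M2 N × M2 N × M3 N → (Fin N → ℤ) × (Fin N → ℤ) × (Σ _ : (Fin N → ℤ), (Fin N → ℤ)) := fun m =>
    (fun i => ∑ k, (m.1 i k : ℤ), fun j => ∑ i, ∑ k, (m.2.2 i j k : ℤ),
      ⟨fun k => (∑ i, (m.1 i k : ℤ)) + ∑ i, ∑ j, (m.2.2 i j k : ℤ), fun k => ∑ i, (m.1 i k : ℤ)⟩)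
  rw [Tc, Set.ncard_eq_toFinset_card _ hf, Finset.card_eq_sum_card_fiberwise (f := φ)
    (t := Finset.Icc 0 a ×ˢ (Finset.Icc 0 b ×ˢ (Finset.Icc 0 c).sigma fun z => Finset.Icc 0 z)), Nat.cast_sum,
    Finset.sum_product]
  · refine Finset.sum_congr rfl fun x hx => ?_
    rw [Finset.sum_product]
    refine Finset.sum_congr rfl fun y hy => ?_
    rw [Finset.sum_sigma]
    refine Finset.sum_congr rfl fun z hz => Finset.sum_congr rfl fun u hu => ?_
    rw [Pm, Pm, Qm, ← Nat.cast_mul, ← Nat.cast_mul, mul_assoc, ← Set.ncard_prod, ← Set.ncard_prod, ← Set.ncard_coe_finset]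
    congr 2
    ext ⟨m1, m2, m3⟩
    simp only [Finset.coe_filter, hf.mem_toFinset]
    simp only [Set.mem_prod, φ, TS, Prod.mk.injEq, Set.mem_ofPred_eq, funext_iff, Sigma.mk.injEq, heq_eq_eq, Pi.sub_apply]
    have sw : ∀ k, ∑ i, ∑ j, (m3 i j k : ℤ) = ∑ i, ∑ j, (m3 i j k : ℤ) := fun _ => rfl
    constructor
    · rintro ⟨⟨h1, h2, h3⟩, h4, h5, h6, h7⟩
      refine ⟨⟨h4, h7⟩, ⟨fun i => ?_, fun i => ?_⟩, fun i => ?_, h5, fun i => ?_⟩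
      · have := h2 i; have := h5 i; linarith
      · have := h3 i; have := h6 i; linarith
      · have := h1 i; have := h4 i; linarith
      · have := h6 i; have := h7 i; linarith
    · rintro ⟨⟨h4, h7⟩, ⟨h1, h2⟩, h3, h5, h6⟩
      refine ⟨⟨fun i => ?_, fun i => ?_, fun i => ?_⟩, h4, h5, fun i => ?_, h7⟩
      · have := h4 i; have := h3 i; linarith
      · have := h1 i; have := h5 i; linarith
      · have := h2 i; have := h6 i; have := h7 i; linarith
      · have := h6 i; have := h7 i; linarith
  · rintro ⟨m1, m2, m3⟩ hm
    obtain ⟨h1, h2, h3⟩ := hf.mem_toFinset.1 hm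
    simp only at h1 h2 h3
    have n1 : ∀ k, 0 ≤ ∑ i, (m1 i k : ℤ) := fun k => Finset.sum_nonneg fun i _ => by simp
    have n1' : ∀ i, 0 ≤ ∑ k, (m1 i k : ℤ) := fun k => Finset.sum_nonneg fun i _ => by simp
    have n2 : ∀ k, 0 ≤ ∑ i, (m2 i k : ℤ) := fun k => Finset.sum_nonneg fun i _ => by simp
    have n2' : ∀ i, 0 ≤ ∑ k, (m2 i k : ℤ) := fun k => Finset.sum_nonneg fun i _ => by simp
    have n3 : ∀ k, 0 ≤ ∑ i, ∑ j, (m3 i j k : ℤ) := fun k => Finset.sum_nonneg fun i _ => Finset.sum_nonneg fun i _ => by simp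
    have n4 : ∀ j, 0 ≤ ∑ i, ∑ k, (m3 i j k : ℤ) := fun k => Finset.sum_nonneg fun i _ => Finset.sum_nonneg fun i _ => by simp
    have n5 : ∀ i, 0 ≤ ∑ j, ∑ k, (m3 i j k : ℤ) := fun k => Finset.sum_nonneg fun i _ => Finset.sum_nonneg fun i _ => by simp
    simp only [φ, Finset.coe_product, Set.mem_prod, Finset.mem_coe, Finset.mem_Icc, Finset.mem_sigma]
    refine ⟨⟨fun i => n1' i, fun i => ?_⟩, ⟨fun i => n4 i, fun i => ?_⟩, ⟨fun i => ?_, fun i => ?_⟩, fun i => n1 i, fun i => ?_⟩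
    · have := h1 i; have := n5 i; simp only; linarith
    · have := h2 i; have := n2' i; simp only; linarith
    · have := n1 i; have := n3 i; simp only [Pi.zero_apply]; linarith
    · have := h3 i; have := n2 i; simp only; linarith
    · have := n3 i; simp only; linarith

theorem Qm_ne {a b c : Fin N → ℤ} (h : Qm a b c ≠ 0) : ((∀ i, 0 ≤ a i) ∧ (∀ i, 0 ≤ b i) ∧ ∀ i, 0 ≤ c i) ∧
    ∑ i, a i = ∑ i, b i ∧ ∑ i, b i = ∑ i, c i := by
  obtain ⟨m, hm⟩ := Set.nonempty_of_ncard_ne_zero h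
  refine ⟨⟨fun i => ?_, fun i => ?_, fun i => ?_⟩, ?_, ?_⟩
  · rw [← hm.1 i]; exact Finset.sum_nonneg fun j _ => Finset.sum_nonneg fun j _ => by simp
  · rw [← hm.2.1 i]; exact Finset.sum_nonneg fun j _ => Finset.sum_nonneg fun j _ => by simp
  · rw [← hm.2.2 i]; exact Finset.sum_nonneg fun j _ => Finset.sum_nonneg fun j _ => by simp
  · simp only [← hm.1, ← hm.2.1]; exact Finset.sum_comm
  · simp only [← hm.2.1, ← hm.2.2]
    rw [Finset.sum_comm]
    simp only [fun i => Finset.sum_comm (s := Finset.univ) (t := Finset.univ) (f := fun j k => (m i j k : ℤ))]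
    exact Finset.sum_comm

theorem Qm_zero : Qm (0 : Fin N → ℤ) 0 0 = 1 := by
  rw [Qm]
  convert Set.ncard_singleton (0 : M3 N) using 2
  ext m
  simp only [Set.mem_ofPred_eq, Set.mem_singleton_iff]
  constructor
  · rintro ⟨h, -⟩
    funext i j k
    have h1 := (Finset.sum_eq_zero_iff_of_nonneg (fun j _ => Finset.sum_nonneg fun j _ => by simp)).1 (h i) j (Finset.mem_univ _)
    have h2 := (Finset.sum_eq_zero_iff_of_nonneg (fun j _ => by simp)).1 h1 k (Finset.mem_univ _)
    exact_mod_cast h2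
  · rintro rfl; simp

theorem Tc_kron {a b c : Fin N → ℤ} (h1 : ∑ i, a i = ∑ i, c i) (h2 : ∑ i, b i = ∑ i, c i) :
    Tc a b c = Qm a b c := by
  symm
  refine Set.ncard_congr (fun m _ => (0, 0, m)) ?_ ?_ ?_
  · intro m hm
    refine ⟨fun i => ?_, fun i => ?_, fun i => ?_⟩
    · simpa using hm.1 i
    · simpa using hm.2.1 i
    · simpa using hm.2.2 i
  · intro m m' _ _ h; exact congrArg (fun z => z.2.2) h
  · rintro ⟨m1, m2, m3⟩ ⟨k1, k2, k3⟩
    simp only at k1 k2 k3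
    have e1 : ∑ i, a i = ∑ i, ∑ k, (m1 i k : ℤ) + ∑ i, ∑ j, ∑ k, (m3 i j k : ℤ) := by
      simp only [← k1, Finset.sum_add_distrib]
    have e2 : ∑ i, b i = ∑ i, ∑ k, (m2 i k : ℤ) + ∑ i, ∑ j, ∑ k, (m3 i j k : ℤ) := by
      simp only [← k2, Finset.sum_add_distrib]
      congr 1; exact Finset.sum_comm
    have e3 : ∑ i, c i = ∑ i, ∑ k, (m1 i k : ℤ) + ∑ i, ∑ k, (m2 i k : ℤ) + ∑ i, ∑ j, ∑ k, (m3 i j k : ℤ) := by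
      simp only [← k3, Finset.sum_add_distrib]
      congr 1
      · congr 1
        · exact Finset.sum_comm
        · exact Finset.sum_comm
      · rw [Finset.sum_comm]
        exact Finset.sum_congr rfl fun i _ => Finset.sum_comm
    have z1 : ∑ i, ∑ k, (m1 i k : ℤ) = 0 := by linarith
    have z2 : ∑ i, ∑ k, (m2 i k : ℤ) = 0 := by linarith
    have zz : ∀ m : M2 N, ∑ i, ∑ k, (m i k : ℤ) = 0 → m = 0 := by
      intro m h
      funext i j
      have h1 := (Finset.sum_eq_zero_iff_of_nonneg (fun j _ => Finset.sum_nonneg fun j _ => by simp)).1 h i (Finset.mem_univ _)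
      have h2 := (Finset.sum_eq_zero_iff_of_nonneg (fun j _ => by simp)).1 h1 j (Finset.mem_univ _)
      exact_mod_cast h2
    obtain rfl := zz _ z1
    obtain rfl := zz _ z2
    refine ⟨m3, ⟨fun i => ?_, fun i => ?_, fun i => ?_⟩, rfl⟩
    · simpa using k1 i
    · simpa using k2 i
    · simpa using k3 i

theorem vec_zero_of {a : Fin N → ℤ} (h : ∀ i, 0 ≤ a i) (hs : ∑ i, a i = 0) : a = 0 := by
  funext i
  exact (Finset.sum_eq_zero_iff_of_nonneg (fun j _ => h j)).1 hs i (Finset.mem_univ _)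

theorem Tc_lr {a b c : Fin N → ℤ} (h : ∑ i, c i = ∑ i, a i + ∑ i, b i) :
    (Tc a b c : ℤ) = conv (fun x => (Pm a x : ℤ)) (fun x => (Pm b x : ℤ)) c := by
  rw [Tc_formula, conv]
  have key : ∀ x y z u, (Pm x u : ℤ) * Pm (b - y) (c - z) * Qm (a - x) y (z - u) ≠ 0 → x = a ∧ y = 0 ∧ u = z := by
    intro x y z u hne
    have q1 : Pm x u ≠ 0 := Nat.cast_ne_zero.1 (left_ne_zero_of_mul (left_ne_zero_of_mul hne))
    have q2 : Pm (b - y) (c - z) ≠ 0 := Nat.cast_ne_zero.1 (right_ne_zero_of_mul (left_ne_zero_of_mul hne))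
    have q3 : Qm (a - x) y (z - u) ≠ 0 := Nat.cast_ne_zero.1 (right_ne_zero_of_mul hne)
    have t1 := Pm_total q1
    have t2 := Pm_total q2
    obtain ⟨⟨n1, n2, n3⟩, t3, t4⟩ := Qm_ne q3
    have d1 : ∑ i, (a - x) i = ∑ i, a i - ∑ i, x i := by simp
    have d2 : ∑ i, (b - y) i = ∑ i, b i - ∑ i, y i := by simp
    have d3 : ∑ i, (c - z) i = ∑ i, c i - ∑ i, z i := by simp
    have d4 : ∑ i, (z - u) i = ∑ i, z i - ∑ i, u i := by simp
    refine ⟨?_, ?_, ?_⟩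
    · exact (sub_eq_zero.1 (vec_zero_of n1 (by linarith))).symm
    · exact vec_zero_of n2 (by linarith)
    · exact (sub_eq_zero.1 (vec_zero_of n3 (by linarith))).symm
  by_cases ha : 0 ≤ a
  · by_cases hb : 0 ≤ b
    · rw [Finset.sum_eq_single a, Finset.sum_eq_single 0]
      · refine Finset.sum_congr rfl fun z hz => ?_
        rw [Finset.sum_eq_single z]
        · simp [Qm_zero]
        · intro u _ hu
          by_contra hne
          exact hu (key _ _ _ _ hne).2.2
        · intro hz'
          exact absurd (Finset.mem_Icc.2 ⟨(Finset.mem_Icc.1 hz).1, le_rfl⟩) hz'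
      · intro y _ hy
        refine Finset.sum_eq_zero fun z _ => Finset.sum_eq_zero fun u _ => ?_
        by_contra hne
        exact hy (key _ _ _ _ hne).2.1
      · intro h'; exact absurd (Finset.mem_Icc.2 ⟨le_rfl, hb⟩) h'
      · intro x _ hx
        refine Finset.sum_eq_zero fun y _ => Finset.sum_eq_zero fun z _ => Finset.sum_eq_zero fun u _ => ?_
        by_contra hne
        exact hx (key _ _ _ _ hne).1
      · intro h'; exact absurd (Finset.mem_Icc.2 ⟨ha, le_rfl⟩) h'
    · rw [Finset.sum_eq_zero, Finset.sum_eq_zero]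
      · intro x _
        by_contra hne
        exact hb (Pm_neg (Nat.cast_ne_zero.1 (right_ne_zero_of_mul hne))).1
      · intro x _
        rw [Finset.Icc_eq_empty hb, Finset.sum_empty]
  · rw [Finset.Icc_eq_empty ha, Finset.sum_empty, Finset.sum_eq_zero]
    intro x _
    by_contra hne
    exact ha (Pm_neg (Nat.cast_ne_zero.1 (left_ne_zero_of_mul hne))).1

end A5
end AK


open scoped BigOperators
open scoped Classical
set_option linter.unusedSectionVars false
set_option linter.unusedVariables false

namespace AK

section A6
variable {N n : ℕ}
open Partition'

theorem JJ_mul (l m : Fin N → ℤ) (f g : (Fin N → ℤ) → ℤ) :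
    JJ l f * JJ m g = JJ l (fun a => JJ m (fun b => f a * g b)) := by
  simp only [JJ_smul, JJ_smul']

theorem JJ_sum' {ι : Type*} (S : Finset ι) (l : Fin N → ℤ) (f : ι → (Fin N → ℤ) → ℤ) :
    JJ l (fun a => ∑ x ∈ S, f x a) = ∑ x ∈ S, JJ l (f x) := by
  have := JJ_sum S l f (fun _ => 1)
  simpa using this

theorem JJJ_mul3 (l m p : Fin N → ℤ) (f g h : (Fin N → ℤ) → ℤ) :
    JJ l f * JJ m g * JJ p h = JJJ l m p (fun a b c => f a * g b * h c) := by
  unfold JJJ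
  simp only [JJ_smul, JJ_smul']

theorem JJJ_sum {ι : Type*} (S : Finset ι) (l m p : Fin N → ℤ) (f : ι → (Fin N → ℤ) → (Fin N → ℤ) → (Fin N → ℤ) → ℤ) :
    JJJ l m p (fun a b c => ∑ x ∈ S, f x a b c) = ∑ x ∈ S, JJJ l m p (f x) := by
  unfold JJJ
  simp only [JJ_sum']

theorem JJJ_smul (l m p : Fin N → ℤ) (f : (Fin N → ℤ) → (Fin N → ℤ) → (Fin N → ℤ) → ℤ) (k : ℤ) :
    JJJ l m p (fun a b c => k * f a b c) = k * JJJ l m p f := by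
  unfold JJJ
  simp only [JJ_smul]

theorem JJJ_congr {l m p : Fin N → ℤ} {f g : (Fin N → ℤ) → (Fin N → ℤ) → (Fin N → ℤ) → ℤ}
    (h : ∀ a b c, ∑ i, a i = ∑ i, l i → ∑ i, b i = ∑ i, m i → ∑ i, c i = ∑ i, p i → f a b c = g a b c) :
    JJJ l m p f = JJJ l m p g :=
  JJ_congr fun a ha => JJ_congr fun b hb => JJ_congr fun c hc => h a b c ha hb hc

theorem JJ_ne {l : Fin N → ℤ} {f : (Fin N → ℤ) → ℤ} (h : JJ l f ≠ 0) : ∃ a, ∑ i, a i = ∑ i, l i ∧ f a ≠ 0 := by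
  obtain ⟨σ, _, hσ⟩ := Finset.exists_ne_zero_of_sum_ne_zero h
  exact ⟨_, sh_total l σ, right_ne_zero_of_mul hσ⟩

theorem vsize {p : Partition'} (h : p.size ≤ N) : ∑ i, vec N p i = p.size :=
  size_eq fun k hk => part_zero (h.trans hk)

theorem vec_dom (l m p : Partition') : Dom (![vec N l, vec N m, vec N p] : Fin 3 → Fin N → ℤ) := by
  intro s i j hij
  fin_cases s
  · exact Int.ofNat_le.2 (l.2 hij.le)
  · exact Int.ofNat_le.2 (m.2 hij.le)
  · exact Int.ofNat_le.2 (p.2 hij.le)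

theorem vec_nn (l m p : Partition') : ∀ s i, 0 ≤ (![vec N l, vec N m, vec N p] : Fin 3 → Fin N → ℤ) s i := by
  intro s i
  fin_cases s <;> simp [vec]

theorem dim_vec (l m p : Partition') : (Module.finrank ℂ (hwv (act (tI N)) ⊤ ![vec N l, vec N m, vec N p]) : ℤ) =
    JJJ (vec N l) (vec N m) (vec N p) (fun a b c => (Tc a b c : ℤ)) := dim_eq _ (vec_nn l m p) (vec_dom l m p)

theorem kron_eq (l m p : Partition') (hl : l.size ≤ N) (hm : m.size ≤ N) (hp : p.size ≤ N) :
    (kron l m p : ℤ) = JJJ (vec N l) (vec N m) (vec N p) (fun a b c => (Qm a b c : ℤ)) := by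
  rw [kron]
  split_ifs with h
  · have h1 : ∑ g : Equiv.Perm (Fin p.size), l.irrChar p.size g * m.irrChar p.size g * p.irrChar p.size g =
        (p.size.factorial : ℤ) * JJJ (vec N l) (vec N m) (vec N p) (fun a b c => (Qm a b c : ℤ)) := by
      simp only [irr_eq hp l h.1.le, irr_eq hp m h.2.le, irr_eq hp p le_rfl]
      rw [Finset.sum_congr rfl fun g _ => JJJ_mul3 _ _ _ _ _ _, ← JJJ_sum, ← JJJ_smul]
      refine JJJ_congr fun a b c ha hb hc => ?_
      rw [vsize hl, h.1] at ha
      rw [← sum_yc3 a b c ha]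
    rw [h1, Int.mul_ediv_cancel_left _ (by positivity), Int.toNat_of_nonneg]
    have h2 := dim_vec (N := N) l m p
    have h3 : JJJ (vec N l) (vec N m) (vec N p) (fun a b c => (Qm a b c : ℤ)) =
        JJJ (vec N l) (vec N m) (vec N p) (fun a b c => (Tc a b c : ℤ)) := by
      refine JJ_congr fun a ha => JJ_congr fun b hb => JJ_congr fun c hc => ?_
      rw [vsize hl, h.1] at ha
      rw [vsize hm, h.2] at hb
      rw [vsize hp] at hc
      show (Qm a b c : ℤ) = (Tc a b c : ℤ)
      rw [Tc_kron (ha.trans hc.symm) (hb.trans hc.symm)]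
    rw [h3, ← h2]
    positivity
  · symm
    by_contra hne
    obtain ⟨a, ha, hne⟩ := JJ_ne hne
    obtain ⟨b, hb, hne⟩ := JJ_ne hne
    obtain ⟨c, hc, hne⟩ := JJ_ne hne
    have := Qm_ne (Nat.cast_ne_zero.1 hne)
    rw [vsize hl] at ha
    rw [vsize hm] at hb
    rw [vsize hp] at hc
    apply h
    constructor <;> zify <;> linarith [this.2.1, this.2.2]

theorem conv_KK (l m p : Fin N → ℤ) : JJ p (conv (KK l) (KK m)) =
    JJJ l m p (fun a b c => conv (fun x => (Pm a x : ℤ)) (fun x => (Pm b x : ℤ)) c) := by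
  have : conv (KK l) (KK m) = fun c => JJ l fun a => JJ m fun b => conv (fun x => (Pm a x : ℤ)) (fun x => (Pm b x : ℤ)) c := by
    funext c
    simp only [conv, JJ_sum', ← JJ_mul]
    rfl
  rw [this, JJ_comm, JJJ]
  refine JJ_congr fun a _ => ?_
  rw [JJ_comm]

theorem lr_eq (l m p : Partition') (hl : l.size ≤ N) (hm : m.size ≤ N) (hp : p.size ≤ N) :
    (lr l m p : ℤ) = JJ (vec N p) (conv (KK (vec N l)) (KK (vec N m))) := by
  rw [conv_KK, lr]
  split_ifs with h
  · have h1 : ∑ g : Equiv.Perm (Fin l.size), ∑ k : Equiv.Perm (Fin m.size), l.irrChar l.size g * m.irrChar m.size k *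
          p.irrChar (l.size + m.size) (sumEmb g k) =
        ((l.size.factorial : ℤ) * (m.size.factorial : ℤ)) * JJJ (vec N l) (vec N m) (vec N p) (fun a b c => conv (fun x => (Pm a x : ℤ)) (fun x => (Pm b x : ℤ)) c) := by
      simp only [irr_eq hl l le_rfl, irr_eq hm m le_rfl, irr_eq (h ▸ hp) p h.le]
      rw [Finset.sum_congr rfl fun g _ => Finset.sum_congr rfl fun k _ => JJJ_mul3 _ _ _ _ _ _,
        Finset.sum_congr rfl fun g _ => (JJJ_sum _ _ _ _ _).symm, ← JJJ_sum, ← JJJ_smul]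
      refine JJJ_congr fun a b c ha hb hc => ?_
      rw [vsize hl] at ha
      rw [vsize hm] at hb
      simp only [yc_sum, conv, Finset.mul_sum]
      rw [Finset.sum_congr rfl fun x _ => Finset.sum_comm, Finset.sum_comm]
      refine Finset.sum_congr rfl fun x _ => ?_
      rw [show ∀ p q r t : ℤ, p * q * (r * t) = (p * r) * (q * t) from fun p q r t => by ring, ← sum_yc2 a x ha, ← sum_yc2 b (c - x) hb, Finset.sum_mul_sum]
      refine Finset.sum_congr rfl fun g _ => Finset.sum_congr rfl fun k _ => ?_
      ring
    rw [h1, Int.mul_ediv_cancel_left _ (by positivity), Int.toNat_of_nonneg]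
    have h2 := dim_vec (N := N) l m p
    have h3 : JJJ (vec N l) (vec N m) (vec N p) (fun a b c => conv (fun x => (Pm a x : ℤ)) (fun x => (Pm b x : ℤ)) c) =
        JJJ (vec N l) (vec N m) (vec N p) (fun a b c => (Tc a b c : ℤ)) := by
      refine JJ_congr fun a ha => JJ_congr fun b hb => JJ_congr fun c hc => ?_
      rw [vsize hl] at ha
      rw [vsize hm] at hb
      rw [vsize hp] at hc
      show conv (fun x => (Pm a x : ℤ)) (fun x => (Pm b x : ℤ)) c = (Tc a b c : ℤ)
      rw [Tc_lr]
      rw [ha, hb, hc, h]; push_cast; rfl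
    rw [h3, ← h2]
    positivity
  · symm
    by_contra hne
    obtain ⟨a, ha, hne⟩ := JJ_ne hne
    obtain ⟨b, hb, hne⟩ := JJ_ne hne
    obtain ⟨c, hc, hne⟩ := JJ_ne hne
    obtain ⟨x, _, hne⟩ := Finset.exists_ne_zero_of_sum_ne_zero hne
    have t1 := Pm_total (Nat.cast_ne_zero.1 (left_ne_zero_of_mul hne))
    have t2 := Pm_total (Nat.cast_ne_zero.1 (right_ne_zero_of_mul hne))
    rw [vsize hl] at ha
    rw [vsize hm] at hb
    rw [vsize hp] at hc
    have d : ∑ i, (c - x) i = ∑ i, c i - ∑ i, x i := by simp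
    apply h
    zify
    linarith

theorem conv_symm {f g : (Fin N → ℤ) → ℤ} (hf : Symm f) (hg : Symm g) : Symm (conv f g) := by
  intro c σ
  symm
  refine Finset.sum_bij (fun x _ => x ∘ σ) ?_ ?_ ?_ ?_
  · intro x hx
    rw [Finset.mem_Icc] at hx ⊢
    exact ⟨fun i => hx.1 (σ i), fun i => hx.2 (σ i)⟩
  · intro x _ y _ h
    funext i
    have := congrFun h (σ.symm i)
    simpa using this
  · intro x hx
    rw [Finset.mem_Icc] at hx
    refine ⟨x ∘ σ.symm, ?_, ?_⟩
    · rw [Finset.mem_Icc]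
      refine ⟨fun i => hx.1 _, fun i => ?_⟩
      have := hx.2 (σ.symm i)
      simpa using this
    · funext i; simp
  · intro x _
    rw [hf x σ, ← hg (c - x) σ]
    rfl

theorem conv_ne {f g : (Fin N → ℤ) → ℤ} {c : Fin N → ℤ} (h : conv f g c ≠ 0) : ∃ x, 0 ≤ x ∧ x ≤ c ∧ f x ≠ 0 ∧ g (c - x) ≠ 0 := by
  obtain ⟨x, hx, hne⟩ := Finset.exists_ne_zero_of_sum_ne_zero h
  rw [Finset.mem_Icc] at hx
  exact ⟨x, hx.1, hx.2, left_ne_zero_of_mul hne, right_ne_zero_of_mul hne⟩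

theorem Qm_symm1 (a b c : Fin N → ℤ) (σ : Equiv.Perm (Fin N)) : Qm (a ∘ σ) b c = Qm a b c := by
  symm
  refine Set.ncard_congr (fun m _ i j k => m (σ i) j k) ?_ ?_ ?_
  · intro m hm
    refine ⟨fun i => hm.1 (σ i), fun j => ?_, fun k => ?_⟩
    · rw [← hm.2.1 j]; exact Equiv.sum_comp σ (fun i => ∑ k, (m i j k : ℤ))
    · rw [← hm.2.2 k]; exact Equiv.sum_comp σ (fun i => ∑ j, (m i j k : ℤ))
  · intro m m' _ _ h; funext i j k
    have := congrFun (congrFun (congrFun h (σ.symm i)) j) k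
    simpa using this
  · intro m hm
    refine ⟨fun i j k => m (σ.symm i) j k, ⟨fun i => ?_, fun j => ?_, fun k => ?_⟩, ?_⟩
    · rw [hm.1]; simp
    · rw [← hm.2.1 j]; exact Equiv.sum_comp σ.symm (fun i => ∑ k, (m i j k : ℤ))
    · rw [← hm.2.2 k]; exact Equiv.sum_comp σ.symm (fun i => ∑ j, (m i j k : ℤ))
    · simp

theorem Qm_swap (a b c : Fin N → ℤ) : Qm a b c = Qm b a c := by
  refine Set.ncard_congr (fun m _ i j k => m j i k) ?_ ?_ ?_
  · intro m hm
    refine ⟨hm.2.1, hm.1, fun k => ?_⟩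
    rw [← hm.2.2 k]; exact Finset.sum_comm
  · intro m m' _ _ h; funext i j k; exact congrFun (congrFun (congrFun h j) i) k
  · intro m hm
    refine ⟨fun i j k => m j i k, ⟨hm.2.1, hm.1, fun k => ?_⟩, rfl⟩
    rw [← hm.2.2 k]; exact Finset.sum_comm

theorem Qm_swap' (a b c : Fin N → ℤ) : Qm a b c = Qm c b a := by
  refine Set.ncard_congr (fun m _ i j k => m k j i) ?_ ?_ ?_
  · intro m hm
    refine ⟨fun i => ?_, fun j => ?_, fun k => ?_⟩
    · rw [← hm.2.2 i]; exact Finset.sum_comm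
    · rw [← hm.2.1 j]; exact Finset.sum_comm
    · rw [← hm.1 k]; exact Finset.sum_comm
  · intro m m' _ _ h; funext i j k; exact congrFun (congrFun (congrFun h k) j) i
  · intro m hm
    refine ⟨fun i j k => m k j i, ⟨fun i => ?_, fun j => ?_, fun k => ?_⟩, rfl⟩
    · rw [← hm.2.2 i]; exact Finset.sum_comm
    · rw [← hm.2.1 j]; exact Finset.sum_comm
    · rw [← hm.1 k]; exact Finset.sum_comm

theorem Qm_symm2 (a b c : Fin N → ℤ) (σ : Equiv.Perm (Fin N)) : Qm a (b ∘ σ) c = Qm a b c := by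
  rw [Qm_swap, Qm_symm1, Qm_swap]

theorem Qm_symm3 (a b c : Fin N → ℤ) (σ : Equiv.Perm (Fin N)) : Qm a b (c ∘ σ) = Qm a b c := by
  rw [Qm_swap', Qm_symm1, Qm_swap']

theorem comp_Pm {M : ℕ} (hM : M ≤ N) (x u : Fin N → ℤ) (hu : ∑ i, u i ≤ M) :
    ∑ p ∈ PS M, KK (vec N p) x * KK (vec N p) u = Pm x u := by
  refine completeness hM (fun a => (Pm a u : ℤ)) ?_ ?_ ?_ x
  · intro a σ; simp only [Pm_symm]
  · intro a ha; exact (Pm_neg (Nat.cast_ne_zero.1 ha)).1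
  · intro a ha; rw [Pm_total (Nat.cast_ne_zero.1 ha)]; exact hu

theorem comp_Qm {M : ℕ} (hM : M ≤ N) (a b c : Fin N → ℤ) (hb : ∑ i, b i ≤ M) :
    ∑ β ∈ PS M, ∑ δ ∈ PS M, ∑ η ∈ PS M, KK (vec N β) a * KK (vec N η) b * KK (vec N δ) c *
      JJJ (vec N β) (vec N η) (vec N δ) (fun a b c => (Qm a b c : ℤ)) = Qm a b c := by
  have hv : ∀ p ∈ PS M, ∑ i, vec N p i ≤ M := by
    intro p hp
    have := mem_PS.1 hp
    rw [vsize (this.trans hM)]; exact_mod_cast this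
  have s1 : ∀ β ∈ PS M, ∀ δ ∈ PS M, ∑ η ∈ PS M, KK (vec N β) a * KK (vec N η) b * KK (vec N δ) c *
      JJJ (vec N β) (vec N η) (vec N δ) (fun a b c => (Qm a b c : ℤ)) = KK (vec N β) a * (KK (vec N δ) c *
        JJ (vec N δ) (fun c => JJ (vec N β) fun a => (Qm a b c : ℤ))) := by
    intro β hβ δ hδ
    have := completeness hM (fun b => JJ (vec N β) fun a => JJ (vec N δ) fun c => (Qm a b c : ℤ)) ?_ ?_ ?_ b
    · rw [JJ_comm, ← this, Finset.mul_sum, Finset.mul_sum]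
      refine Finset.sum_congr rfl fun η _ => ?_
      rw [JJJ, JJ_comm]
      ring
    · intro b σ; simp only [Qm_symm2]
    · intro b h
      obtain ⟨a, ha, h⟩ := JJ_ne h
      obtain ⟨c, hc, h⟩ := JJ_ne h
      exact (Qm_ne (Nat.cast_ne_zero.1 h)).1.2.1
    · intro b h
      obtain ⟨a, ha, h⟩ := JJ_ne h
      obtain ⟨c, hc, h⟩ := JJ_ne h
      rw [(Qm_ne (Nat.cast_ne_zero.1 h)).2.2, hc]
      exact hv δ hδ
  have s2 : ∀ β ∈ PS M, ∑ δ ∈ PS M, KK (vec N β) a * (KK (vec N δ) c *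
        JJ (vec N δ) (fun c => JJ (vec N β) fun a => (Qm a b c : ℤ))) = KK (vec N β) a *
        JJ (vec N β) (fun a => (Qm a b c : ℤ)) := by
    intro β hβ
    rw [← Finset.mul_sum, completeness hM (fun c => JJ (vec N β) fun a => (Qm a b c : ℤ))]
    · intro b σ; simp only [Qm_symm3]
    · intro b h
      obtain ⟨a, ha, h⟩ := JJ_ne h
      exact (Qm_ne (Nat.cast_ne_zero.1 h)).1.2.2
    · intro c h
      obtain ⟨a, ha, h⟩ := JJ_ne h
      have := Qm_ne (Nat.cast_ne_zero.1 h)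
      rw [← this.2.2, ← this.2.1, ha]
      exact hv β hβ
  rw [Finset.sum_congr rfl fun β hβ => (Finset.sum_congr rfl fun δ hδ => s1 β hβ δ hδ).trans (s2 β hβ)]
  refine completeness hM (fun a => (Qm a b c : ℤ)) ?_ ?_ ?_ a
  · intro b σ; simp only [Qm_symm1]
  · intro b h
    exact (Qm_ne (Nat.cast_ne_zero.1 h)).1.1
  · intro c h
    have := Qm_ne (Nat.cast_ne_zero.1 h)
    rw [this.2.1]; exact hb

end A6
end AK


open scoped BigOperators
open scoped Classical
set_option linter.unusedSectionVars false
set_option linter.unusedVariables false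

namespace AK

section A7
variable {N n : ℕ}
open Partition'

theorem move5 {A B : Type*} (S : Finset A) (W : Finset B) (F : B → A → A → A → A → A → ℤ) :
    ∑ w ∈ W, ∑ α ∈ S, ∑ β ∈ S, ∑ δ ∈ S, ∑ η ∈ S, ∑ ρ ∈ S, F w α β δ η ρ =
    ∑ α ∈ S, ∑ β ∈ S, ∑ δ ∈ S, ∑ η ∈ S, ∑ ρ ∈ S, ∑ w ∈ W, F w α β δ η ρ := by
  rw [Finset.sum_comm]
  refine Finset.sum_congr rfl fun α _ => ?_
  rw [Finset.sum_comm]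
  refine Finset.sum_congr rfl fun β _ => ?_
  rw [Finset.sum_comm]
  refine Finset.sum_congr rfl fun δ _ => ?_
  rw [Finset.sum_comm]
  refine Finset.sum_congr rfl fun η _ => ?_
  rw [Finset.sum_comm]

theorem alg5 {A B : Type*} (S : Finset A) (X Y Z : Finset B) (U : B → Finset B) (p q v r s w : A → B → ℤ)
    (t : A → B → B → ℤ) (G : A → A → A → ℤ) :
    ∑ x ∈ X, ∑ y ∈ Y, ∑ z ∈ Z, ∑ u ∈ U z, (∑ α ∈ S, p α x * q α u) * (∑ ρ ∈ S, r ρ y * s ρ z) *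
      (∑ β ∈ S, ∑ δ ∈ S, ∑ η ∈ S, v β x * w η y * t δ z u * G β η δ) =
    ∑ α ∈ S, ∑ β ∈ S, ∑ δ ∈ S, ∑ η ∈ S, ∑ ρ ∈ S, G β η δ * ((∑ x ∈ X, p α x * v β x) * (∑ y ∈ Y, w η y * r ρ y) *
      (∑ z ∈ Z, (∑ u ∈ U z, q α u * t δ z u) * s ρ z)) := by
  have h1 : ∀ x y z u, (∑ α ∈ S, p α x * q α u) * (∑ ρ ∈ S, r ρ y * s ρ z) *
      (∑ β ∈ S, ∑ δ ∈ S, ∑ η ∈ S, v β x * w η y * t δ z u * G β η δ) =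
      ∑ α ∈ S, ∑ β ∈ S, ∑ δ ∈ S, ∑ η ∈ S, ∑ ρ ∈ S, (p α x * q α u) * (r ρ y * s ρ z) * (v β x * w η y * t δ z u * G β η δ) := by
    intro x y z u
    rw [Finset.sum_mul, Finset.sum_mul]
    refine Finset.sum_congr rfl fun α _ => ?_
    rw [Finset.mul_sum]
    refine Finset.sum_congr rfl fun β _ => ?_
    rw [Finset.mul_sum]
    refine Finset.sum_congr rfl fun δ _ => ?_
    rw [Finset.mul_sum]
    refine Finset.sum_congr rfl fun η _ => ?_
    rw [Finset.mul_sum, Finset.sum_mul]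
  simp only [h1]
  simp only [move5]
  refine Finset.sum_congr rfl fun α _ => Finset.sum_congr rfl fun β _ => Finset.sum_congr rfl fun δ _ =>
    Finset.sum_congr rfl fun η _ => Finset.sum_congr rfl fun ρ _ => ?_
  rw [mul_assoc, Finset.sum_mul, Finset.mul_sum]
  refine Finset.sum_congr rfl fun x _ => ?_
  rw [Finset.sum_mul, Finset.mul_sum, Finset.mul_sum]
  refine Finset.sum_congr rfl fun y _ => ?_
  rw [Finset.mul_sum, Finset.mul_sum, Finset.mul_sum]
  refine Finset.sum_congr rfl fun z _ => ?_
  rw [Finset.sum_mul, Finset.mul_sum, Finset.mul_sum, Finset.mul_sum]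
  refine Finset.sum_congr rfl fun u _ => ?_
  ring

theorem fs1 {P : Type*} {f : P → ℕ} (S : Finset P) (h : ∀ x, f x ≠ 0 → x ∈ S) : ∑ᶠ x, f x = ∑ x ∈ S, f x :=
  finsum_eq_sum_of_support_subset f fun x hx => h x hx

theorem fs6 {P : Type*} (S T : Finset P) (F : P → P → P → P → P → P → ℕ)
    (h : ∀ α β δ η ρ τ, F α β δ η ρ τ ≠ 0 → α ∈ S ∧ β ∈ S ∧ δ ∈ S ∧ η ∈ S ∧ ρ ∈ S ∧ τ ∈ T) :
    ∑ᶠ (α : P) (β : P) (δ : P) (η : P) (ρ : P) (τ : P), F α β δ η ρ τ =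
    ∑ α ∈ S, ∑ β ∈ S, ∑ δ ∈ S, ∑ η ∈ S, ∑ ρ ∈ S, ∑ τ ∈ T, F α β δ η ρ τ := by
  have e6 : ∀ α β δ η ρ, ∑ᶠ τ : P, F α β δ η ρ τ = ∑ τ ∈ T, F α β δ η ρ τ := fun α β δ η ρ =>
    fs1 T fun τ hne => (h _ _ _ _ _ _ hne).2.2.2.2.2
  simp only [e6]
  have e5 : ∀ α β δ η, ∑ᶠ ρ : P, ∑ τ ∈ T, F α β δ η ρ τ = ∑ ρ ∈ S, ∑ τ ∈ T, F α β δ η ρ τ := fun α β δ η =>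
    fs1 S fun ρ hne => by
      obtain ⟨τ, _, hne⟩ := Finset.exists_ne_zero_of_sum_ne_zero hne
      exact (h _ _ _ _ _ _ hne).2.2.2.2.1
  simp only [e5]
  have e4 : ∀ α β δ, ∑ᶠ η : P, ∑ ρ ∈ S, ∑ τ ∈ T, F α β δ η ρ τ = ∑ η ∈ S, ∑ ρ ∈ S, ∑ τ ∈ T, F α β δ η ρ τ := fun α β δ =>
    fs1 S fun η hne => by
      obtain ⟨ρ, _, hne⟩ := Finset.exists_ne_zero_of_sum_ne_zero hne
      obtain ⟨τ, _, hne⟩ := Finset.exists_ne_zero_of_sum_ne_zero hne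
      exact (h _ _ _ _ _ _ hne).2.2.2.1
  simp only [e4]
  have e3 : ∀ α β, ∑ᶠ δ : P, ∑ η ∈ S, ∑ ρ ∈ S, ∑ τ ∈ T, F α β δ η ρ τ = ∑ δ ∈ S, ∑ η ∈ S, ∑ ρ ∈ S, ∑ τ ∈ T, F α β δ η ρ τ := fun α β =>
    fs1 S fun δ hne => by
      obtain ⟨η, _, hne⟩ := Finset.exists_ne_zero_of_sum_ne_zero hne
      obtain ⟨ρ, _, hne⟩ := Finset.exists_ne_zero_of_sum_ne_zero hne
      obtain ⟨τ, _, hne⟩ := Finset.exists_ne_zero_of_sum_ne_zero hne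
      exact (h _ _ _ _ _ _ hne).2.2.1
  simp only [e3]
  have e2 : ∀ α, ∑ᶠ β : P, ∑ δ ∈ S, ∑ η ∈ S, ∑ ρ ∈ S, ∑ τ ∈ T, F α β δ η ρ τ = ∑ β ∈ S, ∑ δ ∈ S, ∑ η ∈ S, ∑ ρ ∈ S, ∑ τ ∈ T, F α β δ η ρ τ := fun α =>
    fs1 S fun β hne => by
      obtain ⟨δ, _, hne⟩ := Finset.exists_ne_zero_of_sum_ne_zero hne
      obtain ⟨η, _, hne⟩ := Finset.exists_ne_zero_of_sum_ne_zero hne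
      obtain ⟨ρ, _, hne⟩ := Finset.exists_ne_zero_of_sum_ne_zero hne
      obtain ⟨τ, _, hne⟩ := Finset.exists_ne_zero_of_sum_ne_zero hne
      exact (h _ _ _ _ _ _ hne).2.1
  simp only [e2]
  refine fs1 S fun α hne => ?_
  obtain ⟨β, _, hne⟩ := Finset.exists_ne_zero_of_sum_ne_zero hne
  obtain ⟨δ, _, hne⟩ := Finset.exists_ne_zero_of_sum_ne_zero hne
  obtain ⟨η, _, hne⟩ := Finset.exists_ne_zero_of_sum_ne_zero hne
  obtain ⟨ρ, _, hne⟩ := Finset.exists_ne_zero_of_sum_ne_zero hne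
  obtain ⟨τ, _, hne⟩ := Finset.exists_ne_zero_of_sum_ne_zero hne
  exact (h _ _ _ _ _ _ hne).1

theorem lr_ne {l m p : Partition'} (h : lr l m p ≠ 0) : p.size = l.size + m.size := by
  by_contra hc
  rw [lr, if_neg hc] at h
  exact h rfl

theorem kron_ne {l m p : Partition'} (h : kron l m p ≠ 0) : l.size = p.size ∧ m.size = p.size := by
  by_contra hc
  rw [kron, if_neg hc] at h
  exact h rfl

theorem tau_sum {M : ℕ} (hM : 2 * M ≤ N) {α δ : Partition'} (hα : α.size ≤ M) (hδ : δ.size ≤ M) (ν r : Fin N → ℤ) :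
    ∑ τ ∈ PS (2 * M), JJ (vec N τ) (conv (KK (vec N α)) (KK (vec N δ))) * JJ ν (conv (KK (vec N τ)) (KK r)) =
    JJ ν (conv (conv (KK (vec N α)) (KK (vec N δ))) (KK r)) := by
  simp only [← JJ_smul]
  rw [← JJ_sum']
  refine JJ_congr fun c _ => ?_
  show ∑ τ ∈ PS (2 * M), JJ (vec N τ) (conv (KK (vec N α)) (KK (vec N δ))) * conv (KK (vec N τ)) (KK r) c = _
  rw [conv]
  simp only [conv, Finset.mul_sum]
  rw [Finset.sum_comm]
  refine Finset.sum_congr rfl fun x _ => ?_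
  have := completeness hM (conv (KK (vec N α)) (KK (vec N δ))) (conv_symm (KK_symm _) (KK_symm _)) ?_ ?_ x
  · change _ = conv (KK (vec N α)) (KK (vec N δ)) x * _
    rw [← this, Finset.sum_mul]
    refine Finset.sum_congr rfl fun τ _ => ?_
    rw [← mul_assoc, mul_comm (JJ _ _)]
  · intro a ha
    obtain ⟨x, h0, h1, _⟩ := conv_ne ha
    exact fun i => (h0.trans h1) i
  · intro a ha
    obtain ⟨x, h0, h1, k1, k2⟩ := conv_ne ha
    have t1 := (KK_ne k1).2
    have t2 := (KK_ne k2).2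
    rw [vsize (by omega)] at t1 t2
    have : ∑ i, (a - x) i = ∑ i, a i - ∑ i, x i := by simp
    push_cast
    have : (α.size : ℤ) ≤ M := by exact_mod_cast hα
    have : (δ.size : ℤ) ≤ M := by exact_mod_cast hδ
    linarith

theorem aguiar_eq (l m p : Partition') (hN : 2 * (l.size + m.size + p.size) ≤ N) :
    (aguiar l m p : ℤ) = JJJ (vec N l) (vec N m) (vec N p) (fun a b c => (Tc a b c : ℤ)) := by
  set M := l.size + m.size + p.size with hM
  have hMN : M ≤ N := by omega
  rw [aguiar, fs6 (PS M) (PS (2 * M))]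
  swap
  · intro α β δ η ρ τ hne
    have h5 := lr_ne (right_ne_zero_of_mul hne)
    have hne := left_ne_zero_of_mul hne
    have h4 := lr_ne (right_ne_zero_of_mul hne)
    have hne := left_ne_zero_of_mul hne
    have h3 := kron_ne (right_ne_zero_of_mul hne)
    have hne := left_ne_zero_of_mul hne
    have h2 := lr_ne (right_ne_zero_of_mul hne)
    have h1 := lr_ne (left_ne_zero_of_mul hne)
    simp only [mem_PS]
    omega
  push_cast
  have h1 : ∀ α ∈ PS M, ∀ β ∈ PS M, ∀ δ ∈ PS M, ∀ η ∈ PS M, ∀ ρ ∈ PS M, ∑ τ ∈ PS (2 * M), (lr α β l : ℤ) * lr η ρ m * kron β η δ * lr α δ τ * lr τ ρ p =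
      JJJ (vec N l) (vec N m) (vec N p) (fun a b c => JJJ (vec N β) (vec N η) (vec N δ) (fun a b c => (Qm a b c : ℤ)) *
        (conv (KK (vec N α)) (KK (vec N β)) a * conv (KK (vec N η)) (KK (vec N ρ)) b *
        conv (conv (KK (vec N α)) (KK (vec N δ))) (KK (vec N ρ)) c)) := by
    intro α hα β hβ δ hδ η hη ρ hρ
    rw [mem_PS] at hα hβ hδ hη hρ
    rw [JJJ_smul, ← JJJ_mul3, ← tau_sum hN hα hδ, Finset.mul_sum, Finset.mul_sum]
    refine Finset.sum_congr rfl fun τ hτ => ?_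
    rw [mem_PS] at hτ
    rw [lr_eq (N := N) α β l (by omega) (by omega) (by omega), lr_eq (N := N) η ρ m (by omega) (by omega) (by omega),
      lr_eq (N := N) α δ τ (by omega) (by omega) (by omega), lr_eq (N := N) τ ρ p (by omega) (by omega) (by omega),
      kron_eq (N := N) β η δ (by omega) (by omega) (by omega)]
    ring
  rw [Finset.sum_congr rfl fun α hα => Finset.sum_congr rfl fun β hβ => Finset.sum_congr rfl fun δ hδ =>
    Finset.sum_congr rfl fun η hη => Finset.sum_congr rfl fun ρ hρ => h1 α hα β hβ δ hδ η hη ρ hρ]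
  simp only [← JJJ_sum]
  refine JJJ_congr fun a b c ha hb hc => ?_
  rw [vsize (by omega)] at ha hb hc
  simp only [conv]
  rw [← alg5, Tc_formula]
  refine Finset.sum_congr rfl fun x hx => Finset.sum_congr rfl fun y hy => Finset.sum_congr rfl fun z hz =>
    Finset.sum_congr rfl fun u hu => ?_
  rw [Finset.mem_Icc] at hx hy hz hu
  have e1 : ∑ i, u i ≤ ∑ i, z i := Finset.sum_le_sum fun i _ => hu.2 i
  have e2 : ∑ i, z i ≤ ∑ i, c i := Finset.sum_le_sum fun i _ => hz.2 i
  have e3 : ∑ i, y i ≤ ∑ i, b i := Finset.sum_le_sum fun i _ => hy.2 i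
  have e4 : ∑ i, (c - z) i ≤ ∑ i, c i := Finset.sum_le_sum fun i _ => by
    have := hz.1 i
    simp only [Pi.zero_apply] at this
    simp only [Pi.sub_apply]; linarith
  have f1 : (m.size : ℤ) ≤ M := by push_cast [hM]; linarith [l.size.zero_le, p.size.zero_le]
  have f2 : (p.size : ℤ) ≤ M := by push_cast [hM]; linarith [l.size.zero_le, m.size.zero_le]
  rw [comp_Pm hMN _ _ (by linarith), comp_Pm hMN _ _ (by linarith), comp_Qm hMN _ _ _ (by linarith)]

end A7
end AK


open scoped BigOperators
open scoped Classical
set_option linter.unusedSectionVars false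
set_option linter.unusedVariables false

namespace AK

section A8
variable {N n : ℕ}
open Partition'

theorem sumext (hn : n ≤ N) (f : Fin N → ℤ) (hf : ∀ i : Fin N, n ≤ (i : ℕ) → f i = 0) :
    ∑ i, f i = ∑ i : Fin n, f (Fin.castLE hn i) := by
  symm
  refine Fintype.sum_of_injective (Fin.castLE hn) (Fin.castLE_injective hn) _ _ ?_ ?_
  · intro i hi
    refine hf i ?_
    by_contra hc
    exact hi ⟨⟨i, by omega⟩, rfl⟩
  · intro i; rfl

theorem extz_cast (hn : n ≤ N) (a : Fin n → ℤ) (i : Fin n) : extz N a (Fin.castLE hn i) = a i := by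
  simp [extz]

theorem extz_ge (a : Fin n → ℤ) (i : Fin N) (h : n ≤ (i : ℕ)) : extz N a i = 0 := by
  rw [extz, dif_neg (by omega)]

theorem TS_zero {a b c : Fin N → ℤ} {m : M2 N × M2 N × M3 N} (hm : m ∈ TS a b c) :
    (∀ i, a i = 0 → (∀ k, m.1 i k = 0) ∧ ∀ j k, m.2.2 i j k = 0) ∧
    (∀ j, b j = 0 → (∀ k, m.2.1 j k = 0) ∧ ∀ i k, m.2.2 i j k = 0) ∧
    (∀ k, c k = 0 → (∀ i, m.1 i k = 0) ∧ (∀ j, m.2.1 j k = 0) ∧ ∀ i j, m.2.2 i j k = 0) := by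
  have z1 : ∀ f : Fin N → ℕ, (∑ k, (f k : ℤ)) = 0 → ∀ k, f k = 0 := by
    intro f h k
    have := (Finset.sum_eq_zero_iff_of_nonneg (fun j _ => by positivity)).1 h k (Finset.mem_univ _)
    exact_mod_cast this
  have z2 : ∀ f : Fin N → Fin N → ℕ, (∑ j, ∑ k, (f j k : ℤ)) = 0 → ∀ j k, f j k = 0 := by
    intro f h j
    have := (Finset.sum_eq_zero_iff_of_nonneg (fun j _ => by positivity)).1 h j (Finset.mem_univ _)
    exact z1 _ this
  have n1 : ∀ f : Fin N → ℕ, 0 ≤ (∑ k, (f k : ℤ)) := fun f => by positivity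
  have n2 : ∀ f : Fin N → Fin N → ℕ, 0 ≤ (∑ j, ∑ k, (f j k : ℤ)) := fun f => by positivity
  refine ⟨fun i hi => ?_, fun j hj => ?_, fun k hk => ?_⟩
  · have := hm.1 i
    rw [hi] at this
    have p1 := n1 (fun k => m.1 i k)
    have p2 := n2 (fun j k => m.2.2 i j k)
    exact ⟨z1 _ (by linarith), z2 _ (by linarith)⟩
  · have := hm.2.1 j
    rw [hj] at this
    have p1 := n1 (fun k => m.2.1 j k)
    have p2 := n2 (fun i k => m.2.2 i j k)
    exact ⟨z1 _ (by linarith), z2 (fun i k => m.2.2 i j k) (by linarith)⟩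
  · have := hm.2.2 k
    rw [hk] at this
    have p1 := n1 (fun i => m.1 i k)
    have p2 := n1 (fun j => m.2.1 j k)
    have p3 := n2 (fun i j => m.2.2 i j k)
    exact ⟨z1 (fun i => m.1 i k) (by linarith), z1 (fun j => m.2.1 j k) (by linarith), z2 (fun i j => m.2.2 i j k) (by linarith)⟩

theorem Tc_ext (hn : n ≤ N) (a b c : Fin n → ℤ) : Tc (extz N a) (extz N b) (extz N c) = Tc a b c := by
  refine Set.ncard_congr (fun m _ => (fun i k => m.1 (Fin.castLE hn i) (Fin.castLE hn k),
    fun j k => m.2.1 (Fin.castLE hn j) (Fin.castLE hn k),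
    fun i j k => m.2.2 (Fin.castLE hn i) (Fin.castLE hn j) (Fin.castLE hn k))) ?_ ?_ ?_
  · intro m hm
    obtain ⟨h1, h2, h3⟩ := TS_zero hm
    refine ⟨fun i => ?_, fun j => ?_, fun k => ?_⟩
    · have := hm.1 (Fin.castLE hn i)
      rw [extz_cast, sumext hn _ (fun k hk => by rw [(h3 k (extz_ge c k hk)).1]; rfl),
        sumext hn _ (fun j hj => by simp [(h2 j (extz_ge b j hj)).2])] at this
      rw [← this]
      congr 1
      refine Finset.sum_congr rfl fun j _ => ?_
      rw [sumext hn _ (fun k hk => by rw [(h3 k (extz_ge c k hk)).2.2]; rfl)]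
    · have := hm.2.1 (Fin.castLE hn j)
      rw [extz_cast, sumext hn _ (fun k hk => by rw [(h3 k (extz_ge c k hk)).2.1]; rfl),
        sumext hn _ (fun j hj => by simp [(h1 j (extz_ge a j hj)).2])] at this
      rw [← this]
      congr 1
      refine Finset.sum_congr rfl fun j _ => ?_
      rw [sumext hn _ (fun k hk => by rw [(h3 k (extz_ge c k hk)).2.2]; rfl)]
    · have := hm.2.2 (Fin.castLE hn k)
      rw [extz_cast, sumext hn _ (fun i hi => by rw [(h1 i (extz_ge a i hi)).1]; rfl),
        sumext hn (fun j => (m.2.1 j (Fin.castLE hn k) : ℤ)) (fun j hj => by simp [(h2 j (extz_ge b j hj)).1]),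
        sumext hn (fun i => ∑ j, (m.2.2 i j (Fin.castLE hn k) : ℤ)) (fun j hj => by simp [(h1 j (extz_ge a j hj)).2])] at this
      rw [← this]
      congr 1
      refine Finset.sum_congr rfl fun j _ => ?_
      rw [sumext hn _ (fun k hk => by rw [(h2 k (extz_ge b k hk)).2]; rfl)]
  · intro m m' hm hm' h
    obtain ⟨h1, h2, h3⟩ := TS_zero hm
    obtain ⟨h1', h2', h3'⟩ := TS_zero hm'
    rw [Prod.mk.injEq, Prod.mk.injEq] at h
    obtain ⟨q1, q2, q3⟩ := h
    refine Prod.ext ?_ (Prod.ext ?_ ?_)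
    · funext i k
      by_cases hi : (i : ℕ) < n
      · by_cases hk : (k : ℕ) < n
        · exact congrFun (congrFun q1 ⟨i, hi⟩) ⟨k, hk⟩
        · rw [(h3 k (extz_ge c k (by omega))).1, (h3' k (extz_ge c k (by omega))).1]
      · rw [(h1 i (extz_ge a i (by omega))).1, (h1' i (extz_ge a i (by omega))).1]
    · funext i k
      by_cases hi : (i : ℕ) < n
      · by_cases hk : (k : ℕ) < n
        · exact congrFun (congrFun q2 ⟨i, hi⟩) ⟨k, hk⟩
        · rw [(h3 k (extz_ge c k (by omega))).2.1, (h3' k (extz_ge c k (by omega))).2.1]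
      · rw [(h2 i (extz_ge b i (by omega))).1, (h2' i (extz_ge b i (by omega))).1]
    · funext i j k
      by_cases hi : (i : ℕ) < n
      · by_cases hk : (k : ℕ) < n
        · by_cases hj : (j : ℕ) < n
          · exact congrFun (congrFun (congrFun q3 ⟨i, hi⟩) ⟨j, hj⟩) ⟨k, hk⟩
          · rw [(h2 j (extz_ge b j (by omega))).2, (h2' j (extz_ge b j (by omega))).2]
        · rw [(h3 k (extz_ge c k (by omega))).2.2, (h3' k (extz_ge c k (by omega))).2.2]
      · rw [(h1 i (extz_ge a i (by omega))).2, (h1' i (extz_ge a i (by omega))).2]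
  · intro m hm
    refine ⟨(fun i k => if h : (i : ℕ) < n ∧ (k : ℕ) < n then m.1 ⟨i, h.1⟩ ⟨k, h.2⟩ else 0,
      fun i k => if h : (i : ℕ) < n ∧ (k : ℕ) < n then m.2.1 ⟨i, h.1⟩ ⟨k, h.2⟩ else 0,
      fun i j k => if h : (i : ℕ) < n ∧ (j : ℕ) < n ∧ (k : ℕ) < n then m.2.2 ⟨i, h.1⟩ ⟨j, h.2.1⟩ ⟨k, h.2.2⟩ else 0),
      ⟨fun i => ?_, fun j => ?_, fun k => ?_⟩, ?_⟩
    · by_cases hi : (i : ℕ) < n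
      · rw [extz, dif_pos hi, ← hm.1 ⟨i, hi⟩]
        congr 1
        · rw [sumext hn _ fun k hk => by dsimp only; rw [dif_neg (by omega)]; rfl]
          refine Finset.sum_congr rfl fun k _ => ?_
          dsimp only; rw [dif_pos ⟨hi, k.2⟩]; rfl
        · rw [sumext hn _ fun j hj => Finset.sum_eq_zero fun k _ => by dsimp only; rw [dif_neg (by omega)]; rfl]
          refine Finset.sum_congr rfl fun j _ => ?_
          rw [sumext hn _ fun k hk => by dsimp only; rw [dif_neg (by omega)]; rfl]
          refine Finset.sum_congr rfl fun k _ => ?_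
          dsimp only; rw [dif_pos ⟨hi, j.2, k.2⟩]; rfl
      · rw [extz_ge a i (by omega)]
        simp [hi]
    · by_cases hj : (j : ℕ) < n
      · rw [extz, dif_pos hj, ← hm.2.1 ⟨j, hj⟩]
        congr 1
        · rw [sumext hn _ fun k hk => by dsimp only; rw [dif_neg (by omega)]; rfl]
          refine Finset.sum_congr rfl fun k _ => ?_
          dsimp only; rw [dif_pos ⟨hj, k.2⟩]; rfl
        · rw [sumext hn _ fun i hi => Finset.sum_eq_zero fun k _ => by dsimp only; rw [dif_neg (by omega)]; rfl]
          refine Finset.sum_congr rfl fun i _ => ?_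
          rw [sumext hn _ fun k hk => by dsimp only; rw [dif_neg (by omega)]; rfl]
          refine Finset.sum_congr rfl fun k _ => ?_
          dsimp only; rw [dif_pos ⟨i.2, hj, k.2⟩]; rfl
      · rw [extz_ge b j (by omega)]
        simp [hj]
    · by_cases hk : (k : ℕ) < n
      · rw [extz, dif_pos hk, ← hm.2.2 ⟨k, hk⟩]
        congr 1
        · congr 1
          · rw [sumext hn _ fun i hi => by dsimp only; rw [dif_neg (by omega)]; rfl]
            refine Finset.sum_congr rfl fun i _ => ?_
            dsimp only; rw [dif_pos ⟨i.2, hk⟩]; rfl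
          · rw [sumext hn _ fun i hi => by dsimp only; rw [dif_neg (by omega)]; rfl]
            refine Finset.sum_congr rfl fun i _ => ?_
            dsimp only; rw [dif_pos ⟨i.2, hk⟩]; rfl
        · rw [sumext hn _ fun i hi => Finset.sum_eq_zero fun j _ => by dsimp only; rw [dif_neg (by omega)]; rfl]
          refine Finset.sum_congr rfl fun i _ => ?_
          rw [sumext hn _ fun j hj => by dsimp only; rw [dif_neg (by omega)]; rfl]
          refine Finset.sum_congr rfl fun j _ => ?_
          dsimp only; rw [dif_pos ⟨i.2, j.2, hk⟩]; rfl
      · rw [extz_ge c k (by omega)]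
        simp [hk]
    · simp

theorem Tc_nn {a b c : Fin N → ℤ} (h : Tc a b c ≠ 0) : (∀ i, 0 ≤ a i) ∧ (∀ i, 0 ≤ b i) ∧ ∀ i, 0 ≤ c i := by
  obtain ⟨m, hm⟩ := Set.nonempty_of_ncard_ne_zero h
  refine ⟨fun i => ?_, fun i => ?_, fun i => ?_⟩
  · rw [← hm.1 i]; positivity
  · rw [← hm.2.1 i]; positivity
  · rw [← hm.2.2 i]; positivity

theorem JJJ_bridge (hn : n ≤ N) (l m p : Partition') (hl : ∀ k, n ≤ k → l.1 k = 0) (hm : ∀ k, n ≤ k → m.1 k = 0)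
    (hp : ∀ k, n ≤ k → p.1 k = 0) :
    JJJ (vec N l) (vec N m) (vec N p) (fun a b c => (Tc a b c : ℤ)) =
    JJJ (vec n l) (vec n m) (vec n p) (fun a b c => (Tc a b c : ℤ)) := by
  unfold JJJ
  rw [JJ_bridge hn (vec N l) (fun i hi => by simp [vec, hl i hi])]
  · refine JJ_congr fun a _ => ?_
    show JJ (vec N m) _ = JJ (vec n m) _
    rw [JJ_bridge hn (vec N m) (fun i hi => by simp [vec, hm i hi])]
    · refine JJ_congr fun b _ => ?_
      show JJ (vec N p) _ = JJ (vec n p) _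
      rw [JJ_bridge hn (vec N p) (fun i hi => by simp [vec, hp i hi])]
      · refine JJ_congr fun c _ => ?_
        show (Tc (extz N a) (extz N b) (extz N c) : ℤ) = Tc a b c
        rw [Tc_ext hn]
      · intro c h
        exact (Tc_nn (Nat.cast_ne_zero.1 h)).2.2
    · intro b h
      obtain ⟨c, _, h⟩ := JJ_ne h
      exact (Tc_nn (Nat.cast_ne_zero.1 h)).2.1
  · intro a h
    obtain ⟨b, _, h⟩ := JJ_ne h
    obtain ⟨c, _, h⟩ := JJ_ne h
    exact (Tc_nn (Nat.cast_ne_zero.1 h)).1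

/-- Aguiar coefficients as dimensions of spaces of highest weight vectors. -/
theorem aguiar_dim (l m p : Partition') (hl : ∀ k, n ≤ k → l.1 k = 0) (hm : ∀ k, n ≤ k → m.1 k = 0)
    (hp : ∀ k, n ≤ k → p.1 k = 0) :
    aguiar l m p = Module.finrank ℂ (hwv (act (tI n)) ⊤ ![vec n l, vec n m, vec n p]) := by
  have h := aguiar_eq (N := n + 2 * (l.size + m.size + p.size)) l m p (by omega)
  rw [JJJ_bridge (n := n) (by omega) l m p hl hm hp, ← dim_vec] at h
  exact_mod_cast h

theorem kron_dim (l m p : Partition') (hl : ∀ k, n ≤ k → l.1 k = 0) (hm : ∀ k, n ≤ k → m.1 k = 0)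
    (hp : ∀ k, n ≤ k → p.1 k = 0) (h1 : l.size = p.size) (h2 : m.size = p.size) :
    kron l m p = Module.finrank ℂ (hwv (act (tI n)) ⊤ ![vec n l, vec n m, vec n p]) := by
  have h := kron_eq (N := n + p.size) l m p (by omega) (by omega) (by omega)
  have h3 : JJJ (vec (n + p.size) l) (vec (n + p.size) m) (vec (n + p.size) p) (fun a b c => (Qm a b c : ℤ)) =
      JJJ (vec (n + p.size) l) (vec (n + p.size) m) (vec (n + p.size) p) (fun a b c => (Tc a b c : ℤ)) := by
    refine JJJ_congr fun a b c ha hb hc => ?_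
    rw [vsize (by omega)] at ha hb hc
    rw [h1] at ha
    rw [h2] at hb
    show (Qm a b c : ℤ) = (Tc a b c : ℤ)
    rw [Tc_kron (ha.trans hc.symm) (hb.trans hc.symm)]
  rw [h3, JJJ_bridge (n := n) (by omega) l m p hl hm hp, ← dim_vec] at h
  exact_mod_cast h

end A8
end AK


open scoped BigOperators
open scoped Classical
set_option linter.unusedSectionVars false
set_option linter.unusedVariables false

namespace AK

section C3
open MvPolynomial
variable {N : ℕ}

theorem wv_u_l (m : UV N →₀ ℕ) (s : Fin 3) (i : Fin N) :
    wv (uI N) m (Sum.inl s) i = ∑ j, (m (s, i, j) : ℤ) := by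
  unfold wv
  rw [Fintype.sum_prod_type, Finset.sum_eq_single s]
  · rw [Fintype.sum_prod_type, Finset.sum_eq_single i]
    · simp [uI, uidx]
    · intro a _ ha; simp [uI, uidx, ha]
    · simp
  · intro t _ ht; simp [uI, uidx, ht]
  · simp

theorem wv_u_r (m : UV N →₀ ℕ) (s : Fin 3) (j : Fin N) :
    wv (uI N) m (Sum.inr s) j = ∑ i, (m (s, i, j) : ℤ) := by
  unfold wv
  rw [Fintype.sum_prod_type, Finset.sum_eq_single s]
  · rw [Fintype.sum_prod_type]
    refine Finset.sum_congr rfl fun i _ => ?_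
    rw [Finset.sum_eq_single j]
    · simp [uI, uidx]
    · intro a _ ha; simp [uI, uidx, ha]
    · simp
  · intro t _ ht; simp [uI, uidx, ht]
  · simp

def PmP (a b : Fin N → ℤ) : (Fin N → Fin N → ℕ) → Prop :=
  fun m => (∀ i, ∑ j, (m i j : ℤ) = a i) ∧ ∀ j, ∑ i, (m i j : ℤ) = b j

theorem u_count (κ : Fin 3 ⊕ Fin 3 → Fin N → ℤ) :
    Set.ncard {m : UV N →₀ ℕ | wv (uI N) m = κ} = ∏ s, Pm (κ (Sum.inl s)) (κ (Sum.inr s)) := by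
  let E : (UV N →₀ ℕ) ≃ (Fin 3 → Fin N → Fin N → ℕ) :=
    Finsupp.equivFunOnFinite.trans ((Equiv.curry _ _ _).trans (Equiv.piCongrRight fun _ => Equiv.curry _ _ _))
  have hE : ∀ m s i j, E m s i j = m (s, i, j) := fun _ _ _ _ => rfl
  have h1 : ∀ m : UV N →₀ ℕ, wv (uI N) m = κ ↔ ∀ s, PmP (κ (Sum.inl s)) (κ (Sum.inr s)) (E m s) := by
    intro m
    constructor
    · intro h s
      subst h
      exact ⟨fun i => (wv_u_l m s i).symm, fun j => (wv_u_r m s j).symm⟩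
    · intro h
      funext s i
      rcases s with s | s
      · rw [wv_u_l]; exact (h s).1 i
      · rw [wv_u_r]; exact (h s).2 i
  have e1 : {m : UV N →₀ ℕ // wv (uI N) m = κ} ≃
      {m : Fin 3 → Fin N → Fin N → ℕ // ∀ s, PmP (κ (Sum.inl s)) (κ (Sum.inr s)) (m s)} :=
    E.subtypeEquiv h1
  have e2 := e1.trans (Equiv.subtypePiEquivPi
    (p := fun s (m : Fin N → Fin N → ℕ) => PmP (κ (Sum.inl s)) (κ (Sum.inr s)) m))
  rw [← Nat.card_coe_set_eq]
  refine (Nat.card_congr e2).trans ?_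
  rw [Nat.card_pi]
  refine Finset.prod_congr rfl fun s _ => ?_
  rw [Pm, ← Nat.card_coe_set_eq]
  rfl

theorem sum_equiv' {A B : Type} {_ : Fintype A} {_ : Fintype B} (E : A ≃ B) (f : A → ℤ) (g : B → ℤ)
    (h : ∀ x, f x = g (E x)) : ∑ x, f x = ∑ x, g x := Fintype.sum_equiv E f g h

theorem u_char (w κ : Fin 3 → Fin N → ℕ) (hw : ∀ s, Antitone (w s)) (hκ : ∀ s, Antitone (κ s)) :
    Module.finrank ℂ (hwv (act (uI N)) ⊤ (Sum.elim (fun s i => (w s i : ℤ)) (fun s i => (κ s i : ℤ)))) =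
      if w = κ then 1 else 0 := by
  have h := char_top (uI N) (uI_all N)
    (l := Sum.elim (fun s i => (w s i : ℤ)) (fun s i => (κ s i : ℤ)))
    (by rintro (s | s) i <;> simp) (by
      rintro (s | s) i j hij
      · simpa using hw s hij.le
      · simpa using hκ s hij.le)
  simp only [u_count] at h
  have h2 : (∏ s, JJ (fun i => (w s i : ℤ)) (fun a => JJ (fun i => (κ s i : ℤ)) fun b => (Pm a b : ℤ))) =
      if w = κ then 1 else 0 := by
    have : ∀ s, JJ (fun i => (w s i : ℤ)) (fun a => JJ (fun i => (κ s i : ℤ)) fun b => (Pm a b : ℤ)) =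
        if w s = κ s then 1 else 0 := by
      intro s
      rw [JJ_comm, ortho _ _ (hw s) (hκ s)]
    simp only [this]
    by_cases hwk : w = κ
    · subst hwk; simp
    · rw [if_neg hwk]
      obtain ⟨s, hs⟩ := Function.ne_iff.1 hwk
      exact Finset.prod_eq_zero (Finset.mem_univ s) (if_neg hs)
  have h3 : ((if w = κ then 1 else 0 : ℕ) : ℤ) = if w = κ then 1 else 0 := by split_ifs <;> rfl
  rw [← Nat.cast_inj (R := ℤ), h, h3, ← h2]
  have h4 : ∀ s, JJ (fun i => (w s i : ℤ)) (fun a => JJ (fun i => (κ s i : ℤ)) fun b => (Pm a b : ℤ)) =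
      ∑ x : Equiv.Perm (Fin N) × Equiv.Perm (Fin N), (Equiv.Perm.sign x.1 : ℤ) * ((Equiv.Perm.sign x.2 : ℤ) *
        (Pm (sh (fun i => (w s i : ℤ)) x.1) (sh (fun i => (κ s i : ℤ)) x.2) : ℤ)) := by
    intro s
    rw [Fintype.sum_prod_type]
    simp only [JJ, Finset.mul_sum]
  simp only [h4]
  rw [Finset.prod_univ_sum, Fintype.piFinset_univ]
  let E : (Fin 3 ⊕ Fin 3 → Equiv.Perm (Fin N)) ≃ (Fin 3 → Equiv.Perm (Fin N) × Equiv.Perm (Fin N)) :=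
    (Equiv.sumArrowEquivProdArrow _ _ _).trans (Equiv.arrowProdEquivProdArrow _ _ _).symm
  refine sum_equiv' E _ _ fun x => ?_
  have hE1 : ∀ s, (E x s).1 = x (Sum.inl s) := fun _ => rfl
  have hE2 : ∀ s, (E x s).2 = x (Sum.inr s) := fun _ => rfl
  simp only [hE1, hE2, sgnw, Finset.prod_mul_distrib, Fintype.prod_sum_type]
  push_cast
  rw [mul_assoc]
  rfl

end C3
end AK


open scoped BigOperators
open scoped Classical
set_option linter.unusedSectionVars false
set_option linter.unusedVariables false

namespace AK

section C4
open MvPolynomial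
variable {N : ℕ}

/-- restriction of an index structure to part of the group -/
def resI {ι κ : Type} {Y : Type} (I : Idx ι N Y) (f : κ → ι) (hf : Function.Injective f) : Idx κ N Y where
  idx s := I.idx (f s)
  rep s := I.rep (f s)
  a1 s := I.a1 (f s)
  a2 s t x i h := I.a2 _ _ x i (hf.ne h)
  a3 s := I.a3 _
  a4 s t x i j h := I.a4 _ _ x i j (hf.ne h)
  a5 s := I.a5 _

noncomputable def lI (N : ℕ) : Idx (Fin 3) N (UV N) := resI (uI N) Sum.inl Sum.inl_injective
noncomputable def rI (N : ℕ) : Idx (Fin 3) N (UV N) := resI (uI N) Sum.inr Sum.inr_injective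

theorem act_lI (s : Fin 3) (i j : Fin N) : act (lI N) s i j = act (uI N) (Sum.inl s) i j := rfl
theorem act_rI (s : Fin 3) (i j : Fin N) : act (rI N) s i j = act (uI N) (Sum.inr s) i j := rfl

theorem lI_all (x : UV N) : ∃ s i, (lI N).idx s x = some i := by
  obtain ⟨t, a, b⟩ := x
  exact ⟨t, a, by simp [lI, resI, uI, uidx]⟩

theorem rI_all (x : UV N) : ∃ s i, (rI N).idx s x = some i := by
  obtain ⟨t, a, b⟩ := x
  exact ⟨t, b, by simp [rI, resI, uI, uidx]⟩

noncomputable def LH (w : Fin 3 → Fin N → ℤ) : Submodule ℂ (AR N) := hwv (act (lI N)) ⊤ w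

theorem hwv_u (w κ : Fin 3 → Fin N → ℤ) (v : AR N) :
    v ∈ hwv (act (uI N)) ⊤ (Sum.elim w κ) ↔ v ∈ hwv (act (rI N)) (LH w) κ := by
  rw [LH, mem_hwv, mem_hwv, mem_hwv]
  constructor
  · intro h
    exact ⟨⟨trivial, fun s i => h.2.1 (Sum.inl s) i, fun s i j => h.2.2 (Sum.inl s) i j⟩,
      fun s i => h.2.1 (Sum.inr s) i, fun s i j => h.2.2 (Sum.inr s) i j⟩
  · intro h
    refine ⟨trivial, ?_, ?_⟩
    · rintro (s | s) i
      · exact h.1.2.1 s i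
      · exact h.2.1 s i
    · rintro (s | s) i j
      · exact h.1.2.2 s i j
      · exact h.2.2 s i j

theorem LH_st (w : Fin 3 → Fin N → ℤ) (s : Fin 3) (i j : Fin N) : ∀ v ∈ LH w, act (rI N) s i j v ∈ LH w := by
  intro v hv
  rw [LH, mem_hwv] at hv ⊢
  have hc : ∀ t k l, act (lI N) t k l (act (rI N) s i j v) = act (rI N) s i j (act (lI N) t k l v) := by
    intro t k l
    have := (act_rel (uI N)).diff (Sum.inl t) (Sum.inr s) (by simp) k l i j
    exact congrArg (fun f => f v) this
  refine ⟨trivial, fun t k => ?_, fun t k l hkl => ?_⟩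
  · rw [hc, hv.2.1 t k, map_smul]
  · rw [hc, hv.2.2 t k l hkl, map_zero]

theorem LH_good (w : Fin 3 → Fin N → ℤ) : Good (act (rI N)) (LH w) := by
  refine good_sub (Wd_good (rI N) (∑ s, ∑ i, w s i).toNat) ?_ (LH_st w)
  rw [LH, hwv_top_eq (lI N) lI_all (Int.self_le_toNat _)]
  exact fun v hv => (mem_hwv.1 hv).1

/-- fundamental weights -/
def om (x : Fin 3 × Fin N) : Fin 3 → Fin N → ℕ := fun t i => if t = x.1 ∧ i ≤ x.2 then 1 else 0

def omz (x : Fin 3 × Fin N) : Fin 3 → Fin N → ℤ := fun t i => (om x t i : ℤ)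

theorem om_anti (x : Fin 3 × Fin N) (s) : Antitone (om x s) := by
  intro i j hij
  unfold om
  split_ifs with h1 h2
  · exact le_rfl
  · exact absurd ⟨h1.1, hij.trans h1.2⟩ h2
  · simp
  · simp

theorem exT (x : Fin 3 × Fin N) : ∃ t : AR N, t ≠ 0 ∧ t ∈ hwv (act (uI N)) ⊤ (Sum.elim (omz x) (omz x)) := by
  have h := u_char (om x) (om x) (om_anti x) (om_anti x)
  rw [if_pos rfl] at h
  have : hwv (act (uI N)) ⊤ (Sum.elim (omz x) (omz x)) ≠ ⊥ := by
    intro h0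
    have h1 : Module.finrank ℂ (hwv (act (uI N)) ⊤ (Sum.elim (omz x) (omz x))) = 1 := h
    rw [h0] at h1
    simp at h1
  obtain ⟨t, ht, h0⟩ := (Submodule.ne_bot_iff _).1 this
  exact ⟨t, h0, ht⟩

theorem tele (W : ℕ → ℤ) (i n : ℕ) (h : i ≤ n) : ∑ p ∈ Finset.Ico i n, (W p - W (p + 1)) = W i - W n := by
  induction n, h using Nat.le_induction with
  | base => simp
  | succ n hn ih => rw [Finset.sum_Ico_succ_top hn, ih]; ring

theorem om_decomp (w : Fin 3 → Fin N → ℕ) (hw : ∀ s, Antitone (w s)) :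
    ∃ c : Fin 3 × Fin N → ℕ, (fun s i => (w s i : ℤ)) = ∑ x, c x • omz x := by
  let W : Fin 3 → ℕ → ℤ := fun s k => if h : k < N then (w s ⟨k, h⟩ : ℤ) else 0
  have hW : ∀ s k, W s (k + 1) ≤ W s k := by
    intro s k
    simp only [W]
    split_ifs with h1 h2
    · have := hw s (show (⟨k, h2⟩ : Fin N) ≤ ⟨k + 1, h1⟩ from Nat.le_succ k)
      exact_mod_cast this
    · omega
    · positivity
    · exact le_rfl
  refine ⟨fun x => (W x.1 x.2 - W x.1 (x.2 + 1)).toNat, ?_⟩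
  funext s i
  rw [Finset.sum_apply, Finset.sum_apply]
  have h1 : ∀ x : Fin 3 × Fin N, ((W x.1 x.2 - W x.1 (x.2 + 1)).toNat • omz x) s i =
      if s = x.1 ∧ i ≤ x.2 then W x.1 x.2 - W x.1 (x.2 + 1) else 0 := by
    intro x
    have := hW x.1 x.2
    simp only [Pi.smul_apply, omz, om, nsmul_eq_mul]
    rw [Int.natCast_toNat_eq_self.2 (by linarith)]
    split_ifs <;> simp
  simp only [h1]
  rw [Fintype.sum_prod_type, Finset.sum_eq_single s (fun t _ ht => by simp [Ne.symm ht]) (by simp)]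
  simp only [true_and]
  have h2 : ∑ x : Fin N, (if i ≤ x then W s x - W s (x + 1) else 0) =
      ∑ p ∈ Finset.range N, (if (i : ℕ) ≤ p then W s p - W s (p + 1) else 0) := by
    rw [Finset.sum_range]
    rfl
  rw [h2, ← Finset.sum_filter]
  have h3 : Finset.filter (fun p => (i : ℕ) ≤ p) (Finset.range N) = Finset.Ico (i : ℕ) N := by
    ext p; rw [Finset.mem_filter, Finset.mem_range, Finset.mem_Ico]; tauto
  rw [h3, tele _ _ _ i.2.le]
  simp [W]

noncomputable def Cu (N : ℕ) : Subalgebra ℂ (AR N) := Algebra.adjoin ℂ (⋃ x : Fin 3 × Fin N, (↑(LH (omz x)) : Set (AR N)))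

theorem adjoin_st {A : Type} [CommRing A] [Algebra ℂ A] (S : Set A) (D : A →ₗ[ℂ] A)
    (hm : ∀ p q, D (p * q) = D p * q + p * D q) (h1 : D 1 = 0)
    (hS : ∀ p ∈ S, D p ∈ Algebra.adjoin ℂ S) : ∀ p ∈ Algebra.adjoin ℂ S, D p ∈ Algebra.adjoin ℂ S := by
  intro p hp
  induction hp using Algebra.adjoin_induction with
  | mem x hx => exact hS x hx
  | algebraMap r =>
    rw [Algebra.algebraMap_eq_smul_one, map_smul, h1, smul_zero]
    exact Subalgebra.zero_mem _
  | add x y _ _ hx hy => rw [map_add]; exact Subalgebra.add_mem _ hx hy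
  | mul x y hx' hy' hx hy =>
    rw [hm]
    exact Subalgebra.add_mem _ (Subalgebra.mul_mem _ hx hy') (Subalgebra.mul_mem _ hx' hy)

theorem Cu_st (s : Fin 3) (i j : Fin N) : ∀ p ∈ Cu N, act (rI N) s i j p ∈ Cu N := by
  refine adjoin_st _ _ (act_mul (rI N) s i j) (act_one (rI N) s i j) ?_
  intro p hp
  obtain ⟨x, hx⟩ := Set.mem_iUnion.1 hp
  exact Algebra.subset_adjoin (Set.mem_iUnion.2 ⟨x, LH_st _ s i j p hx⟩)

theorem ex_tw (w : Fin 3 → Fin N → ℕ) (hw : ∀ s, Antitone (w s)) : ∃ t ∈ Cu N, t ≠ 0 ∧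
    t ∈ hwv (act (uI N)) ⊤ (Sum.elim (fun s i => (w s i : ℤ)) (fun s i => (w s i : ℤ))) := by
  obtain ⟨c, hc⟩ := om_decomp w hw
  choose T hT0 hT using exT (N := N)
  refine ⟨∏ x, T x ^ c x, ?_, ?_, ?_⟩
  · refine Subalgebra.prod_mem _ fun x _ => Subalgebra.pow_mem _ (Algebra.subset_adjoin (Set.mem_iUnion.2 ⟨x, ?_⟩)) _
    have := (hwv_u _ _ _).1 (hT x)
    exact (mem_hwv.1 this).1
  · exact Finset.prod_ne_zero_iff.2 fun x _ => pow_ne_zero _ (hT0 x)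
  · have h := hwv_prod (I := uI N) Finset.univ (fun x => c x • Sum.elim (omz x) (omz x)) (fun x => T x ^ c x)
      (fun x _ => hwv_pow (hT x) _)
    have e : ∑ x, c x • Sum.elim (omz x) (omz x) =
        Sum.elim (fun s i => (w s i : ℤ)) (fun s i => (w s i : ℤ)) := by
      rw [hc]
      funext s i
      rcases s with s | s <;> simp [Finset.sum_apply]
    rwa [e] at h

theorem LH_le (w : Fin 3 → Fin N → ℕ) (hw : ∀ s, Antitone (w s)) :
    LH (fun s i => (w s i : ℤ)) ≤ Subalgebra.toSubmodule (Cu N) := by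
  refine hwv_gen (act_rel (rI N)) (LH_good _) (fun s i j v hv => Cu_st s i j v hv) ?_
  intro κ hκ v hv
  by_cases h0 : v = 0
  · rw [h0]; exact Submodule.zero_mem _
  have hnn := wt_nonneg (rI N) (mem_hwv.1 hv).2.1 h0
  obtain ⟨k, rfl⟩ : ∃ k : Fin 3 → Fin N → ℕ, κ = fun s i => (k s i : ℤ) :=
    ⟨fun s i => (κ s i).toNat, by funext s i; simp [hnn s i]⟩
  have hk : ∀ s, Antitone (k s) := by
    intro s i j hij
    rcases hij.eq_or_lt with h | h
    · rw [h]
    · have := hκ s i j h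
      exact Int.ofNat_le.1 this
  rw [← hwv_u] at hv
  have hc := u_char w k hw hk
  have hfd := hwv_fd (uI N) (uI_all N) (Sum.elim (fun s i => (w s i : ℤ)) fun s i => (k s i : ℤ))
  by_cases hwk : w = k
  · subst hwk
    rw [if_pos rfl] at hc
    obtain ⟨t, htC, ht0, ht⟩ := ex_tw w hw
    obtain ⟨c, hcc⟩ := (finrank_eq_one_iff_of_nonzero' (⟨t, ht⟩ : hwv (act (uI N)) ⊤ _)
      (fun h => ht0 (congrArg Subtype.val h))).1 hc ⟨v, hv⟩
    have : c • t = v := congrArg Subtype.val hcc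
    rw [← this]
    exact Submodule.smul_mem _ _ htC
  · rw [if_neg hwk, Submodule.finrank_eq_zero] at hc
    rw [hc] at hv
    exact absurd ((Submodule.mem_bot _).1 hv) h0

end C4
end AK


open scoped BigOperators
open scoped Classical
set_option linter.unusedSectionVars false
set_option linter.unusedVariables false

namespace AK

section C5
open MvPolynomial
variable {N : ℕ}

noncomputable def rho (N : ℕ) : AR N →ₐ[ℂ] OR N := rename Sum.inr

theorem rho_R (t : Fin 3 ⊕ Fin 3) (i j : Fin N) (p : AR N) :
    act (oI N) (Sum.inr t) i j (rho N p) = rho N (act (uI N) t i j p) := by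
  refine (inter (rho N) (dact (uI N) t i j) (dact (oI N) (Sum.inr t) i j) ?_ p).symm
  intro x
  have h : rho N (X x) = X (Sum.inr x) := rename_X _ _
  rw [h, ← act_apply, ← act_apply, act_X, act_X]
  by_cases h : (uI N).idx t x = some j
  · rw [if_pos h, if_pos (by exact h)]
    exact rename_X _ _
  · rw [if_neg h, if_neg (by exact h), map_zero]

theorem rho_E (s : Fin 3) (i j : Fin N) (p : AR N) :
    act (oI N) (Sum.inl s) i j (rho N p) = 0 := by
  refine (inter (rho N) 0 (dact (oI N) (Sum.inl s) i j) ?_ p).symm.trans (by simp)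
  intro x
  have h : rho N (X x) = X (Sum.inr x) := rename_X _ _
  rw [h, ← act_apply, act_X]
  simp [oI, sumIdx]

noncomputable def GC (N : ℕ) : Set (OR N) :=
  Set.range (xx N) ∪ ⋃ x : Fin 3 × Fin N, rho N '' (↑(LH (omz x)) : Set (AR N))

noncomputable def CC (N : ℕ) : Subalgebra ℂ (OR N) := Algebra.adjoin ℂ (GC N)

theorem CC_fg : (CC N).FG := by
  have hfd : ∀ x : Fin 3 × Fin N, ∃ S : Set (AR N), S.Finite ∧ Submodule.span ℂ S = LH (omz x) := by
    intro x
    have := hwv_fd (lI N) lI_all (omz x)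
    have h : (LH (omz x)).FG := (Module.Finite.iff_fg).1 this
    exact Submodule.fg_def.1 h
  choose S hS1 hS2 using hfd
  rw [Subalgebra.fg_def]
  refine ⟨Set.range (xx N) ∪ ⋃ x, rho N '' S x, ?_, ?_⟩
  · exact (Set.finite_range _).union (Set.finite_iUnion fun x => (hS1 x).image _)
  · refine le_antisymm (Algebra.adjoin_mono ?_) (Algebra.adjoin_le ?_)
    · refine Set.union_subset_union_right _ (Set.iUnion_mono fun x => Set.image_mono ?_)
      rw [← hS2]
      exact Submodule.subset_span
    · rintro p (hp | hp)
      · exact Algebra.subset_adjoin (Or.inl hp)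
      · obtain ⟨x, q, hq, rfl⟩ := Set.mem_iUnion.1 hp
        have hq' : q ∈ Submodule.span ℂ (S x) := by rw [hS2]; exact hq
        clear hp hq
        induction hq' using Submodule.span_induction with
        | mem a ha => exact Algebra.subset_adjoin (Or.inr (Set.mem_iUnion.2 ⟨x, a, ha, rfl⟩))
        | zero => rw [map_zero]; exact Subalgebra.zero_mem _
        | add a b ha hb h1 h2 =>
          rw [map_add]
          exact Subalgebra.add_mem _ h1 h2
        | smul c a ha h1 =>
          rw [map_smul]
          exact Subalgebra.smul_mem _ h1 c

theorem CC_noeth : IsNoetherianRing (CC N) := by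
  have : Algebra.FiniteType ℂ (CC N) := (Subalgebra.fg_iff_finiteType _).1 CC_fg
  exact Algebra.FiniteType.isNoetherianRing ℂ _

theorem CC_tot (s : Fin 3) (i j : Fin N) : ∀ p ∈ CC N, tot N s i j p ∈ CC N := by
  refine adjoin_st _ _ (tot_mul s i j) ?_ ?_
  · simp only [tot, LinearMap.sub_apply, act_one, sub_zero]
  · rintro p (⟨x, rfl⟩ | hp)
    · rw [tot, LinearMap.sub_apply, act_apply, act_apply, LR_xx, E_xx, sub_zero]
      split_ifs
      · exact Algebra.subset_adjoin (Or.inl ⟨_, rfl⟩)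
      · exact Subalgebra.zero_mem _
    · obtain ⟨x, q, hq, rfl⟩ := Set.mem_iUnion.1 hp
      rw [tot, LinearMap.sub_apply, rho_E, rho_R, zero_sub]
      refine Subalgebra.neg_mem _ (Algebra.subset_adjoin (Or.inr (Set.mem_iUnion.2 ⟨x, _, ?_, rfl⟩)))
      exact LH_st _ s j i q hq

theorem CC_L (s : Fin 3) (i j : Fin N) (hij : i < j) : ∀ p ∈ CC N,
    act (oI N) (Sum.inr (Sum.inl s)) i j p = 0 := by
  intro p hp
  induction hp using Algebra.adjoin_induction with
  | mem p hp =>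
    rcases hp with ⟨x, rfl⟩ | hp
    · rw [act_apply, LR_xx]
    · obtain ⟨x, q, hq, rfl⟩ := Set.mem_iUnion.1 hp
      rw [rho_R]
      have h := (mem_hwv.1 hq).2.2 s i j hij
      rw [act_lI] at h
      rw [h, map_zero]
  | algebraMap r => exact act_C _ _ _ _ r
  | add x y _ _ hx hy => rw [map_add, hx, hy, add_zero]
  | mul x y _ _ hx hy => rw [act_mul, hx, hy]; simp

theorem rho_Cu (p : AR N) (hp : p ∈ Cu N) : rho N p ∈ CC N := by
  induction hp using Algebra.adjoin_induction with
  | mem p hp =>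
    obtain ⟨x, hx⟩ := Set.mem_iUnion.1 hp
    exact Algebra.subset_adjoin (Or.inr (Set.mem_iUnion.2 ⟨x, p, hx, rfl⟩))
  | algebraMap r => rw [AlgHom.commutes]; exact Subalgebra.algebraMap_mem _ _
  | add x y _ _ hx hy => rw [map_add]; exact Subalgebra.add_mem _ hx hy
  | mul x y _ _ hx hy => rw [map_mul]; exact Subalgebra.mul_mem _ hx hy

noncomputable abbrev sg (N : ℕ) := sumAlgEquiv ℂ (TV N) (UV N)

theorem coeff_mul_C' {σ R : Type} [CommSemiring R] (m : σ →₀ ℕ) (p : MvPolynomial σ R) (a : R) :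
    coeff m (p * C a) = coeff m p * a := by
  rw [mul_comm, coeff_C_mul, mul_comm]

theorem sg_act (t : Fin 3 ⊕ Fin 3) (i j : Fin N) (p : OR N) : ∀ m : TV N →₀ ℕ,
    coeff m (sg N (act (oI N) (Sum.inr t) i j p)) = act (uI N) t i j (coeff m (sg N p)) := by
  induction p using MvPolynomial.induction_on with
  | C a =>
    intro m
    rw [act_C, map_zero, coeff_zero, sumAlgEquiv_C_inl, coeff_C]
    split_ifs
    · rw [act_C]
    · rw [map_zero]
  | add p q hp hq => intro m; simp only [map_add, coeff_add, hp, hq]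
  | mul_X p x hp =>
    intro m
    rw [act_mul]
    rcases x with x | u
    · have h : act (oI N) (Sum.inr t) i j (X (Sum.inl x)) = 0 := LR_xx t i j x
      rw [h, mul_zero, add_zero, map_mul, map_mul, sumAlgEquiv_X_inl, coeff_mul_X', coeff_mul_X']
      split_ifs
      · exact hp _
      · rw [map_zero]
    · have h : act (oI N) (Sum.inr t) i j (X (Sum.inr u)) = rho N (act (uI N) t i j (X u)) := by
        rw [← rho_R]; congr 1; exact (rename_X _ _).symm
      have h2 : ∀ q : AR N, sg N (rho N q) = C q := by
        intro q
        exact congrArg (fun f => f q) (sumAlgEquiv_comp_rename_inr ℂ (TV N) (UV N))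
      rw [h, map_add, map_mul, map_mul, map_mul, h2, sumAlgEquiv_X_inr, coeff_add, coeff_mul_C', coeff_mul_C', coeff_mul_C',
        act_mul, hp]

theorem sg_symm_mem (P : MvPolynomial (TV N) (AR N)) (h : ∀ m, coeff m P ∈ Cu N) : (sg N).symm P ∈ CC N := by
  rw [← support_sum_monomial_coeff P, map_sum]
  refine Subalgebra.sum_mem _ fun m _ => ?_
  rw [monomial_eq, map_mul]
  refine Subalgebra.mul_mem _ ?_ ?_
  · have h2 : ∀ q : AR N, (sg N).symm (C q) = rho N q := by
      intro q
      rw [AlgEquiv.symm_apply_eq]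
      exact (congrArg (fun f => f q) (sumAlgEquiv_comp_rename_inr ℂ (TV N) (UV N))).symm
    rw [h2]
    exact rho_Cu _ (h m)
  · rw [Finsupp.prod, map_prod]
    refine Subalgebra.prod_mem _ fun x _ => ?_
    rw [map_pow, sumAlgEquiv_symm_X]
    have hx : (X (Sum.inl x) : OR N) ∈ CC N := Algebra.subset_adjoin (Or.inl ⟨x, rfl⟩)
    exact Subalgebra.pow_mem _ hx _

theorem phi_mem {κ : Fin 3 → Fin N → ℤ} (hn : ∀ s i, 0 ≤ κ s i) (hd : Dom κ) {p : SR N}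
    (hp : p ∈ hwv (act (tI N)) ⊤ κ) : phi N p ∈ CC N := by
  rw [← (sg N).symm_apply_apply (phi N p)]
  refine sg_symm_mem _ fun m => ?_
  have hLH : coeff m (sg N (phi N p)) ∈ LH κ := by
    rw [LH, mem_hwv]
    rw [mem_hwv] at hp
    refine ⟨trivial, fun s i => ?_, fun s i j hij => ?_⟩
    · rw [act_lI, ← sg_act, ← phi_L, hp.2.1 s i, map_smul, map_smul, coeff_smul]
    · rw [act_lI, ← sg_act, ← phi_L, hp.2.2 s i j hij, map_zero, map_zero, coeff_zero]
  obtain ⟨k, rfl⟩ : ∃ k : Fin 3 → Fin N → ℕ, κ = fun s i => (k s i : ℤ) :=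
    ⟨fun s i => (κ s i).toNat, by funext s i; simp [hn s i]⟩
  refine LH_le k ?_ hLH
  intro s i j hij
  rcases hij.eq_or_lt with h | h
  · rw [h]
  · have := hd s i j h
    exact Int.ofNat_le.1 this

end C5
end AK


open scoped BigOperators
open scoped Classical
set_option linter.unusedSectionVars false
set_option linter.unusedVariables false

namespace AK

section C6
open MvPolynomial
variable {N : ℕ}

theorem wt_mul {ι Y : Type} [Fintype ι] [Fintype Y] {I : Idx ι N Y} {κ κ' : ι → Fin N → ℤ} {p q : MvPolynomial Y ℂ}
    (hp : p ∈ wt (act I) κ) (hq : q ∈ wt (act I) κ') : p * q ∈ wt (act I) (κ + κ') := by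
  intro s i
  rw [act_mul, hp s i, hq s i]
  simp only [Pi.add_apply, Int.cast_add, add_smul, smul_mul_assoc, mul_smul_comm]

theorem mem_Wd_sup {Y : Type} (p : MvPolynomial Y ℂ) {D : ℕ} (h : p.support.sup Finsupp.degree ≤ D) :
    p ∈ Wd Y D := by
  rw [Wd, mem_restrictSupport_iff]
  intro m hm
  exact (Finset.le_sup (f := Finsupp.degree) hm).trans h

/-- vectors killed by the raising operators -/
def Nil (e : Fin 3 → Fin N → Fin N → Module.End ℂ (SR N)) : Submodule ℂ (SR N) where
  carrier := {v | ∀ s i j, i < j → e s i j v = 0}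
  add_mem' := by
    intro a b ha hb s i j h
    rw [map_add, ha s i j h, hb s i j h, add_zero]
  zero_mem' := by intro s i j h; exact map_zero _
  smul_mem' := by
    intro c a ha s i j h
    rw [map_smul, ha s i j h, smul_zero]

theorem Nil_st (s : Fin 3) (i : Fin N) (v : SR N) (hv : v ∈ Nil (act (tI N))) :
    act (tI N) s i i v ∈ Nil (act (tI N)) := by
  intro t k l hkl
  have hr := act_rel (tI N)
  by_cases h : t = s
  · subst h
    have := congrArg (fun f => f v) (hr.same t k l i i)
    simp only [Module.End.mul_apply, LinearMap.sub_apply, LinearMap.add_apply] at this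
    rw [this, hv t k l hkl, map_zero]
    have h1 : (if l = i then act (tI N) t k i else 0) v = 0 := by
      split_ifs with h
      · subst h; exact hv _ _ _ hkl
      · rfl
    have h2 : (if i = k then act (tI N) t i l else 0) v = 0 := by
      split_ifs with h
      · subst h; exact hv _ _ _ hkl
      · rfl
    rw [h1, h2]; simp
  · have := congrArg (fun f => f v) (hr.diff t s h k l i i)
    simp only [Module.End.mul_apply] at this
    rw [this, hv t k l hkl, map_zero]

theorem extract (b : SR N) (hb : b ∈ Nil (act (tI N))) (κ0 : Fin 3 → Fin N → ℤ) :
    ∃ g ∈ hwv (act (tI N)) ⊤ κ0, b - g ∈ ⨆ κ, ⨆ (_ : κ ≠ κ0), wt (act (tI N)) κ := by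
  obtain ⟨F, f, hf, hs⟩ := good_dec (Wd_good (tI N) _) (mem_Wd_sup b le_rfl)
  have hc := comp_mem (act (tI N)) (Nil (act (tI N))) Nil_st F f (fun κ _ => (hf κ).2) (by rw [hs]; exact hb)
  have hsum : ∀ G : Finset (Fin 3 → Fin N → ℤ), κ0 ∉ G →
      ∑ κ ∈ G, f κ ∈ ⨆ κ, ⨆ (_ : κ ≠ κ0), wt (act (tI N)) κ := by
    intro G hG
    refine Submodule.sum_mem _ fun κ hκ => ?_
    have hne : κ ≠ κ0 := fun h => hG (h ▸ hκ)
    exact Submodule.mem_iSup_of_mem κ (Submodule.mem_iSup_of_mem hne (hf κ).2)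
  by_cases h0 : κ0 ∈ F
  · refine ⟨f κ0, ?_, ?_⟩
    · rw [mem_hwv]
      exact ⟨trivial, (hf κ0).2, hc κ0 h0⟩
    · rw [← hs, ← Finset.add_sum_erase _ _ h0, add_sub_cancel_left]
      exact hsum _ (Finset.notMem_erase _ _)
  · refine ⟨0, Submodule.zero_mem _, ?_⟩
    rw [sub_zero, ← hs]
    exact hsum _ h0

theorem cas_tot_mul (p m : OR N) (hm : ∀ s i j, tot N s i j m = 0) :
    cas (tot N) (p * m) = cas (tot N) p * m := by
  unfold cas
  simp only [LinearMap.sum_apply, Module.End.mul_apply, tot_mul, hm, mul_zero, add_zero, Finset.sum_mul]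

theorem R_mul (r : Polynomial ℂ) (p m : OR N) (hm : ∀ s i j, tot N s i j m = 0) :
    Polynomial.aeval (cas (tot N)) r (p * m) = Polynomial.aeval (cas (tot N)) r p * m := by
  induction r using Polynomial.induction_on' with
  | add a b ha hb => simp only [map_add, LinearMap.add_apply, ha, hb, add_mul]
  | monomial n a =>
    have h : ∀ n, ((cas (tot N)) ^ n) (p * m) = ((cas (tot N)) ^ n) p * m := by
      intro n
      induction n with
      | zero => simp
      | succ n ih => rw [pow_succ', Module.End.mul_apply, Module.End.mul_apply, ih, cas_tot_mul _ _ hm]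
    simp only [Polynomial.aeval_monomial, Module.End.mul_apply, Module.algebraMap_end_apply, h, smul_mul_assoc]

theorem R_mem (r : Polynomial ℂ) (p : OR N) (hp : p ∈ CC N) :
    Polynomial.aeval (cas (tot N)) r p ∈ CC N := by
  induction r using Polynomial.induction_on' with
  | add a b ha hb => rw [map_add, LinearMap.add_apply]; exact Subalgebra.add_mem _ ha hb
  | monomial n a =>
    have h : ∀ n, ((cas (tot N)) ^ n) p ∈ CC N := by
      intro n
      induction n with
      | zero => simpa using hp
      | succ n ih =>
        rw [pow_succ', Module.End.mul_apply]
        exact cas_mem (W := Subalgebra.toSubmodule (CC N)) CC_tot ih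
    simp only [Polynomial.aeval_monomial, Module.End.mul_apply, Module.algebraMap_end_apply]
    exact Subalgebra.smul_mem _ (h n) _

theorem R_phi (r : Polynomial ℂ) (hr : r.eval 0 = 1) (p : SR N) :
    Polynomial.aeval (cas (tot N)) r (phi N p) = phi N p := by
  rw [aeval_inv _ r, hr, one_smul]
  unfold cas
  simp only [LinearMap.sum_apply, Module.End.mul_apply, phi_tot, map_zero, Finset.sum_const_zero]

/-- the generators give module generators over the invariants -/
theorem gens (b : OR N → OR N) (S : Finset (OR N)) (hb : ∀ c ∈ S, b c ∈ CC N) (H : OR N → SR N)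
    (hH : ∀ c ∈ S, phi N (H c) = c) (p : SR N) (hp : ∑ c ∈ S, b c * c = phi N p) :
    ∃ g : OR N → SR N, (∀ c ∈ S, g c ∈ Nil (act (tI N))) ∧ p = ∑ c ∈ S, g c * H c := by
  obtain ⟨r, hr0, hr⟩ := reynolds tot_rel (tot_good (N := N) (S.sup fun c => (b c).support.sup Finsupp.degree))
  refine ⟨fun c => ev N (Polynomial.aeval (cas (tot N)) r (b c)), ?_, ?_⟩
  · intro c hc s i j hij
    rw [ev_tot, hr, CC_L s i j hij _ (R_mem r _ (hb c hc)), add_zero, map_zero]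
    refine mem_Wd_sup _ ?_
    exact Finset.le_sup (f := fun c => (b c).support.sup Finsupp.degree) hc
  · rw [← ev_phi p, ← R_phi r hr0 p, ← hp, map_sum, map_sum]
    refine Finset.sum_congr rfl fun c hc => ?_
    rw [R_mul, map_mul]
    · congr 1
      rw [← hH c hc, ev_phi, hH c hc]
    · intro s i j
      rw [← hH c hc, phi_tot]

theorem bounded (a l : Fin 3 → Fin N → ℤ) (hn : ∀ d : ℕ, ∀ s i, 0 ≤ (l + d • a) s i)
    (hd : ∀ d : ℕ, Dom (l + d • a)) (h1 : ∀ z : ℤ, Module.finrank ℂ (hwv (act (tI N)) ⊤ (z • a)) ≤ 1) :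
    ∃ r, ∀ d : ℕ, Module.finrank ℂ (hwv (act (tI N)) ⊤ (l + d • a)) ≤ r := by
  have hno : IsNoetherianRing (CC N) := CC_noeth
  let S : Set (CC N) := {c | ∃ d : ℕ, ∃ h ∈ hwv (act (tI N)) ⊤ (l + d • a), phi N h = c.1}
  have hfg : (Submodule.span (CC N) S).FG := IsNoetherian.noetherian _
  obtain ⟨T, hTS, hT⟩ := Submodule.fg_span_iff_fg_span_finset_subset S |>.1 hfg
  have hch : ∀ c : CC N, ∃ d : ℕ, ∃ h : SR N, c ∈ T → (h ∈ hwv (act (tI N)) ⊤ (l + d • a) ∧ phi N h = c.1) := by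
    intro c
    by_cases hc : c ∈ T
    · obtain ⟨d, h, h1, h2⟩ := hTS hc
      exact ⟨d, h, fun _ => ⟨h1, h2⟩⟩
    · exact ⟨0, 0, fun h => absurd h hc⟩
  choose dd H hH using hch
  refine ⟨T.card, fun d => ?_⟩
  have hgen : ∀ z : ℤ, ∃ v : SR N, ∀ w ∈ hwv (act (tI N)) ⊤ (z • a), ∃ c : ℂ, c • v = w := by
    intro z
    have := hwv_fd (tI N) (tI_all N) (z • a)
    obtain ⟨v, hv⟩ := finrank_le_one_iff.1 (h1 z)
    refine ⟨v, fun w hw => ?_⟩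
    obtain ⟨c, hc⟩ := hv ⟨w, hw⟩
    exact ⟨c, congrArg Subtype.val hc⟩
  choose G hG using hgen
  have hle : hwv (act (tI N)) ⊤ (l + d • a) ≤
      Submodule.span ℂ (↑(T.image fun c => G ((d : ℤ) - dd c) * H c) : Set (SR N)) := by
    intro h hh
    have hmem : (⟨phi N h, phi_mem (hn d) (hd d) hh⟩ : CC N) ∈ Submodule.span (CC N) (T : Set (CC N)) := by
      rw [← hT]
      exact Submodule.subset_span ⟨d, h, hh, rfl⟩
    obtain ⟨f, -, hf⟩ := Submodule.mem_span_finset.1 hmem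
    have hf' : ∑ c ∈ T, (f c).1 * c.1 = phi N h := by
      have := congrArg Subtype.val hf
      simpa using this
    obtain ⟨g, hg1, hg2⟩ : ∃ g : CC N → SR N, (∀ c ∈ T, g c ∈ Nil (act (tI N))) ∧ h = ∑ c ∈ T, g c * H c := by
      have q1 : ∀ c ∈ T.image Subtype.val, (if hc : c ∈ CC N then (f ⟨c, hc⟩).1 else 0) ∈ CC N := by
        intro c0 hc0
        obtain ⟨c, hc1, rfl⟩ := Finset.mem_image.1 hc0
        rw [dif_pos c.2]
        exact (f c).2
      have q2 : ∀ c ∈ T.image Subtype.val, phi N (if hc : c ∈ CC N then H ⟨c, hc⟩ else 0) = c := by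
        intro c0 hc0
        obtain ⟨c, hc1, rfl⟩ := Finset.mem_image.1 hc0
        rw [dif_pos c.2]
        exact (hH c hc1).2
      have q3 : ∑ c ∈ T.image Subtype.val, (if hc : c ∈ CC N then (f ⟨c, hc⟩).1 else 0) * c = phi N h := by
        rw [← hf', Finset.sum_image (fun x _ y _ h => Subtype.ext h)]
        refine Finset.sum_congr rfl fun c _ => ?_
        rw [dif_pos c.2]
      obtain ⟨g, hg1, hg2⟩ := gens (fun c => if hc : c ∈ CC N then (f ⟨c, hc⟩).1 else 0)
        (T.image Subtype.val) q1 (fun c => if hc : c ∈ CC N then H ⟨c, hc⟩ else 0) q2 h q3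
      refine ⟨fun c => g c.1, fun c hc => hg1 _ (Finset.mem_image_of_mem _ hc), ?_⟩
      rw [hg2, Finset.sum_image (fun x _ y _ h => Subtype.ext h)]
      refine Finset.sum_congr rfl fun c _ => ?_
      rw [dif_pos c.2]
    have hex : ∀ c : CC N, ∃ u : SR N, c ∈ T → (u ∈ hwv (act (tI N)) ⊤ (((d : ℤ) - dd c) • a) ∧
        g c - u ∈ ⨆ κ, ⨆ (_ : κ ≠ ((d : ℤ) - dd c) • a), wt (act (tI N)) κ) := by
      intro c
      by_cases hc : c ∈ T
      · obtain ⟨u, hu⟩ := extract (g c) (hg1 c hc) (((d : ℤ) - dd c) • a)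
        exact ⟨u, fun _ => hu⟩
      · exact ⟨0, fun h => absurd h hc⟩
    choose u hu using hex
    have hw : ∀ c : CC N, ((d : ℤ) - dd c) • a + (l + dd c • a) = l + d • a := by
      intro c
      rw [sub_smul, natCast_zsmul, natCast_zsmul]; abel
    have heq : h = ∑ c ∈ T, u c * H c := by
      rw [← sub_eq_zero]
      have hdis := wt_disj (act (tI N)) (l + d • a)
      refine (Submodule.disjoint_def.1 hdis) _ ?_ ?_
      · refine Submodule.sub_mem _ (mem_hwv.1 hh).2.1 (Submodule.sum_mem _ fun c hc => ?_)
        have := wt_mul (mem_hwv.1 (hu c hc).1).2.1 (mem_hwv.1 (hH c hc).1).2.1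
        rwa [hw] at this
      · rw [hg2, ← Finset.sum_sub_distrib]
        refine Submodule.sum_mem _ fun c hc => ?_
        rw [← sub_mul]
        have hle : (⨆ κ, ⨆ (_ : κ ≠ ((d : ℤ) - dd c) • a), wt (act (tI N)) κ) ≤
            (⨆ κ, ⨆ (_ : κ ≠ l + d • a), wt (act (tI N)) κ).comap (LinearMap.mulRight ℂ (H c)) := by
          refine iSup₂_le fun κ hκ p hp => ?_
          rw [Submodule.mem_comap, LinearMap.mulRight_apply]
          have h2 := wt_mul hp (mem_hwv.1 (hH c hc).1).2.1
          have hne : κ + (l + dd c • a) ≠ l + d • a := by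
            rw [← hw c]
            exact fun h => hκ (add_right_cancel h)
          exact Submodule.mem_iSup_of_mem _ (Submodule.mem_iSup_of_mem hne h2)
        exact hle (hu c hc).2
    rw [heq]
    refine Submodule.sum_mem _ fun c hc => ?_
    obtain ⟨k, hk⟩ := hG _ (u c) (hu c hc).1
    rw [← hk, smul_mul_assoc]
    exact Submodule.smul_mem _ _ (Submodule.subset_span (Finset.mem_coe.2 (Finset.mem_image_of_mem _ hc)))
  calc _ ≤ Module.finrank ℂ (Submodule.span ℂ (↑(T.image fun c => G ((d : ℤ) - dd c) * H c) : Set (SR N))) :=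
        Submodule.finrank_mono hle
    _ ≤ _ := finrank_span_finset_le_card _
    _ ≤ _ := Finset.card_image_le

end C6
end AK


open scoped BigOperators
open scoped Classical
set_option linter.unusedSectionVars false
set_option linter.unusedVariables false

namespace AK

section C7
open MvPolynomial Partition'
variable {N : ℕ}

theorem hwv_zero_le : Module.finrank ℂ (hwv (act (tI N)) ⊤ (0 : Fin 3 → Fin N → ℤ)) ≤ 1 := by
  refine finrank_le_one (⟨1, hwv_one⟩ : hwv (act (tI N)) ⊤ 0) ?_
  rintro ⟨w, hw⟩
  have h := wt_le_Wd (tI N) (tI_all N) (κ := 0) (D := 0) (by simp) (mem_hwv.1 hw).2.1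
  rw [Wd, mem_restrictSupport_iff] at h
  refine ⟨coeff 0 w, Subtype.ext ?_⟩
  show coeff 0 w • (1 : SR N) = w
  ext m
  rw [coeff_smul, coeff_one, smul_eq_mul]
  split_ifs with hm
  · rw [← hm, mul_one]
  · rw [mul_zero]
    by_contra hc
    have h1 : m.degree ≤ 0 := h (mem_support_iff.2 (Ne.symm hc))
    exact hm ((Finsupp.degree_eq_zero_iff m).1 (Nat.le_zero.1 h1)).symm

theorem vec_add (l : Partition') (d : ℕ) (a : Partition') : vec N (l + d • a) = vec N l + d • vec N a := by
  funext i
  have : (l + d • a).1 i = l.1 i + d * a.1 i := rfl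
  simp [vec, this]

theorem vec_smul (d : ℕ) (a : Partition') : vec N (d • a) = d • vec N a := by
  funext i
  have : (d • a).1 i = d * a.1 i := rfl
  simp [vec, this]

theorem vec3_add (l m p a b c : Partition') (d : ℕ) :
    (![vec N (l + d • a), vec N (m + d • b), vec N (p + d • c)] : Fin 3 → Fin N → ℤ) =
      ![vec N l, vec N m, vec N p] + d • ![vec N a, vec N b, vec N c] := by
  funext s
  fin_cases s <;> simp [vec_add]

theorem vec3_smul (a b c : Partition') (d : ℕ) :
    (![vec N (d • a), vec N (d • b), vec N (d • c)] : Fin 3 → Fin N → ℤ) =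
      d • ![vec N a, vec N b, vec N c] := by
  funext s
  fin_cases s <;> simp [vec_smul]

theorem size_smul (d : ℕ) (a : Partition') : size (d • a) = d * size a := by
  have h : ∀ k, a.plength ≤ k → a.1 k = 0 := fun k hk => part_zero' hk
  have h' : ∀ k, a.plength ≤ k → (d • a).1 k = 0 := by
    intro k hk
    have : (d • a).1 k = d * a.1 k := rfl
    rw [this, h k hk, mul_zero]
  have e1 := size_eq h
  have e2 := size_eq h'
  rw [vec_smul] at e2
  have : (size (d • a) : ℤ) = d * size a := by
    rw [← e1, ← e2, Finset.mul_sum]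
    simp
  exact_mod_cast this

theorem ev_const (f : ℕ → ℕ) (hf : ∀ d, f d ≤ f (d + 1)) (r : ℕ) (hr : ∀ d, f d ≤ r) :
    ∃ M, ∀ d, M ≤ d → f d = f M := by
  have hm : Monotone f := monotone_nat_of_le_succ hf
  have hb : BddAbove (Set.range f) := ⟨r, by rintro _ ⟨d, rfl⟩; exact hr d⟩
  obtain ⟨M, hM⟩ := Nat.sSup_mem (Set.range_nonempty f) hb
  refine ⟨M, fun d hd => le_antisymm ?_ (hm hd)⟩
  rw [hM]
  exact le_csSup hb ⟨d, rfl⟩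

theorem mono_step (a l : Fin 3 → Fin N → ℤ) {t : SR N} (ht : t ∈ hwv (act (tI N)) ⊤ a) (h0 : t ≠ 0) :
    Module.finrank ℂ (hwv (act (tI N)) ⊤ l) ≤ Module.finrank ℂ (hwv (act (tI N)) ⊤ (l + a)) := by
  have hfd := hwv_fd (tI N) (tI_all N) (l + a)
  have hinj : Function.Injective (LinearMap.mulRight ℂ t) := fun p q h => mul_right_cancel₀ h0 h
  rw [(Submodule.equivMapOfInjective _ hinj _).finrank_eq]
  refine Submodule.finrank_mono ?_
  rintro _ ⟨p, hp, rfl⟩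
  exact hwv_mul hp ht

theorem main_aux (α β γ : Partition')
    (hαβ : size α = size β) (hβγ : size β = size γ)
    (h : ∀ d : ℕ, 0 < d → kron (d • α) (d • β) (d • γ) = 1) (l m nu : Partition') :
    ∃ N : ℕ, ∀ d : ℕ, N ≤ d →
      aguiar (l + d • α) (m + d • β) (nu + d • γ) =
        aguiar (l + N • α) (m + N • β) (nu + N • γ) := by
  obtain ⟨n, hα, hβ, hγ, hl, hm, hnu⟩ : ∃ n, (∀ k, n ≤ k → α.1 k = 0) ∧ (∀ k, n ≤ k → β.1 k = 0) ∧
      (∀ k, n ≤ k → γ.1 k = 0) ∧ (∀ k, n ≤ k → l.1 k = 0) ∧ (∀ k, n ≤ k → m.1 k = 0) ∧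
      (∀ k, n ≤ k → nu.1 k = 0) :=
    ⟨α.plength + β.plength + γ.plength + l.plength + m.plength + nu.plength,
      fun k hk => part_zero' (by omega), fun k hk => part_zero' (by omega),
      fun k hk => part_zero' (by omega), fun k hk => part_zero' (by omega),
      fun k hk => part_zero' (by omega), fun k hk => part_zero' (by omega)⟩
  have hs : ∀ (p : Partition') (d : ℕ), (∀ k, n ≤ k → p.1 k = 0) → ∀ k, n ≤ k → (d • p).1 k = 0 := by
    intro p d hp k hk
    have : (d • p).1 k = d * p.1 k := rfl
    rw [this, hp k hk, mul_zero]
  have hsa : ∀ (q p : Partition') (d : ℕ), (∀ k, n ≤ k → q.1 k = 0) → (∀ k, n ≤ k → p.1 k = 0) →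
      ∀ k, n ≤ k → (q + d • p).1 k = 0 := by
    intro q p d hq hp k hk
    have : (q + d • p).1 k = q.1 k + d * p.1 k := rfl
    rw [this, hp k hk, hq k hk, mul_zero, add_zero]
  set a : Fin 3 → Fin n → ℤ := ![vec n α, vec n β, vec n γ] with ha
  set L : Fin 3 → Fin n → ℤ := ![vec n l, vec n m, vec n nu] with hL
  have hk : ∀ d : ℕ, 0 < d → Module.finrank ℂ (hwv (act (tI n)) ⊤ (d • a)) = 1 := by
    intro d hd
    rw [← h d hd, kron_dim (n := n) _ _ _ (hs _ d hα) (hs _ d hβ) (hs _ d hγ)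
      (by rw [size_smul, size_smul, hαβ, hβγ]) (by rw [size_smul, size_smul, hβγ]), vec3_smul]
  have hag : ∀ d : ℕ, aguiar (l + d • α) (m + d • β) (nu + d • γ) =
      Module.finrank ℂ (hwv (act (tI n)) ⊤ (L + d • a)) := by
    intro d
    rw [aguiar_dim (n := n) _ _ _ (hsa _ _ d hl hα) (hsa _ _ d hm hβ) (hsa _ _ d hnu hγ), vec3_add]
  have h1 : ∀ z : ℤ, Module.finrank ℂ (hwv (act (tI n)) ⊤ (z • a)) ≤ 1 := by
    intro z
    rcases lt_trichotomy z 0 with hz | hz | hz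
    · by_contra hc
      have hne : hwv (act (tI n)) ⊤ (z • a) ≠ ⊥ := by
        intro h0
        rw [h0, finrank_bot] at hc
        omega
      obtain ⟨p, hp, hp0⟩ := (Submodule.ne_bot_iff _).1 hne
      have hnn := wt_nonneg (tI n) (mem_hwv.1 hp).2.1 hp0
      have ha0 : z • a = 0 := by
        funext s i
        have q1 := hnn s i
        have q2 : 0 ≤ a s i := vec_nn α β γ s i
        have q3 : (z • a) s i = z * a s i := rfl
        rw [q3] at q1 ⊢
        exact le_antisymm (mul_nonpos_of_nonpos_of_nonneg hz.le q2) q1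
      rw [ha0] at hc
      exact hc hwv_zero_le
    · rw [hz, zero_smul]; exact hwv_zero_le
    · obtain ⟨d, rfl⟩ := Int.eq_ofNat_of_zero_le hz.le
      rw [natCast_zsmul]
      exact (hk d (by omega)).le
  obtain ⟨r, hr⟩ := bounded a L (fun d => by rw [ha, hL, ← vec3_add]; exact vec_nn _ _ _)
    (fun d => by rw [ha, hL, ← vec3_add]; exact vec_dom _ _ _) h1
  obtain ⟨t, ht, ht0⟩ : ∃ t ∈ hwv (act (tI n)) ⊤ a, t ≠ 0 := by
    refine (Submodule.ne_bot_iff _).1 fun h0 => ?_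
    have := hk 1 one_pos
    rw [one_smul, h0, finrank_bot] at this
    omega
  simp only [hag]
  refine ev_const (fun d => Module.finrank ℂ (hwv (act (tI n)) ⊤ (L + d • a))) (fun d => ?_) r hr
  have := mono_step a (L + d • a) ht ht0
  rwa [add_assoc, ← succ_nsmul] at this

end C7
end AK

open Partition' in
/-- If `α, β, γ` have equal size and the Kronecker coefficient `g_{dα,dβ,dγ}` equals 1 for
all positive integers `d`, then `(α,β;γ)` is Aguiar-stable: for every triple of partitions
`(λ,μ,ν)` the sequence `d ↦ a_{λ+dα,μ+dβ}^{ν+dγ}` is eventually constant. -/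
theorem aguiar_stable_of_kron_stable (α β γ : Partition')
    (hαβ : size α = size β) (hβγ : size β = size γ)
    (h : ∀ d : ℕ, 0 < d → kron (d • α) (d • β) (d • γ) = 1) :
    ∀ l m nu : Partition', ∃ N : ℕ, ∀ d : ℕ, N ≤ d →
      aguiar (l + d • α) (m + d • β) (nu + d • γ) =
        aguiar (l + N • α) (m + N • β) (nu + N • γ) := by
  intro l m nu
  exact AK.main_aux α β γ hαβ hβγ h l m nu
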